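/- arXiv:2008.05152 — 5 statements merged into one kernel-verified Lean document; each statement's English description precedes it below -/
import Mathlib

section
/- Let (X,d) be a complete metric space that is relatively K ball connected for some K > 1, let ε ∈ (0,1) and let N = N_X(ε) be the integer from the relative ball connectedness condition. Then for every pair of distinct points x, y ∈ X there exists a map γ : [0,1] → X with γ(0) = x, γ(1) = y such that: (i) d(x, γ(t)) ≤ K·d(x,y)/(1−ε) for all t ∈ [0,1]; and (ii) for every integer k ≥ 0, whenever t₁, t₂ ∈ [0,1] satisfy |t₁ − t₂| ≤ N^{−k}, one has d(γ(t₁), γ(t₂)) ≤ (2K/(1−ε) + 1)·ε^k·d(x,y). In particular γ is continuous (indeed Hölder continuous). -/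
/-- The chain condition at scale `ε` within dilation factor `K`, with chains of length `N`. -/
def ChainCond (X : Type*) [MetricSpace X] (ε K : ℝ) (N : ℕ) : Prop :=
  ∀ (x₀ : X) (R : ℝ), 0 < R →
    ∀ x ∈ closure (Metric.ball x₀ R), ∀ y ∈ closure (Metric.ball x₀ R),
      ∃ z : ℕ → X, z 0 = x ∧ z N = y ∧
        (∀ i ≤ N, Metric.ball (z i) (ε * R) ⊆ Metric.ball x₀ (K * R)) ∧
        ∀ i, 1 ≤ i → i ≤ N → dist (z (i - 1)) (z i) < ε * R

/-- Relative `K` ball connectedness with a specified function `ε ↦ N_X(ε)` giving the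
number of balls in the chain condition. -/
def RBCWith (X : Type*) [MetricSpace X] (K : ℝ) (N : ℝ → ℕ) : Prop :=
  ∀ ε ∈ Set.Ioo (0:ℝ) 1, ChainCond X ε K (N ε)

open Set Filter Topology

/-- A version of the chain condition for points strictly inside the ball. -/
lemma ChainCond.exists_chain {X : Type*} [MetricSpace X] {ε K : ℝ} {N : ℕ}
    (h : ChainCond X ε K N) (hε : 0 < ε) {o p q : X} {r : ℝ}
    (hp : dist o p < r) (hq : dist o q < r) :
    ∃ z : ℕ → X, z 0 = p ∧ z N = q ∧ (∀ i ≤ N, dist o (z i) < K * r) ∧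
      ∀ i < N, dist (z i) (z (i + 1)) < ε * r := by
  have hr : 0 < r := dist_nonneg.trans_lt hp
  obtain ⟨z, h0, hN, hb, hd⟩ := h o r hr p (subset_closure (by rwa [Metric.mem_ball']))
    q (subset_closure (by rwa [Metric.mem_ball']))
  refine ⟨z, h0, hN, fun i hi => ?_, fun i hi => ?_⟩
  · have := hb i hi (Metric.mem_ball_self (mul_pos hε hr))
    rwa [Metric.mem_ball'] at this
  · simpa using hd (i + 1) (by omega) hi

lemma ChainCond.two_le {X : Type*} [MetricSpace X] {ε K : ℝ} {N : ℕ}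
    (h : ChainCond X ε K N) (hε : ε ∈ Ioo (0 : ℝ) 1) {x y : X} (hxy : x ≠ y) : 2 ≤ N := by
  have hd : 0 < dist x y := dist_pos.2 hxy
  have hlt : dist x y < dist x y / ε := by
    rw [lt_div_iff₀ hε.1]; nlinarith [hε.2]
  obtain ⟨z, h0, hN, -, hz⟩ := h.exists_chain hε.1 (o := x) (p := x) (q := y)
    (r := dist x y / ε) (by rw [dist_self]; exact hd.trans hlt) hlt
  by_contra! hlt2
  interval_cases N
  · exact hxy (h0.symm.trans hN)
  · have := hz 0 one_pos
    rw [h0, zero_add, hN, mul_div_cancel₀ _ hε.1.ne'] at this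
    exact this.false

/-- Repeatedly inserting chains gives a Hölder path, with a non-optimal constant. -/
lemma ChainCond.exists_path {X : Type*} [MetricSpace X] [CompleteSpace X] {ε K : ℝ} {N : ℕ}
    (h : ChainCond X ε K N) (hε : ε ∈ Ioo (0 : ℝ) 1) (hN : 2 ≤ N) {p q : X} {r : ℝ}
    (hpq : dist p q < r) :
    ∃ γ : ℝ → X, γ 0 = p ∧ γ 1 = q ∧ ∀ k : ℕ, ∀ s ≥ 0, ∀ t ≥ 0, |s - t| ≤ ((N : ℝ) ^ k)⁻¹ →
      dist (γ s) (γ t) ≤ (2 * (K / (1 - ε)) + 1) * ε ^ k * r := by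
  have hr : 0 < r := dist_nonneg.trans_lt hpq
  have hN0 : 0 < N := by omega
  have hNR : (0 : ℝ) < N := by exact_mod_cast hN0
  have key : ∀ (a b : X) (ρ : ℝ), ∃ z : ℕ → X, dist a b < ρ → z 0 = a ∧ z N = b ∧
      (∀ i ≤ N, dist a (z i) < K * ρ) ∧ ∀ i < N, dist (z i) (z (i + 1)) < ε * ρ := by
    intro a b ρ
    by_cases hab : dist a b < ρ
    · obtain ⟨z, hz⟩ := h.exists_chain hε.1 (o := a) (p := a)
        (by rw [dist_self]; exact dist_nonneg.trans_lt hab) hab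
      exact ⟨z, fun _ => hz⟩
    · exact ⟨fun _ => a, fun h => absurd h hab⟩
  choose c hc using key
  let v : ℕ → ℕ → X := fun n => Nat.rec (fun i => if i = 0 then p else q)
    (fun n w i => c (w (i / N)) (w (i / N + 1)) (ε ^ n * r) (i % N)) n
  have v_succ : ∀ n i, v (n + 1) i =
    c (v n (i / N)) (v n (i / N + 1)) (ε ^ n * r) (i % N) := fun _ _ => rfl
  have hstep : ∀ n i, dist (v n i) (v n (i + 1)) < ε ^ n * r := by
    intro n
    induction n with
    | zero =>
      intro i
      rcases i with _ | i
      · simpa [v] using hpq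
      · simpa [v] using hr
    | succ n ih =>
      intro i
      have hi := hc _ _ _ (ih (i / N))
      have hmod := Nat.mod_lt i hN0
      have hs := hi.2.2.2 _ hmod
      have e : ε ^ (n + 1) * r = ε * (ε ^ n * r) := by ring
      rw [v_succ, v_succ, e]
      by_cases hlt : i % N + 1 < N
      · have h1 : (i + 1) % N = i % N + 1 := by
          rw [Nat.add_mod, Nat.mod_eq_of_lt (show 1 < N by omega), Nat.mod_eq_of_lt hlt]
        have h2 : (i + 1) / N = i / N := by
          rw [Nat.div_eq_iff hN0]
          have := Nat.div_add_mod' i N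
          constructor <;> lia
        rwa [h1, h2]
      · have h3 : i % N + 1 = N := by omega
        have h4 : i + 1 = N * (i / N + 1) := by
          have := Nat.div_add_mod i N
          rw [mul_add]; omega
        have h1 : (i + 1) % N = 0 := by rw [h4]; simp
        have h2 : (i + 1) / N = i / N + 1 := by rw [h4]; exact Nat.mul_div_cancel_left _ hN0
        rw [h1, h2, (hc _ _ _ (ih (i / N + 1))).1]
        rwa [h3, hi.2.1] at hs
  let u : ℝ → ℕ → X := fun t n => v n ⌊(N : ℝ) ^ n * t⌋₊
  have hu : ∀ t n, dist (u t n) (u t (n + 1)) ≤ K * r * ε ^ n := by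
    intro t n
    have e : ⌊(N : ℝ) ^ (n + 1) * t⌋₊ / N = ⌊(N : ℝ) ^ n * t⌋₊ := by
      rw [← Nat.floor_div_natCast]
      congr 1
      field_simp
      ring
    have := (hc _ _ _ (hstep n ⌊(N : ℝ) ^ n * t⌋₊)).2.2.1
      (⌊(N : ℝ) ^ (n + 1) * t⌋₊ % N) (Nat.mod_lt _ hN0).le
    simp only [u]
    rw [v_succ, e]
    exact this.le.trans_eq (by ring)
  have hlim : ∀ t, ∃ a, Tendsto (u t) atTop (𝓝 a) := fun t =>
    cauchySeq_tendsto_of_complete (cauchySeq_of_le_geometric _ _ hε.2 (hu t))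
  choose γ hγ using hlim
  have hdist : ∀ t n, dist (u t n) (γ t) ≤ K * r * ε ^ n / (1 - ε) := fun t n =>
    dist_le_of_le_geometric_of_tendsto _ _ hε.2 (hu t) (hγ t) n
  have v_mul : ∀ n i, v (n + 1) (N * i) = v n i := by
    intro n i
    rw [v_succ, Nat.mul_mod_right, (hc _ _ _ (hstep n _)).1, Nat.mul_div_cancel_left _ hN0]
  have v_pow : ∀ n i, v n (N ^ n * i) = if i = 0 then p else q := by
    intro n i
    induction n with
    | zero => simp [v]
    | succ n ih => rw [pow_succ', mul_assoc, v_mul, ih]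
  have hend : ∀ i : ℕ, γ i = if i = 0 then p else q := by
    intro i
    refine tendsto_nhds_unique (hγ i) ?_
    have : u i = fun _ => if i = 0 then p else q := by
      funext n
      simp only [u]
      rw [← v_pow n i]
      congr 1
      exact_mod_cast Nat.floor_natCast (N ^ n * i)
    rw [this]
    exact tendsto_const_nhds
  refine ⟨γ, by simpa using hend 0, by simpa using hend 1, ?_⟩
  intro k s hs t ht hst
  wlog hle : s ≤ t generalizing s t
  · rw [dist_comm]
    exact this t ht s hs (by rwa [abs_sub_comm]) (le_of_not_ge hle)
  have hNk : (0 : ℝ) < (N : ℝ) ^ k := by positivity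
  have hmid : dist (u s k) (u t k) ≤ ε ^ k * r := by
    have h1 : ⌊(N : ℝ) ^ k * s⌋₊ ≤ ⌊(N : ℝ) ^ k * t⌋₊ := Nat.floor_mono (by gcongr)
    have h2 : ⌊(N : ℝ) ^ k * t⌋₊ ≤ ⌊(N : ℝ) ^ k * s⌋₊ + 1 := by
      rw [← Nat.floor_add_one (by positivity)]
      apply Nat.floor_mono
      rw [abs_sub_comm, abs_of_nonneg (by linarith)] at hst
      have := mul_le_mul_of_nonneg_left hst hNk.le
      rw [mul_inv_cancel₀ hNk.ne'] at this
      linarith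
    simp only [u]
    rcases (by omega : ⌊(N : ℝ) ^ k * t⌋₊ = ⌊(N : ℝ) ^ k * s⌋₊ ∨
      ⌊(N : ℝ) ^ k * t⌋₊ = ⌊(N : ℝ) ^ k * s⌋₊ + 1) with h3 | h3
    · rw [h3, dist_self]; have := hε.1; positivity
    · rw [h3]; exact (hstep k _).le
  calc dist (γ s) (γ t) ≤ dist (γ s) (u s k) + dist (u s k) (u t k) + dist (u t k) (γ t) :=
        dist_triangle4 _ _ _ _
    _ ≤ K * r * ε ^ k / (1 - ε) + ε ^ k * r + K * r * ε ^ k / (1 - ε) := by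
        gcongr
        · rw [dist_comm]; exact hdist s k
        · exact hdist t k
    _ = _ := by ring

/-- Paths `g i` on `[0, ℓ]` from `u i` to `u (i + 1)` can be run one after the other, with pauses of
length `w` in between, so that times at most `w` apart see a single one of the paths. -/
lemma exists_glue {X : Type*} {n : ℕ} (hn : 1 ≤ n) {ℓ w : ℝ} (hℓ : 0 ≤ ℓ) (hw : 0 < w)
    (u : ℕ → X) (g : ℕ → ℝ → X) (hg0 : ∀ i < n, g i 0 = u i) (hg1 : ∀ i < n, g i ℓ = u (i + 1)) :
    ∃ f : ℝ → X, f 0 = u 0 ∧ f (n * (ℓ + w) - w) = u n ∧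
      ∀ s ∈ Icc 0 (n * (ℓ + w) - w), ∀ t ∈ Icc 0 (n * (ℓ + w) - w), |s - t| ≤ w →
        ∃ i < n, ∃ s' ∈ Icc 0 ℓ, ∃ t' ∈ Icc 0 ℓ, |s' - t'| ≤ |s - t| ∧
          f s = g i s' ∧ f t = g i t' := by
  have hc : 0 < ℓ + w := by linarith
  let a : ℝ → ℕ := fun t => ⌊t / (ℓ + w)⌋₊
  let b : ℝ → ℝ := fun t => min (t - a t * (ℓ + w)) ℓ
  have a_le : ∀ t, 0 ≤ t → a t * (ℓ + w) ≤ t := fun t ht => by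
    rw [← le_div_iff₀ hc]; exact Nat.floor_le (by positivity)
  have lt_a : ∀ t, t < (a t + 1) * (ℓ + w) := fun t => by
    rw [← div_lt_iff₀ hc]; exact Nat.lt_floor_add_one _
  have a_eq : ∀ (i : ℕ) (t : ℝ), i * (ℓ + w) ≤ t → t < (i + 1) * (ℓ + w) → a t = i := by
    intro i t h1 h2
    have : 0 ≤ t := le_trans (by positivity) h1
    exact (Nat.floor_eq_iff (by positivity)).2
      ⟨by rwa [le_div_iff₀ hc], by rwa [div_lt_iff₀ hc]⟩
  have a_lt : ∀ t, 0 ≤ t → t ≤ n * (ℓ + w) - w → a t < n := by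
    intro t h0 h1
    have : (a t : ℝ) * (ℓ + w) < n * (ℓ + w) := by linarith [a_le t h0]
    exact_mod_cast lt_of_mul_lt_mul_right this hc.le
  have b_mem : ∀ t, 0 ≤ t → b t ∈ Icc 0 ℓ := fun t ht =>
    ⟨le_min (by linarith [a_le t ht]) hℓ, min_le_right _ _⟩
  refine ⟨fun t => g (a t) (b t), ?_, ?_, ?_⟩
  · have h0 : a 0 = 0 := by simp [a]
    have h1 : b 0 = 0 := by simp [b, h0, hℓ]
    simp only [h0, h1]
    exact hg0 0 (by omega)
  · obtain ⟨m, rfl⟩ : ∃ m, n = m + 1 := ⟨n - 1, by omega⟩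
    have h0 : a ((m + 1 : ℕ) * (ℓ + w) - w) = m := by
      apply a_eq <;> push_cast <;> nlinarith
    have h1 : b ((m + 1 : ℕ) * (ℓ + w) - w) = ℓ := by
      simp only [b, h0]
      push_cast
      rw [min_eq_right]
      linarith
    simp only [h0, h1]
    exact hg1 m (by omega)
  · intro s hs t ht hst
    wlog hle : s ≤ t generalizing s t
    · obtain ⟨i, hi, t', ht', s', hs', h1, h2, h3⟩ :=
        this t ht s hs (by rwa [abs_sub_comm]) (le_of_not_ge hle)
      exact ⟨i, hi, s', hs', t', ht', by rwa [abs_sub_comm s', abs_sub_comm s], h3, h2⟩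
    have hst' : |s - t| = t - s := by rw [abs_sub_comm, abs_of_nonneg (by linarith)]
    rw [hst'] at hst ⊢
    by_cases hsame : a t = a s
    · refine ⟨a s, a_lt s hs.1 hs.2, b s, b_mem s hs.1, b t, b_mem t ht.1, ?_, rfl, ?_⟩
      · have := abs_min_sub_min_le_max (s - a s * (ℓ + w)) ℓ (t - a t * (ℓ + w)) ℓ
        rw [hsame] at this
        simp only [b, hsame]
        refine this.trans (max_le ?_ (by simpa using hle))
        rw [abs_le]; constructor <;> linarith
      · simp only [hsame]
    · have hmono : a s ≤ a t := Nat.floor_mono (by gcongr)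
      have hsucc : a t = a s + 1 := by
        apply a_eq
        · have h1 : a s + 1 ≤ a t := by omega
          have h2 : ((a s + 1 : ℕ) : ℝ) ≤ a t := by exact_mod_cast h1
          exact (mul_le_mul_of_nonneg_right h2 hc.le).trans (a_le t ht.1)
        · push_cast
          linarith [lt_a s]
      have ht1 := a_le t ht.1
      have ht2 := a_lt t ht.1 ht.2
      have hs1 := lt_a s
      rw [hsucc] at ht1
      push_cast at ht1
      by_cases hsℓ : s - a s * (ℓ + w) ≤ ℓ
      · have hts : t = (a s + 1) * (ℓ + w) ∧ b s = ℓ := by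
          have : t = (a s + 1) * (ℓ + w) := by linarith
          exact ⟨this, min_eq_right (by linarith)⟩
        have hbt : b t = 0 := by
          simp only [b, hsucc]
          push_cast
          rw [hts.1, sub_self, min_eq_left hℓ]
        refine ⟨a t, ht2, 0, ⟨le_rfl, hℓ⟩, 0, ⟨le_rfl, hℓ⟩, by simpa using hle, ?_, ?_⟩
        · simp only [hts.2]
          rw [hg1 _ (by omega), hg0 _ ht2, hsucc]
        · simp only [hbt]
      · have hbs : b s = ℓ := min_eq_right (by linarith)
        refine ⟨a t, ht2, 0, ⟨le_rfl, hℓ⟩, b t, b_mem t ht.1, ?_, ?_, rfl⟩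
        · rw [abs_sub_comm, sub_zero, abs_of_nonneg (b_mem t ht.1).1]
          refine (min_le_left _ _).trans ?_
          rw [hsucc]
          push_cast
          linarith
        · simp only [hbs]
          rw [hg1 _ (by omega), hg0 _ ht2, hsucc]

/-- Any two points of a ball of radius `r` about `o` are joined by a path of duration `L` that stays
within `A * r` of `o`, and moves by at most `B * ε ^ k * r` in time `N⁻ᵏ`. -/
def HasHolderPaths (X : Type*) [MetricSpace X] (ε : ℝ) (N : ℕ) (B L A : ℝ) : Prop :=
  ∀ (o p q : X) (r : ℝ), dist o p < r → dist o q < r → ∃ γ : ℝ → X, γ 0 = p ∧ γ L = q ∧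
    (∀ t ∈ Icc 0 L, dist o (γ t) ≤ A * r) ∧
    ∀ k : ℕ, ∀ s ∈ Icc 0 L, ∀ t ∈ Icc 0 L, |s - t| ≤ ((N : ℝ) ^ k)⁻¹ →
      dist (γ s) (γ t) ≤ B * ε ^ k * r

/-- A sufficiently fine chain gives paths that take long but have a smaller excursion. -/
lemma exists_hasHolderPaths {X : Type*} [MetricSpace X] [CompleteSpace X] {ε K : ℝ} {N : ℝ → ℕ}
    (hK : 0 < K) (hRBC : RBCWith X K N) (hε : ε ∈ Ioo (0 : ℝ) 1) [Nontrivial X] :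
    ∃ L A, 0 ≤ L ∧ A < K / (1 - ε) ∧ HasHolderPaths X ε (N ε) (2 * (K / (1 - ε))) L A := by
  obtain ⟨x, y, hxy⟩ := exists_pair_ne X
  have h1ε : 0 < 1 - ε := sub_pos.2 hε.2
  set E := K / (1 - ε) with hE
  have hEpos : 0 < E := by positivity
  have hEeq : K + ε * E = E := by rw [hE]; field_simp; ring
  have hC : 0 < 2 * E + 1 := by positivity
  obtain ⟨η, hη0, hη1⟩ : ∃ η, 0 < η ∧ η < min 1 (ε * E / (2 * E + 1)) :=
    exists_between (lt_min one_pos (by have := hε.1; positivity))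
  have hη2 : (2 * E + 1) * η < ε * E := by
    have := (lt_div_iff₀ hC).1 (hη1.trans_le (min_le_right _ _))
    linarith
  have hηmem : η ∈ Ioo (0 : ℝ) 1 := ⟨hη0, hη1.trans_le (min_le_left _ _)⟩
  have hM := (hRBC η hηmem).two_le hηmem hxy
  have hN := (hRBC ε hε).two_le hε hxy
  have hMR : (2 : ℝ) ≤ N η := by exact_mod_cast hM
  have hNR : (1 : ℝ) ≤ N ε := by exact_mod_cast (by omega : 1 ≤ N ε)
  refine ⟨N η * (1 + 1) - 1, K + (2 * E + 1) * η, by linarith, by linarith, ?_⟩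
  intro o p q r hp hq
  have hr : 0 < r := dist_nonneg.trans_lt hp
  obtain ⟨z, h0, h1, hz, hstep⟩ := (hRBC η hηmem).exists_chain hη0 hp hq
  choose! g hg0 hg1 hg using fun i hi => (hRBC ε hε).exists_path hε hN (hstep i hi)
  obtain ⟨f, hf0, hf1, hf⟩ := exists_glue (by omega : 1 ≤ N η) zero_le_one one_pos z g hg0 hg1
  refine ⟨f, hf0.trans h0, hf1.trans h1, fun t ht => ?_, fun k s hs t ht hst => ?_⟩
  · obtain ⟨i, hi, t', ht', -, -, -, e, -⟩ := hf t ht t ht (by simp)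
    have h2 := hg i hi 0 0 le_rfl t' ht'.1 (by simpa [abs_of_nonneg ht'.1] using ht'.2)
    rw [hg0 i hi, pow_zero, mul_one] at h2
    rw [e]
    calc dist o (g i t') ≤ dist o (z i) + dist (z i) (g i t') := dist_triangle _ _ _
      _ ≤ K * r + (2 * E + 1) * (η * r) := add_le_add (hz i hi.le).le h2
      _ = _ := by ring
  · obtain ⟨i, hi, s', hs', t', ht', hst', e1, e2⟩ :=
      hf s hs t ht (hst.trans (inv_le_one_of_one_le₀ (one_le_pow₀ hNR)))
    rw [e1, e2]
    refine (hg i hi k s' hs'.1 t' ht'.1 (hst'.trans hst)).trans ?_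
    have : (2 * E + 1) * η ≤ 2 * E := by nlinarith [hε.2]
    have h3 : 0 ≤ ε ^ k * r := by have := hε.1; positivity
    calc (2 * E + 1) * ε ^ k * (η * r) = (2 * E + 1) * η * (ε ^ k * r) := by ring
      _ ≤ 2 * E * (ε ^ k * r) := by gcongr
      _ = _ := by ring

/-- Two consecutive steps of a chain lie in a ball about their common point, so they can be covered
by a single path; this leaves time for a pause. -/
lemma HasHolderPaths.step {X : Type*} [MetricSpace X] {ε K B L A : ℝ} {N : ℕ}
    (h : HasHolderPaths X ε N B L A) (hc : ChainCond X ε K N) (hε : ε ∈ Ioo (0 : ℝ) 1)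
    (hN : 2 ≤ N) (hL : 0 ≤ L) (hB : 2 * (K + ε * A) ≤ B) :
    HasHolderPaths X ε N B (((N + 1) / 2 : ℕ) * (L / N + (N : ℝ)⁻¹) - (N : ℝ)⁻¹) (K + ε * A) := by
  intro o p q r hp hq
  have hr : 0 < r := dist_nonneg.trans_lt hp
  have hNR : (0 : ℝ) < N := by exact_mod_cast (by omega : 0 < N)
  have hN1 : (1 : ℝ) ≤ N := by exact_mod_cast (by omega : 1 ≤ N)
  obtain ⟨z, h0, h1, hz, hstep⟩ := hc.exists_chain hε.1 hp hq
  have hpaths : ∀ i < (N + 1) / 2, ∃ γ : ℝ → X, γ 0 = z (2 * i) ∧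
      γ L = z (min (2 * (i + 1)) N) ∧ (∀ t ∈ Icc 0 L, dist (z (2 * i + 1)) (γ t) ≤ A * (ε * r)) ∧
      ∀ k : ℕ, ∀ s ∈ Icc 0 L, ∀ t ∈ Icc 0 L, |s - t| ≤ ((N : ℝ) ^ k)⁻¹ →
        dist (γ s) (γ t) ≤ B * ε ^ k * (ε * r) := by
    intro i hi
    refine h _ _ _ _ ?_ ?_
    · rw [dist_comm]; exact hstep _ (by omega)
    · rcases le_or_gt (2 * (i + 1)) N with hle | hlt
      · rw [min_eq_left hle]; exact hstep (2 * i + 1) (by omega)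
      · rw [min_eq_right hlt.le, show N = 2 * i + 1 by omega, dist_self]
        exact mul_pos hε.1 hr
  have : Nonempty X := ⟨o⟩
  choose! g hg0 hg1 hge hg using hpaths
  obtain ⟨f, hf0, hf1, hf⟩ := exists_glue (n := (N + 1) / 2) (by omega)
    (ℓ := L / N) (w := (N : ℝ)⁻¹) (by positivity) (by positivity)
    (fun i => z (min (2 * i) N)) (fun i t => g i (N * t))
    (fun i hi => by rw [mul_zero, hg0 i hi, min_eq_left (by omega)])
    (fun i hi => by rw [mul_div_cancel₀ _ hNR.ne', hg1 i hi])
  have hscale : ∀ t ∈ Icc 0 (L / N), (N : ℝ) * t ∈ Icc 0 L := fun t ht =>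
    ⟨by have := ht.1; positivity, by have := (le_div_iff₀ hNR).1 ht.2; linarith⟩
  have hexc : ∀ t ∈ Icc 0 (((N + 1) / 2 : ℕ) * (L / N + (N : ℝ)⁻¹) - (N : ℝ)⁻¹),
      dist o (f t) ≤ (K + ε * A) * r := by
    intro t ht
    obtain ⟨i, hi, t', ht', -, -, -, e, -⟩ := hf t ht t ht (by simp)
    rw [e]
    calc dist o (g i (N * t')) ≤ dist o (z (2 * i + 1)) + dist (z (2 * i + 1)) (g i (N * t')) :=
          dist_triangle _ _ _
      _ ≤ K * r + A * (ε * r) :=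
          add_le_add (hz _ (by omega)).le (hge i hi _ (hscale t' ht'))
      _ = _ := by ring
  refine ⟨f, by simpa using hf0.trans (by simpa using h0), hf1.trans ?_, hexc, ?_⟩
  · rw [min_eq_right (by omega), h1]
  · intro k s hs t ht hst
    rcases k with _ | k
    · calc dist (f s) (f t) ≤ dist o (f s) + dist o (f t) := dist_triangle_left _ _ _
        _ ≤ (K + ε * A) * r + (K + ε * A) * r := add_le_add (hexc s hs) (hexc t ht)
        _ = 2 * (K + ε * A) * r := by ring
        _ ≤ B * ε ^ 0 * r := by rw [pow_zero, mul_one]; gcongr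
    · have hle : ((N : ℝ) ^ (k + 1))⁻¹ ≤ (N : ℝ)⁻¹ := by
        gcongr
        exact le_self_pow₀ hN1 (by omega)
      obtain ⟨i, hi, s', hs', t', ht', hst', e1, e2⟩ := hf s hs t ht (hst.trans hle)
      rw [e1, e2]
      refine (hg i hi k _ (hscale s' hs') _ (hscale t' ht') ?_).trans_eq (by ring)
      rw [← mul_sub, abs_mul, abs_of_pos hNR]
      calc (N : ℝ) * |s' - t'| ≤ N * ((N : ℝ) ^ (k + 1))⁻¹ := by gcongr; exact hst'.trans hst
        _ = ((N : ℝ) ^ k)⁻¹ := by field_simp; ring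

/-- There are paths with excursion strictly better than `K / (1 - ε)` whose duration is as close to
`1` as desired. -/
lemma exists_hasHolderPaths_of_pos {X : Type*} [MetricSpace X] [CompleteSpace X] {ε K : ℝ}
    {N : ℝ → ℕ} (hK : 0 < K) (hRBC : RBCWith X K N) (hε : ε ∈ Ioo (0 : ℝ) 1) [Nontrivial X]
    {η : ℝ} (hη : 0 < η) :
    ∃ L A, 0 ≤ L ∧ L ≤ 1 + η ∧ A < K / (1 - ε) ∧
      HasHolderPaths X ε (N ε) (2 * (K / (1 - ε))) L A := by
  obtain ⟨x, y, hxy⟩ := exists_pair_ne X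
  have h1ε : 0 < 1 - ε := sub_pos.2 hε.2
  have hN := (hRBC ε hε).two_le hε hxy
  have hNR : (2 : ℝ) ≤ N ε := by exact_mod_cast hN
  have hEeq : K + ε * (K / (1 - ε)) = K / (1 - ε) := by field_simp; ring
  obtain ⟨L₀, A₀, hL₀, hA₀, h₀⟩ := exists_hasHolderPaths hK hRBC hε
  have hiter : ∀ j : ℕ, ∃ L A, 0 ≤ L ∧ L ≤ 1 + (3 / 4) ^ j * L₀ ∧ A < K / (1 - ε) ∧
      HasHolderPaths X ε (N ε) (2 * (K / (1 - ε))) L A := by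
    intro j
    induction j with
    | zero => exact ⟨L₀, A₀, hL₀, by linarith, hA₀, h₀⟩
    | succ j ih =>
      obtain ⟨L, A, hL, hLj, hA, h⟩ := ih
      have hA' : K + ε * A < K / (1 - ε) := by nlinarith [hε.1]
      refine ⟨_, _, ?_, ?_, hA', h.step (hRBC ε hε) hε hN hL (by linarith)⟩
      · have h1 : (1 : ℝ) ≤ ((N ε + 1) / 2 : ℕ) := by
          exact_mod_cast (by omega : 1 ≤ (N ε + 1) / 2)
        have h2 : 0 ≤ L / N ε := by positivity
        have h3 : 0 ≤ (N ε : ℝ)⁻¹ := by positivity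
        nlinarith
      · have h1 : (((N ε + 1) / 2 : ℕ) : ℝ) ≤ (N ε + 1) / 2 := by
          have := @Nat.cast_div_le ℝ _ _ _ (N ε + 1) 2
          exact_mod_cast this
        have hc : 0 ≤ (3 / 4 : ℝ) ^ j * L₀ := by positivity
        set c := (3 / 4 : ℝ) ^ j * L₀
        have h2 : ((N ε + 1) / 2 : ℕ) * (L / N ε + (N ε : ℝ)⁻¹) - (N ε : ℝ)⁻¹ =
            (((N ε + 1) / 2 : ℕ) * (L + 1) - 1) / N ε := by field_simp
        rw [h2, div_le_iff₀ (by linarith), pow_succ, mul_right_comm]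
        have h3 : (((N ε + 1) / 2 : ℕ) : ℝ) * (L + 1) ≤ (N ε + 1) / 2 * (2 + c) :=
          mul_le_mul h1 (by linarith) (by linarith) (by linarith)
        change _ ≤ (1 + c * (3 / 4)) * _
        nlinarith
  obtain ⟨j, hj⟩ : ∃ j : ℕ, (3 / 4 : ℝ) ^ j * L₀ < η := by
    have : Tendsto (fun j : ℕ => (3 / 4 : ℝ) ^ j * L₀) atTop (𝓝 (0 * L₀)) :=
      (tendsto_pow_atTop_nhds_zero_of_lt_one (by norm_num) (by norm_num)).mul_const _
    rw [zero_mul] at this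
    exact (this.eventually (gt_mem_nhds hη)).exists
  obtain ⟨L, A, h1, h2, h3, h4⟩ := hiter j
  exact ⟨L, A, h1, by linarith, h3, h4⟩

/-- Let `(X,d)` be a complete metric space that is relatively `K` ball
connected for some `K > 1`, with chain function `ε ↦ N_X(ε)`.  Fix `ε ∈ (0,1)` and put
`N = N_X(ε)`.  Then any two distinct points `x ≠ y` are joined by a map `γ : [0,1] → X`
with `γ 0 = x`, `γ 1 = y`, such that
(i) `d(x, γ t) ≤ K d(x,y)/(1-ε)` for all `t ∈ [0,1]`, and
(ii) for every `k : ℕ`, if `|t₁ - t₂| ≤ N⁻ᵏ` then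
`d(γ t₁, γ t₂) ≤ (2K/(1-ε) + 1) εᵏ d(x,y)`.  In particular `γ` is continuous. -/
theorem rbc_holder_path
    {X : Type*} [MetricSpace X] [CompleteSpace X]
    (K : ℝ) (hK : 1 < K) (N : ℝ → ℕ) (hRBC : RBCWith X K N)
    (ε : ℝ) (hε : ε ∈ Set.Ioo (0:ℝ) 1) :
    ∀ x y : X, x ≠ y → ∃ γ : ℝ → X,
      γ 0 = x ∧ γ 1 = y ∧
      (∀ t ∈ Set.Icc (0:ℝ) 1, dist x (γ t) ≤ K * dist x y / (1 - ε)) ∧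
      (∀ k : ℕ, ∀ t₁ ∈ Set.Icc (0:ℝ) 1, ∀ t₂ ∈ Set.Icc (0:ℝ) 1,
        |t₁ - t₂| ≤ ((N ε : ℝ) ^ k)⁻¹ →
        dist (γ t₁) (γ t₂) ≤ (2 * K / (1 - ε) + 1) * ε ^ k * dist x y) ∧
      ContinuousOn γ (Set.Icc 0 1) := by
  intro x y hxy
  have : Nontrivial X := ⟨x, y, hxy⟩
  have hd : 0 < dist x y := dist_pos.2 hxy
  have h1ε : 0 < 1 - ε := sub_pos.2 hε.2
  have hK0 : 0 < K := by linarith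
  have hN := (hRBC ε hε).two_le hε hxy
  have hNR : (0 : ℝ) < N ε := by exact_mod_cast (by omega : 0 < N ε)
  set E := K / (1 - ε) with hE
  have hEpos : 0 < E := by positivity
  obtain ⟨m, hm⟩ : ∃ m : ℕ, ε ^ m < 1 / (4 * E) :=
    exists_pow_lt_of_lt_one (by positivity) hε.2
  have hm' : 2 * E * (1 + ε ^ m) < 2 * E + 1 := by
    rw [lt_div_iff₀ (by positivity)] at hm
    linarith
  obtain ⟨L, A, hL0, hL1, hA, h⟩ := exists_hasHolderPaths_of_pos hK0 hRBC hε
    (η := ((N ε : ℝ) ^ m)⁻¹) (by positivity)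
  obtain ⟨δ, hδ, hAδ, hBδ⟩ : ∃ δ : ℝ, 1 < δ ∧ A * δ ≤ E ∧ 2 * E * (1 + ε ^ m) * δ ≤ 2 * E + 1 := by
    have hA' : ∀ᶠ δ : ℝ in 𝓝[>] 1, A * δ < E :=
      ((continuous_const_mul A).tendsto' 1 A (mul_one A)).mono_left nhdsWithin_le_nhds
        |>.eventually (gt_mem_nhds hA)
    have hB' : ∀ᶠ δ : ℝ in 𝓝[>] 1, 2 * E * (1 + ε ^ m) * δ < 2 * E + 1 :=
      ((continuous_const_mul _).tendsto' 1 _ (mul_one _)).mono_left nhdsWithin_le_nhds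
        |>.eventually (gt_mem_nhds hm')
    obtain ⟨δ, h1, h2, h3⟩ := (hA'.and (hB'.and self_mem_nhdsWithin)).exists
    exact ⟨δ, h3, h1.le, h2.le⟩
  obtain ⟨γ, h0, h1, hexc, hmod⟩ := h x x y (δ * dist x y)
    (by rw [dist_self]; positivity) (by nlinarith)
  have hscale : ∀ t ∈ Icc (0 : ℝ) 1, L * t ∈ Icc 0 L := fun t ht =>
    ⟨mul_nonneg hL0 ht.1, mul_le_of_le_one_right hL0 ht.2⟩
  have hii : ∀ k : ℕ, ∀ t₁ ∈ Icc (0:ℝ) 1, ∀ t₂ ∈ Icc (0:ℝ) 1,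
      |t₁ - t₂| ≤ ((N ε : ℝ) ^ k)⁻¹ →
      dist (γ (L * t₁)) (γ (L * t₂)) ≤ (2 * K / (1 - ε) + 1) * ε ^ k * dist x y := by
    intro k s hs t ht hst
    wlog hle : s ≤ t generalizing s t
    · rw [dist_comm]
      exact this t ht s hs (by rwa [abs_sub_comm]) (le_of_not_ge hle)
    rw [abs_sub_comm, abs_of_nonneg (by linarith)] at hst
    have hk : 0 < ((N ε : ℝ) ^ k)⁻¹ := by positivity
    have hs' := hscale s hs
    have ht' := hscale t ht
    have hle' : L * s ≤ L * t := by gcongr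
    have hlen : L * t - L * s ≤ ((N ε : ℝ) ^ k)⁻¹ + ((N ε : ℝ) ^ (k + m))⁻¹ := by
      calc L * t - L * s = L * (t - s) := by ring
        _ ≤ (1 + ((N ε : ℝ) ^ m)⁻¹) * ((N ε : ℝ) ^ k)⁻¹ :=
          mul_le_mul hL1 hst (by linarith) (by positivity)
        _ = _ := by rw [pow_add, mul_inv]; ring
    have hkm : 0 < ((N ε : ℝ) ^ (k + m))⁻¹ := by positivity
    obtain ⟨c, hc1, hc2, hc3, hc4⟩ : ∃ c, L * s ≤ c ∧ c ≤ L * t ∧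
        c - L * s ≤ ((N ε : ℝ) ^ k)⁻¹ ∧ L * t - c ≤ ((N ε : ℝ) ^ (k + m))⁻¹ := by
      refine ⟨min (L * t) (L * s + ((N ε : ℝ) ^ k)⁻¹), le_min hle' (by linarith), min_le_left _ _,
        by linarith [min_le_right (L * t) (L * s + ((N ε : ℝ) ^ k)⁻¹)], ?_⟩
      rcases min_cases (L * t) (L * s + ((N ε : ℝ) ^ k)⁻¹) with h | h <;> linarith
    have hc : c ∈ Icc 0 L := ⟨hs'.1.trans hc1, hc2.trans ht'.2⟩
    have hpos : 0 ≤ ε ^ k * dist x y := by have := hε.1; positivity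
    calc dist (γ (L * s)) (γ (L * t)) ≤ dist (γ (L * s)) (γ c) + dist (γ c) (γ (L * t)) :=
          dist_triangle _ _ _
      _ ≤ 2 * E * ε ^ k * (δ * dist x y) + 2 * E * ε ^ (k + m) * (δ * dist x y) := by
          refine add_le_add (hmod k _ hs' _ hc ?_) (hmod (k + m) _ hc _ ht' ?_)
          · rwa [abs_sub_comm, abs_of_nonneg (by linarith)]
          · rwa [abs_sub_comm, abs_of_nonneg (by linarith)]
      _ = 2 * E * (1 + ε ^ m) * δ * (ε ^ k * dist x y) := by ring
      _ ≤ (2 * E + 1) * (ε ^ k * dist x y) := by gcongr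
      _ = _ := by rw [hE]; ring
  refine ⟨fun t => γ (L * t), by simpa using h0, by simpa using h1, fun t ht => ?_, hii, ?_⟩
  · calc dist x (γ (L * t)) ≤ A * (δ * dist x y) := hexc _ (hscale t ht)
      _ = A * δ * dist x y := by ring
      _ ≤ E * dist x y := by gcongr
      _ = _ := by rw [hE]; ring
  · rw [Metric.continuousOn_iff]
    intro t ht η hη
    have hC : 0 < (2 * K / (1 - ε) + 1) * dist x y := by positivity
    obtain ⟨k, hk⟩ : ∃ k : ℕ, ε ^ k < η / ((2 * K / (1 - ε) + 1) * dist x y) :=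
      exists_pow_lt_of_lt_one (by positivity) hε.2
    refine ⟨((N ε : ℝ) ^ k)⁻¹, by positivity, fun s hs hst => ?_⟩
    refine (hii k s hs t ht (by rw [← Real.dist_eq]; exact hst.le)).trans_lt ?_
    rw [lt_div_iff₀ hC] at hk
    linarith
end

section
/- Let (X,d) be a complete metric space that is relatively ball connected and metric doubling. Then (X,d) is quasi-arc connected. -/
/-- A distortion function: an increasing homeomorphism of `[0,∞)` onto itself. -/
structure IsDistortion (η : ℝ → ℝ) : Prop where
  strictMonoOn : StrictMonoOn η (Set.Ici 0)
  continuousOn : ContinuousOn η (Set.Ici 0)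
  map_zero : η 0 = 0
  surjOn : Set.SurjOn η (Set.Ici 0) (Set.Ici 0)

/-- A metric space `(X,d)` is quasi-arc connected if there is a distortion function `η`
such that any two distinct points `x, y` are the endpoints of an `η`-quasisymmetric image
of `[0,1]` in `X`.  (A continuous injective map on the compact interval `[0,1]` is a
homeomorphism onto its image `J ⊆ X`.) -/
def QuasiArcConnected (X : Type*) [MetricSpace X] : Prop :=
  ∃ η : ℝ → ℝ, IsDistortion η ∧
    ∀ x y : X, x ≠ y → ∃ γ : ℝ → X,
      γ 0 = x ∧ γ 1 = y ∧
      ContinuousOn γ (Set.Icc 0 1) ∧ Set.InjOn γ (Set.Icc 0 1) ∧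
      ∀ s ∈ Set.Icc (0:ℝ) 1, ∀ a ∈ Set.Icc (0:ℝ) 1, ∀ b ∈ Set.Icc (0:ℝ) 1,
        s ≠ b → dist (γ s) (γ a) ≤ η (|s - a| / |s - b|) * dist (γ s) (γ b)

/-- Relative `K` ball connectedness. -/
def IsRBC (X : Type*) [MetricSpace X] (K : ℝ) : Prop :=
  ∀ ε ∈ Set.Ioo (0:ℝ) 1, ∃ N : ℕ, ChainCond X ε K N

/-- Metric doubling: there is `N ≥ 2` such that every ball of radius `R` is covered by `N`
balls of radius `R/2`. -/
def MetricDoubling (X : Type*) [MetricSpace X] : Prop :=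
  ∃ N : ℕ, 2 ≤ N ∧ ∀ (x : X) (R : ℝ), 0 < R → ∃ z : Fin N → X,
    Metric.ball x R ⊆ ⋃ i, Metric.ball (z i) (R / 2)

section QuasiArcs

open Set Metric Finset

/-- A finite chain `z 0, …, z L` from `x` to `y` in `S` with steps shorter than `δ`. -/
structure IsPath {X : Type*} [MetricSpace X] (S : Set X) (δ : ℝ) (x y : X) (L : ℕ)
    (z : ℕ → X) : Prop where
  start : z 0 = x
  finish : z L = y
  mem : ∀ i ≤ L, z i ∈ S
  step : ∀ i < L, dist (z i) (z (i + 1)) < δ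

/-- `y` can be reached from `x` by a chain in `S` with steps shorter than `δ` whose total
`w`-weight (not counting the last point) is at most `c`. -/
def Reach {X : Type*} [MetricSpace X] (S : Set X) (δ : ℝ) (w : X → ℝ) (x y : X) (c : ℝ) : Prop :=
  ∃ L z, IsPath S δ x y L z ∧ ∑ i ∈ range L, w (z i) ≤ c

/-- Any two points at distance less than `R` are joined inside the ball of radius `κ * R` by a
chain of at most `N` steps shorter than `ε * R`. -/
def ChainLinked (X : Type*) [MetricSpace X] (κ ε N : ℝ) : Prop :=
  ∀ (x y : X) (R : ℝ), dist x y < R → Reach (ball x (κ * R)) (ε * R) (fun _ => 1) x y N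

section Paths

variable {X : Type*} [MetricSpace X] {S : Set X} {δ : ℝ} {w : X → ℝ} {x y v : X}

theorem IsPath.concat {L L' : ℕ} {z z' : ℕ → X} (h : IsPath S δ x y L z)
    (h' : IsPath S δ y v L' z') :
    ∃ z'', IsPath S δ x v (L + L') z'' ∧
      ∑ i ∈ range (L + L'), w (z'' i) = ∑ i ∈ range L, w (z i) + ∑ i ∈ range L', w (z' i) := by
  have hL : ∀ i, L ≤ i → (if i < L then z i else z' (i - L)) = z' (i - L) := by
    intro i hi; rw [if_neg (by omega)]
  have hl : ∀ i, i ≤ L → (if i < L then z i else z' (i - L)) = z i := by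
    intro i hi
    split_ifs with h1
    · rfl
    · obtain rfl : i = L := by omega
      simp [h.finish, h'.start]
  refine ⟨fun i => if i < L then z i else z' (i - L), ⟨?_, ?_, ?_, ?_⟩, ?_⟩
  · show (if 0 < L then z 0 else z' (0 - L)) = x
    rw [hl 0 (by omega), h.start]
  · show (if L + L' < L then z _ else z' (L + L' - L)) = v
    rw [hL _ (by omega), Nat.add_sub_cancel_left, h'.finish]
  · intro i hi
    show (if i < L then z i else z' (i - L)) ∈ S
    rcases le_total i L with h1 | h1
    · rw [hl i h1]; exact h.mem i h1
    · rw [hL i h1]; exact h'.mem _ (by omega)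
  · intro i hi
    show dist (if i < L then z i else z' (i - L))
      (if i + 1 < L then z (i + 1) else z' (i + 1 - L)) < δ
    rcases lt_or_ge i L with h1 | h1
    · rw [hl i h1.le, hl (i + 1) h1]; exact h.step i h1
    · rw [hL i h1, hL (i + 1) (by omega), show i + 1 - L = (i - L) + 1 by omega]
      exact h'.step _ (by omega)
  · rw [sum_range_add]
    congr 1
    · refine sum_congr rfl fun i hi => ?_
      simp only [Finset.mem_range] at hi
      simp [hi]
    · refine sum_congr rfl fun i _ => ?_
      simp

theorem IsPath.sub {L i j : ℕ} {z : ℕ → X} (h : IsPath S δ x y L z) (hij : i ≤ j) (hj : j ≤ L) :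
    IsPath S δ (z i) (z j) (j - i) (fun l => z (i + l)) where
  start := by simp
  finish := by simp [Nat.add_sub_cancel' hij]
  mem := fun l hl => h.mem _ (by omega)
  step := fun l hl => h.step _ (by omega)

theorem IsPath.mono {S' : Set X} {δ' : ℝ} {L : ℕ} {z : ℕ → X} (h : IsPath S δ x y L z)
    (hS : S ⊆ S') (hδ : δ ≤ δ') : IsPath S' δ' x y L z :=
  ⟨h.start, h.finish, fun i hi => hS (h.mem i hi), fun i hi => (h.step i hi).trans_le hδ⟩

theorem Reach.refl (hx : x ∈ S) {c : ℝ} (hc : 0 ≤ c) : Reach S δ w x x c :=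
  ⟨0, fun _ => x, ⟨rfl, rfl, fun _ _ => hx, fun i hi => by omega⟩, by simpa using hc⟩

theorem Reach.trans {c c' : ℝ} (h : Reach S δ w x y c) (h' : Reach S δ w y v c') :
    Reach S δ w x v (c + c') := by
  obtain ⟨L, z, hz, hc⟩ := h
  obtain ⟨L', z', hz', hc'⟩ := h'
  obtain ⟨z'', h1, h2⟩ := hz.concat (w := w) hz'
  exact ⟨_, z'', h1, by rw [h2]; linarith⟩

theorem Reach.mono {S' : Set X} {δ' c c' : ℝ} (h : Reach S δ w x y c)
    (hS : S ⊆ S') (hδ : δ ≤ δ') (hc : c ≤ c') : Reach S' δ' w x y c' := by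
  obtain ⟨L, z, hz, h1⟩ := h
  exact ⟨L, z, hz.mono hS hδ, h1.trans hc⟩

theorem Reach.of_steps {c : ℝ} {z : ℕ → X} (L : ℕ) (h0 : z 0 ∈ S)
    (h : ∀ i < L, Reach S δ w (z i) (z (i + 1)) c) : Reach S δ w (z 0) (z L) (L * c) := by
  induction L with
  | zero => simpa using Reach.refl h0 le_rfl
  | succ L ih =>
    have := (ih fun i hi => h i (by omega)).trans (h L (by omega))
    refine this.mono subset_rfl le_rfl ?_
    push_cast; linarith

theorem Reach.weigh {N W : ℝ} (h : Reach S δ (fun _ => 1) x y N) (hW : 0 ≤ W)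
    (hw : ∀ z ∈ S, w z ≤ W) : Reach S δ w x y (N * W) := by
  obtain ⟨L, z, hz, h1⟩ := h
  refine ⟨L, z, hz, ?_⟩
  have h2 : ∑ i ∈ range L, w (z i) ≤ ∑ i ∈ range L, W :=
    sum_le_sum fun i hi => hw _ (hz.mem i (by simp only [Finset.mem_range] at hi; omega))
  simp only [sum_const, card_range, nsmul_eq_mul, mul_one] at h1 h2
  exact h2.trans (mul_le_mul_of_nonneg_right h1 hW)

/-- A chain of almost minimal weight is almost minimal between any two of its points. -/
theorem exists_nearly_minimal {c₀ : ℝ} (h : Reach S δ w x y c₀) (hw : ∀ z, 0 ≤ w z) :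
    ∃ L z, IsPath S δ x y L z ∧ ∀ i j, i ≤ j → j ≤ L → ∀ c, Reach S δ w (z i) (z j) c →
      ∑ l ∈ Finset.Ico i j, w (z l) ≤ c + 1 := by
  let T : Set ℝ := {c | ∃ L z, IsPath S δ x y L z ∧ ∑ i ∈ range L, w (z i) = c}
  have hT : T.Nonempty := by
    obtain ⟨L, z, hz, -⟩ := h
    exact ⟨_, L, z, hz, rfl⟩
  have hbd : BddBelow T := ⟨0, by
    rintro c ⟨L, z, -, rfl⟩
    exact sum_nonneg fun i _ => hw _⟩
  obtain ⟨c, ⟨L, z, hz, rfl⟩, hlt⟩ := exists_lt_of_csInf_lt hT (lt_add_one (sInf T))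
  refine ⟨L, z, hz, fun i j hij hj c hc => ?_⟩
  obtain ⟨L', z', hz', hc'⟩ := hc
  have hp1 := hz.sub (Nat.zero_le i) (hij.trans hj)
  have hp3 := hz.sub hj le_rfl
  rw [hz.start] at hp1
  rw [hz.finish] at hp3
  obtain ⟨u, hu, hu'⟩ := hp1.concat (w := w) hz'
  obtain ⟨u', hv, hv'⟩ := hu.concat (w := w) hp3
  have hle := csInf_le hbd ⟨_, _, hv, rfl⟩
  rw [hv', hu'] at hle
  have e1 : ∑ l ∈ range L, w (z l) = ∑ l ∈ range i, w (z l) + ∑ l ∈ Finset.Ico i j, w (z l)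
      + ∑ l ∈ Finset.Ico j L, w (z l) := by
    rw [sum_range_add_sum_Ico _ hij, sum_range_add_sum_Ico _ hj]
  rw [sum_Ico_eq_sum_range _ j L] at e1
  simp only [Nat.sub_zero, zero_add] at hle
  linarith

end Paths

section Linked

variable {X : Type*} [MetricSpace X]

theorem ChainLinked.comp {κ ε N κ' ε' N' : ℝ} (h : ChainLinked X κ ε N)
    (h' : ChainLinked X κ' ε' N') (hε : 0 ≤ ε) (hκ' : 0 ≤ κ') (hN' : 0 ≤ N') :
    ChainLinked X (κ + κ' * ε) (ε' * ε) (N * N') := by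
  intro x y R hR
  obtain ⟨L, z, hz, hc⟩ := h x y R hR
  have hR0 : 0 < R := dist_nonneg.trans_lt hR
  have h0 : z 0 ∈ ball x ((κ + κ' * ε) * R) :=
    ball_subset_ball (by nlinarith [mul_nonneg (mul_nonneg hκ' hε) hR0.le]) (hz.mem 0 (by omega))
  have key := Reach.of_steps (S := ball x ((κ + κ' * ε) * R)) (δ := ε' * ε * R)
    (w := fun _ => 1) (c := N') L h0 fun i hi => by
      refine (h' _ _ _ (hz.step i hi)).mono (ball_subset_ball' ?_) (by rw [mul_assoc]) le_rfl
      have := hz.mem i hi.le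
      rw [Metric.mem_ball] at this
      nlinarith
  rw [hz.start, hz.finish] at key
  refine key.mono subset_rfl le_rfl ?_
  simp only [sum_const, card_range, nsmul_eq_mul, mul_one] at hc
  exact mul_le_mul_of_nonneg_right hc hN'

theorem ChainLinked.pow {κ N : ℝ} (hκ : 1 ≤ κ) (hN : 0 ≤ N) (h : ChainLinked X κ (1 / 2) N)
    (n : ℕ) : ChainLinked X (2 * κ) ((1 / 2) ^ n) (N ^ n) := by
  induction n with
  | zero =>
    intro x y R hR
    have hR0 : 0 < R := dist_nonneg.trans_lt hR
    refine ⟨1, fun i => if i = 0 then x else y, ⟨by simp, by simp, ?_, ?_⟩, by simp⟩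
    · intro i _
      show (if i = 0 then x else y) ∈ ball x _
      split_ifs
      · exact mem_ball_self (by positivity)
      · rw [Metric.mem_ball, dist_comm]; nlinarith
    · intro i hi
      obtain rfl : i = 0 := by omega
      simpa using hR
  | succ n ih =>
    have := h.comp ih (by norm_num) (by positivity) (by positivity)
    convert this using 1 <;> ring

end Linked

section Refinement

variable {X : Type*} [MetricSpace X]

theorem reach_of_height {h : X → ℝ} (hLip : ∀ x y, h x ≤ h y + dist x y) {lam β κ ε N R H δ : ℝ}
    {x y : X} (hlam : 0 ≤ lam) (hlink : ChainLinked X κ ε N) (hδ : ε * R ≤ δ)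
    (hd : dist x y < R) (hH : h x + κ * R ≤ H) (hHβ : H ≤ β) :
    Reach {z | h z < β} δ (fun z => Real.exp (lam * h z)) x y (N * Real.exp (lam * H)) := by
  have hsub : ∀ z ∈ ball x (κ * R), h z < H := by
    intro z hz
    rw [Metric.mem_ball] at hz
    linarith [hLip z x]
  refine ((hlink x y R hd).weigh (Real.exp_pos _).le fun z hz => ?_).mono
    (fun z hz => (hsub z hz).trans_le hHβ) hδ le_rfl
  exact Real.exp_le_exp.2 (mul_le_mul_of_nonneg_left (hsub z hz).le hlam)

theorem Reach.along {S : Set X} {δ W : ℝ} {w : X → ℝ} {Z : ℕ → X} {M : ℕ} (hW : 0 ≤ W)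
    (hS : ∀ i ≤ M, Z i ∈ S) (h1 : ∀ i < M, Reach S δ w (Z i) (Z (i + 1)) W)
    (h2 : ∀ i < M, Reach S δ w (Z (i + 1)) (Z i) W) (D : ℕ) :
    ∀ k l, k ≤ M → l ≤ M → k ≤ l + D → l ≤ k + D → Reach S δ w (Z k) (Z l) (D * W) := by
  induction D with
  | zero =>
    intro k l hk hl h3 h4
    obtain rfl : k = l := by omega
    exact Reach.refl (hS k hk) (by simp)
  | succ D ih =>
    intro k l hk hl h3 h4
    rcases lt_trichotomy k l with h | h | h
    · refine ((h1 k (by omega)).trans (ih (k + 1) l (by omega) hl (by omega) (by omega))).mono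
        subset_rfl le_rfl ?_
      push_cast; linarith
    · subst h
      exact Reach.refl (hS k hk) (by positivity)
    · obtain ⟨j, rfl⟩ : ∃ j, k = j + 1 := ⟨k - 1, by omega⟩
      refine ((h2 j (by omega)).trans (ih j l (by omega) hl (by omega) (by omega))).mono
        subset_rfl le_rfl ?_
      push_cast; linarith

theorem jump_le {f : ℕ → ℕ} {C L : ℕ} (hf : ∀ i < L, f (i + 1) ≤ f i + C) {i : ℕ} (n : ℕ)
    (hn : i + n ≤ L) : f (i + n) ≤ f i + C * n := by
  induction n with
  | zero => simp
  | succ n ih =>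
    have := hf (i + n) (by omega)
    have := ih (by omega)
    rw [← add_assoc, mul_add]; omega

theorem jump_ge {f : ℕ → ℕ} {C L : ℕ} (hf : ∀ i < L, f i ≤ f (i + 1) + C) {i : ℕ} (n : ℕ)
    (hn : i + n ≤ L) : f i ≤ f (i + n) + C * n := by
  induction n with
  | zero => simp
  | succ n ih =>
    have := hf (i + n) (by omega)
    have := ih (by omega)
    rw [← add_assoc, mul_add]; omega

/-- A chain of almost minimal weight does not leave the neighbourhood of the chain `Z`. -/
theorem height_le {h : X → ℝ} {S : Set X} {δ W a b c lam : ℝ} {z Z : ℕ → X} {C L M : ℕ}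
    {f : ℕ → ℕ} (hW : 0 ≤ W) (hlam : 0 ≤ lam) (hab : a ≤ b)
    (hmin : ∀ i j, i ≤ j → j ≤ L → ∀ c, Reach S δ (fun z => Real.exp (lam * h z)) (z i) (z j) c →
      ∑ l ∈ Finset.Ico i j, Real.exp (lam * h (z l)) ≤ c + 1)
    (h0 : h (z 0) ≤ a) (hL : h (z L) ≤ a) (hfM : ∀ i ≤ L, f i ≤ M)
    (hf1 : ∀ i < L, f (i + 1) ≤ f i + C) (hf2 : ∀ i < L, f i ≤ f (i + 1) + C)
    (hdown : ∀ i ≤ L, h (z i) ≤ a →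
      Reach S δ (fun z => Real.exp (lam * h z)) (z i) (Z (f i)) c)
    (hup : ∀ i ≤ L, h (z i) ≤ a →
      Reach S δ (fun z => Real.exp (lam * h z)) (Z (f i)) (z i) c)
    (halong : ∀ D k l : ℕ, k ≤ M → l ≤ M → k ≤ l + D → l ≤ k + D →
      Reach S δ (fun z => Real.exp (lam * h z)) (Z k) (Z l) (D * W))
    (hWa : 4 * C * W ≤ Real.exp (lam * a)) (hcb : 4 * c + 2 < Real.exp (lam * b)) :
    ∀ i ≤ L, h (z i) ≤ b := by
  intro i hi
  by_contra! hib
  classical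
  obtain ⟨p, hpi, hpa, hp⟩ : ∃ p ≤ i, h (z p) ≤ a ∧ ∀ l, p < l → l ≤ i → a < h (z l) := by
    refine ⟨Nat.findGreatest (fun p => h (z p) ≤ a) i, Nat.findGreatest_le i,
      Nat.findGreatest_spec (P := fun p => h (z p) ≤ a) (Nat.zero_le i) h0, fun l hl hli => ?_⟩
    exact not_le.1 (Nat.findGreatest_is_greatest hl hli)
  have hex : ∃ q, i ≤ q ∧ h (z q) ≤ a := ⟨L, hi, hL⟩
  obtain ⟨q, hiq, hqa, hqL, hq⟩ : ∃ q, i ≤ q ∧ h (z q) ≤ a ∧ q ≤ L ∧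
      ∀ l, i ≤ l → l < q → a < h (z l) := by
    refine ⟨Nat.find hex, (Nat.find_spec hex).1, (Nat.find_spec hex).2,
      Nat.find_min' hex ⟨hi, hL⟩, fun l hl hlq => ?_⟩
    have := Nat.find_min hex hlq
    push Not at this
    exact this hl
  have hpi' : p < i := lt_of_le_of_ne hpi (by rintro rfl; linarith)
  have hiq' : i < q := lt_of_le_of_ne hiq (by rintro rfl; linarith)
  obtain ⟨n, rfl⟩ : ∃ n, q = p + (n + 2) := ⟨q - p - 2, by omega⟩
  have hr : Reach S δ (fun z => Real.exp (lam * h z)) (z p) (z (p + (n + 2)))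
      (c + ((C * (n + 2) : ℕ) : ℝ) * W + c) := by
    refine ((hdown p (by omega) hpa).trans (halong (C * (n + 2)) _ _ (hfM _ (by omega))
      (hfM _ hqL) ?_ ?_)).trans (hup _ hqL hqa)
    · exact jump_ge hf2 (n + 2) hqL
    · exact jump_le hf1 (n + 2) hqL
  have hsum := hmin _ _ (by omega) hqL _ hr
  have hb : Real.exp (lam * b) ≤ ∑ l ∈ Finset.Ico p (p + (n + 2)), Real.exp (lam * h (z l)) := by
    refine le_trans (Real.exp_le_exp.2 (mul_le_mul_of_nonneg_left hib.le hlam)) ?_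
    exact single_le_sum (f := fun l => Real.exp (lam * h (z l)))
      (fun l _ => (Real.exp_pos _).le) (Finset.mem_Ico.2 ⟨hpi, hiq'⟩)
  have ha : (n + 1) * Real.exp (lam * a) ≤
      ∑ l ∈ Finset.Ico p (p + (n + 2)), Real.exp (lam * h (z l)) := by
    have h1 : ∑ l ∈ Finset.Ico (p + 1) (p + (n + 2)), Real.exp (lam * a) ≤
        ∑ l ∈ Finset.Ico (p + 1) (p + (n + 2)), Real.exp (lam * h (z l)) := by
      refine sum_le_sum fun l hl => Real.exp_le_exp.2 (mul_le_mul_of_nonneg_left ?_ hlam)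
      rw [Finset.mem_Ico] at hl
      rcases le_total l i with h2 | h2
      · exact (hp l (by omega) h2).le
      · exact (hq l h2 (by omega)).le
    rw [sum_const, Nat.card_Ico, nsmul_eq_mul, show p + (n + 2) - (p + 1) = n + 1 by omega] at h1
    push_cast at h1
    refine h1.trans (sum_le_sum_of_subset_of_nonneg (Finset.Ico_subset_Ico (by omega) le_rfl)
      fun l _ _ => (Real.exp_pos _).le)
  push_cast at hsum
  have hCW : 0 ≤ C * W := by positivity
  have hn : (0 : ℝ) ≤ n := by positivity
  nlinarith [mul_le_mul_of_nonneg_left hWa (by positivity : (0:ℝ) ≤ n + 1), mul_nonneg hn hCW]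

/-- Close points of a chain of almost minimal weight have close indices. -/
theorem index_le_of_reach {h : X → ℝ} {S : Set X} {δ lam N₁ : ℝ} {z : ℕ → X} {C L : ℕ}
    (hLip : ∀ x y, h x ≤ h y + dist x y) (hpos : ∀ x, 0 ≤ h x) (hlam : 0 ≤ lam)
    (hN₁ : 0 ≤ N₁) (hstep : ∀ i < L, dist (z i) (z (i + 1)) ≤ δ)
    (hmin : ∀ i j, i ≤ j → j ≤ L → ∀ c, Reach S δ (fun z => Real.exp (lam * h z)) (z i) (z j) c →
      ∑ l ∈ Finset.Ico i j, Real.exp (lam * h (z l)) ≤ c + 1)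
    (hC : 9 * N₁ + 3 ≤ C) (hslow : lam * (C + 1) * δ ≤ 1)
    {i j : ℕ} (hij : i ≤ j) (hj : j ≤ L)
    (hr : Reach S δ (fun z => Real.exp (lam * h z)) (z i) (z j)
      (N₁ * Real.exp (lam * h (z i) + 1))) : j ≤ i + C := by
  by_contra! hlt
  have hsum := hmin i j hij hj _ hr
  have hheight : ∀ n, i + n ≤ L → h (z i) ≤ h (z (i + n)) + n * δ := by
    intro n
    induction n with
    | zero => simp
    | succ n ih =>
      intro hn
      have h1 := ih (by omega)
      have h2 := hLip (z (i + n)) (z (i + n + 1))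
      have h3 := hstep (i + n) (by omega)
      rw [← add_assoc]
      push_cast
      linarith
  have hδ : 0 ≤ δ := dist_nonneg.trans (hstep i (by omega))
  have hlow : (C + 1) * Real.exp (lam * h (z i) - 1) ≤
      ∑ l ∈ Finset.Ico i j, Real.exp (lam * h (z l)) := by
    have h1 : ∑ l ∈ Finset.Ico i (i + (C + 1)), Real.exp (lam * h (z i) - 1) ≤
        ∑ l ∈ Finset.Ico i (i + (C + 1)), Real.exp (lam * h (z l)) := by
      refine sum_le_sum fun l hl => Real.exp_le_exp.2 ?_
      rw [Finset.mem_Ico] at hl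
      obtain ⟨n, rfl⟩ : ∃ n, l = i + n := ⟨l - i, by omega⟩
      have h2 := mul_le_mul_of_nonneg_left (hheight n (by omega)) hlam
      have h3 : (n : ℝ) ≤ C + 1 := by exact_mod_cast (by omega : n ≤ C + 1)
      have h4 := mul_le_mul_of_nonneg_left h3 (mul_nonneg hlam hδ)
      nlinarith
    rw [sum_const, Nat.card_Ico, nsmul_eq_mul, Nat.add_sub_cancel_left] at h1
    push_cast at h1
    exact h1.trans (sum_le_sum_of_subset_of_nonneg (Finset.Ico_subset_Ico le_rfl (by omega))
      fun l _ _ => (Real.exp_pos _).le)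
  have he := Real.exp_one_lt_three
  have he0 := Real.exp_pos 1
  have h1 : 1 ≤ Real.exp (lam * h (z i)) := Real.one_le_exp (mul_nonneg hlam (hpos _))
  rw [Real.exp_add] at hsum
  rw [Real.exp_sub] at hlow
  set u := Real.exp (lam * h (z i))
  set e := Real.exp 1
  have h5 : (C + 1) * (u / e) ≤ N₁ * (u * e) + 1 := hlow.trans hsum
  have h6 : (C + 1) * u ≤ (N₁ * (u * e) + 1) * e := by
    rw [← mul_div_assoc, div_le_iff₀ he0] at h5
    exact h5
  have h7 : e * e ≤ 9 := by nlinarith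
  nlinarith [mul_le_mul_of_nonneg_left h7 (mul_nonneg hN₁ (by linarith : (0:ℝ) ≤ u)),
    mul_le_mul_of_nonneg_right hC (by linarith : (0:ℝ) ≤ u)]

end Refinement

/-- Points of the finite chain `z 0, …, z L` at distance at most `ρ` have indices differing by
at most `C`. -/
def IndexSep {X : Type*} [MetricSpace X] (C : ℕ) (ρ : ℝ) (L : ℕ) (z : ℕ → X) : Prop :=
  ∀ k l, k ≤ l → l ≤ L → dist (z k) (z l) ≤ ρ → l ≤ k + C

/-- The chain `z` of mesh `τ * m` refines the chain `Z` of mesh `m`; the `i`-th point of `z` is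
labelled by the nearby `f i`-th point of `Z`. -/
structure Refines {X : Type*} [MetricSpace X] (C E : ℕ) (b m : ℝ) (M : ℕ) (Z : ℕ → X) (L : ℕ)
    (z : ℕ → X) (f : ℕ → ℕ) : Prop where
  start : f 0 = 0
  finish : f L = M
  le : ∀ i ≤ L, f i ≤ M
  near : ∀ i ≤ L, dist (z i) (Z (f i)) ≤ b * m
  jump : ∀ i < L, f (i + 1) ≤ f i + C
  index : ∀ i j D, i ≤ j → j ≤ L → f i ≤ f j + D → f j ≤ f i + D → j ≤ i + E * (D + 2)

section Step

variable {X : Type*} [MetricSpace X]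

theorem exists_small_scale {N₀ A D : ℝ} (T₀ : ℕ) (hN₀ : 1 ≤ N₀) (hA : 1 ≤ A) :
    ∃ T : ℕ, 1 ≤ T ∧ Real.log (A * N₀ ^ (T + T₀)) * (1 / 2) ^ T * D ≤ 1 := by
  have h1 := tendsto_pow_const_mul_const_pow_of_abs_lt_one 1
    (by norm_num [abs_lt] : |(1 / 2 : ℝ)| < 1)
  have h2 := tendsto_pow_const_mul_const_pow_of_abs_lt_one 0
    (by norm_num [abs_lt] : |(1 / 2 : ℝ)| < 1)
  have h3 : Filter.Tendsto (fun T : ℕ => Real.log (A * N₀ ^ (T + T₀)) * (1 / 2) ^ T * D)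
      Filter.atTop (nhds 0) := by
    have h4 := ((h1.const_mul (Real.log N₀)).add
      (h2.const_mul (Real.log A + T₀ * Real.log N₀))).mul_const D
    simp only [mul_zero, add_zero, zero_mul] at h4
    refine h4.congr fun T => ?_
    rw [Real.log_mul (by positivity) (by positivity), Real.log_pow]
    push_cast
    ring
  obtain ⟨T, hT, hT1⟩ := ((h3.eventually (Iic_mem_nhds (by norm_num : (0:ℝ) < 1))).and
    (Filter.eventually_ge_atTop 1)).exists
  exact ⟨T, hT1, hT⟩

set_option maxHeartbeats 1000000 in
theorem exists_refinement {κ N₀ : ℝ} (hκ : 1 ≤ κ) (hN₀ : 1 ≤ N₀)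
    (hlink : ∀ n : ℕ, ChainLinked X κ ((1 / 2) ^ n) (N₀ ^ n)) :
    ∃ (C E : ℕ) (b σ τ : ℝ), 1 ≤ C ∧ 1 ≤ b ∧ 5 * b ≤ σ ∧ 0 < τ ∧ τ ≤ 1 / 2 ∧
      ∀ (m : ℝ) (M : ℕ) (Z : ℕ → X) (x y : X), 0 < m → x ≠ y → IsPath univ m x y M Z →
        IndexSep C (σ * m) M Z → ∃ L z f, IsPath univ (τ * m) x y L z ∧ IndexSep C (σ * (τ * m)) L z ∧
          Refines C E b m M Z L z f := by
  obtain ⟨a, ha⟩ : ∃ a, a = κ + 1 := ⟨_, rfl⟩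
  obtain ⟨e, he⟩ : ∃ e, e = a + 2 * a * κ := ⟨_, rfl⟩
  obtain ⟨b, hb⟩ : ∃ b, b = e + 1 := ⟨_, rfl⟩
  obtain ⟨β, hβ⟩ : ∃ β, β = b + 2 * b * κ := ⟨_, rfl⟩
  have ha1 : 2 ≤ a := by linarith
  have hea : a ≤ e := by nlinarith
  have hb1 : a + 1 ≤ b := by linarith
  have hβb : 3 * b ≤ β := by nlinarith
  obtain ⟨T₁, hT₁⟩ := pow_unbounded_of_one_lt (2 * (3 * β)) (by norm_num : (1:ℝ) < 2)
  obtain ⟨T₀, hT₀⟩ := pow_unbounded_of_one_lt (2 * b) (by norm_num : (1:ℝ) < 2)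
  obtain ⟨C, hC⟩ := exists_nat_ge (9 * N₀ ^ T₁ + 3)
  have hN₁ : 1 ≤ N₀ ^ T₁ := one_le_pow₀ hN₀
  have hC12 : (12 : ℝ) ≤ C := by linarith
  obtain ⟨T, hT, hTD⟩ := exists_small_scale (A := 8 * C) (D := 2 * (3 * β) * κ + C + 1) T₀ hN₀
    (by linarith)
  obtain ⟨N, hN⟩ : ∃ N, N = N₀ ^ (T + T₀) := ⟨_, rfl⟩
  have hN1 : 1 ≤ N := hN ▸ one_le_pow₀ hN₀
  rw [← hN] at hTD
  obtain ⟨ell, hell⟩ : ∃ ell, ell = Real.log (8 * C * N) := ⟨_, rfl⟩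
  rw [← hell] at hTD
  have hCN : 12 ≤ C * N := by nlinarith
  have hexp : Real.exp ell = 8 * C * N := by
    rw [hell, Real.exp_log]; nlinarith
  have hell1 : 1 ≤ ell := by
    have : Real.exp 1 ≤ Real.exp ell := by
      rw [hexp]; linarith [Real.exp_one_lt_three]
    exact Real.exp_le_exp.1 this
  obtain ⟨τ, hτ⟩ : ∃ τ : ℝ, τ = (1 / 2) ^ T := ⟨_, rfl⟩
  rw [← hτ] at hTD
  have hτ0 : 0 < τ := by rw [hτ]; positivity
  have hτ2 : τ ≤ 1 / 2 := by
    rw [hτ]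
    calc (1 / 2 : ℝ) ^ T ≤ (1 / 2) ^ 1 := pow_le_pow_of_le_one (by norm_num) (by norm_num) hT
      _ = 1 / 2 := by norm_num
  have hellτ : 0 < ell * τ := by positivity
  have hslow1 : ell * τ * (2 * (3 * β) * κ) ≤ 1 := by nlinarith
  have hslow2 : ell * τ * (C + 1) ≤ 1 := by
    have : 0 ≤ β * κ := by nlinarith
    nlinarith
  obtain ⟨E, hE⟩ := exists_nat_ge (N * Real.exp (ell * β) + 1)
  refine ⟨C, E, b, 3 * β, τ, by exact_mod_cast (by linarith : (1:ℝ) ≤ C), by linarith, by linarith,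
    hτ0, hτ2, ?_⟩
  intro m M Z x y hm hxy hZ hsep
  obtain ⟨h, hh⟩ : ∃ h : X → ℝ, h = fun z => infDist z (Z '' Set.Iic M) := ⟨_, rfl⟩
  have hne : (Z '' Set.Iic M).Nonempty := ⟨Z 0, 0, Nat.zero_le _, rfl⟩
  have hcpt : IsCompact (Z '' Set.Iic M) := ((Set.finite_Iic M).image Z).isCompact
  have hLip : ∀ x y, h x ≤ h y + dist x y := fun x y => by
    rw [hh]; exact infDist_le_infDist_add_dist
  have hpos : ∀ x, 0 ≤ h x := fun x => by rw [hh]; exact infDist_nonneg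
  have hZ0 : ∀ i ≤ M, h (Z i) = 0 := fun i hi => by
    rw [hh]; exact infDist_zero_of_mem ⟨i, hi, rfl⟩
  have hlabel : ∀ v, ∃ k ≤ M, dist v (Z k) = h v := by
    intro v
    obtain ⟨u, ⟨k, hk, rfl⟩, hu⟩ := hcpt.exists_infDist_eq_dist hne v
    exact ⟨k, hk, by rw [hh]; exact hu.symm⟩
  obtain ⟨lam, hlam⟩ : ∃ lam, lam = ell / m := ⟨_, rfl⟩
  have hlam0 : 0 ≤ lam := by rw [hlam]; positivity
  have hlm : ∀ c, lam * (c * m) = ell * c := fun c => by rw [hlam]; field_simp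
  have hscale : ∀ c, c ≤ b → (1 / 2 : ℝ) ^ (T + T₀) * (2 * c * m) ≤ τ * m := by
    intro c hc
    rw [pow_add, ← hτ]
    have h1 : (1 / 2 : ℝ) ^ T₀ * (2 * c) ≤ 1 := by
      rw [one_div, inv_pow, inv_mul_le_iff₀ (by positivity)]; linarith
    have h2 := mul_le_mul_of_nonneg_left h1 (by positivity : 0 ≤ τ * m)
    nlinarith
  have hloc : ∀ u v r c, dist u v < 2 * r * m → r ≤ b → h u + κ * (2 * r * m) ≤ c * m → c ≤ β →
      Reach {z | h z < β * m} (τ * m) (fun z => Real.exp (lam * h z)) u v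
        (N * Real.exp (ell * c)) := by
    intro u v r c hd hr hc hcβ
    rw [← hlm c, hN]
    exact reach_of_height hLip hlam0 (hlink _) (hscale r hr) hd hc
      (mul_le_mul_of_nonneg_right hcβ hm.le)
  obtain ⟨W, hW⟩ : ∃ W, W = N * Real.exp (ell * κ) := ⟨_, rfl⟩
  have hW0 : 0 ≤ W := by rw [hW]; positivity
  have hβ0 : 0 < β := by linarith
  have hκβ : κ ≤ β := by linarith
  have hmemZ : ∀ i ≤ M, Z i ∈ {z | h z < β * m} := fun i hi => by
    simp only [Set.mem_ofPred_eq, hZ0 i hi]; positivity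
  have halong := Reach.along (S := {z | h z < β * m}) (δ := τ * m)
    (w := fun z => Real.exp (lam * h z)) (Z := Z) (M := M) hW0 hmemZ
    (fun i hi => by
      rw [hW]
      refine hloc _ _ (1 / 2) κ (by have := hZ.step i hi; linarith) (by linarith) ?_ hκβ
      rw [hZ0 i hi.le]; linarith)
    (fun i hi => by
      rw [hW]
      refine hloc _ _ (1 / 2) κ (by rw [dist_comm]; have := hZ.step i hi; linarith)
        (by linarith) ?_ hκβ
      rw [hZ0 (i + 1) hi]; linarith)
  have hstart := halong M 0 M (Nat.zero_le _) le_rfl (by omega) (by omega)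
  rw [hZ.start, hZ.finish] at hstart
  obtain ⟨L, z, hz, hmin⟩ := exists_nearly_minimal hstart fun _ => (Real.exp_pos _).le
  have hL : L ≠ 0 := by
    rintro rfl
    exact hxy (hz.start.symm.trans hz.finish)
  have hx0 : h x = 0 := by rw [← hZ.start]; exact hZ0 0 (Nat.zero_le _)
  have hy0 : h y = 0 := by rw [← hZ.finish]; exact hZ0 M le_rfl
  obtain ⟨f, hf0, hfL, hfM, hfd⟩ : ∃ f : ℕ → ℕ, f 0 = 0 ∧ f L = M ∧ (∀ i, f i ≤ M) ∧
      ∀ i, dist (z i) (Z (f i)) = h (z i) := by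
    choose F hFM hF using hlabel
    refine ⟨fun i => if i = 0 then 0 else if i = L then M else F (z i), by simp, by simp [hL],
      fun i => ?_, fun i => ?_⟩
    · dsimp only
      split_ifs
      · exact Nat.zero_le _
      · exact le_rfl
      · exact hFM _
    · dsimp only
      split_ifs with h1 h2
      · rw [h1, hz.start, hZ.start, hx0, dist_self]
      · rw [h2, hz.finish, hZ.finish, hy0, dist_self]
      · exact hF _
  have hjump : ∀ i < L, dist (Z (f i)) (Z (f (i + 1))) ≤ 3 * β * m := by
    intro i hi
    have h1 := dist_triangle4 (Z (f i)) (z i) (z (i + 1)) (Z (f (i + 1)))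
    rw [dist_comm (Z (f i)) (z i), hfd, hfd] at h1
    have h2 : h (z i) < β * m := hz.mem i hi.le
    have h3 : h (z (i + 1)) < β * m := hz.mem (i + 1) hi
    have h4 := hz.step i hi
    have h5 : τ * m ≤ β * m := mul_le_mul_of_nonneg_right (by linarith) hm.le
    linarith
  have hf1 : ∀ i < L, f (i + 1) ≤ f i + C := by
    intro i hi
    rcases le_total (f i) (f (i + 1)) with h1 | h1
    · exact hsep _ _ h1 (hfM _) (hjump i hi)
    · omega
  have hf2 : ∀ i < L, f i ≤ f (i + 1) + C := by
    intro i hi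
    rcases le_total (f (i + 1)) (f i) with h1 | h1
    · exact hsep _ _ h1 (hfM _) (by rw [dist_comm]; exact hjump i hi)
    · omega
  have hexp1 : ∀ c, Real.exp (ell * (c + 1)) = 8 * C * N * Real.exp (ell * c) := fun c => by
    rw [mul_add, mul_one, Real.exp_add, hexp, mul_comm]
  have ham : 0 < a * m := by positivity
  have hem : e * m = κ * (2 * a * m) + a * m := by rw [he]; ring
  have hheight : ∀ i ≤ L, h (z i) ≤ b * m := by
    refine height_le (f := f) (Z := Z) (M := M) (C := C) (a := a * m)
      (c := N * Real.exp (ell * e)) hW0 hlam0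
      (mul_le_mul_of_nonneg_right (by linarith) hm.le) hmin ?_ ?_ (fun i _ => hfM i) hf1 hf2 ?_ ?_ halong ?_ ?_
    · rw [hz.start, hx0]; positivity
    · rw [hz.finish, hy0]; positivity
    · intro i _ hi
      refine hloc _ _ a e ?_ (by linarith) ?_ (by linarith)
      · rw [hfd]; linarith
      · rw [hem]; linarith
    · intro i _ hi
      refine hloc _ _ a e ?_ (by linarith) ?_ (by linarith)
      · rw [dist_comm, hfd]; linarith
      · rw [hZ0 _ (hfM i), hem]; linarith
    · rw [hlm, ha, hexp1, hW]
      have := Real.exp_pos (ell * κ)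
      nlinarith [mul_pos (by linarith : 0 < C * N) this]
    · rw [hlm, hb, hexp1]
      have h1 : 1 ≤ Real.exp (ell * e) :=
        Real.one_le_exp (mul_nonneg (by linarith) (by linarith))
      have h2 : 1 ≤ N * Real.exp (ell * e) := by nlinarith
      nlinarith
  refine ⟨L, z, f, hz.mono (Set.subset_univ _) le_rfl, ?_, hf0, hfL, fun i _ => hfM i,
    fun i hi => (hfd i).trans_le (hheight i hi), hf1, ?_⟩
  · intro i j hij hj hd
    have hslow : lam * (C + 1) * (τ * m) ≤ 1 := by
      have := hlm ((C + 1) * τ)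
      calc lam * (C + 1) * (τ * m) = lam * ((C + 1) * τ * m) := by ring
        _ = ell * τ * (C + 1) := by rw [this]; ring
        _ ≤ 1 := hslow2
    refine index_le_of_reach hLip hpos hlam0 (by positivity) (fun i hi => (hz.step i hi).le) hmin
      hC hslow hij hj ?_
    have h1 : lam * h (z i) + 1 = lam * (h (z i) + 1 / lam) := by
      have : lam ≠ 0 := by rw [hlam]; positivity
      field_simp
    have h2 : 2 * (3 * β) * κ * τ * m ≤ 1 / lam := by
      rw [le_div_iff₀ (by rw [hlam]; positivity)]
      have := hlm (2 * (3 * β) * κ * τ)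
      calc 2 * (3 * β) * κ * τ * m * lam = lam * (2 * (3 * β) * κ * τ * m) := by ring
        _ = ell * τ * (2 * (3 * β) * κ) := by rw [this]; ring
        _ ≤ 1 := hslow1
    have h3 : 1 / lam ≤ m := by
      rw [hlam, one_div_div, div_le_iff₀ (by linarith)]
      exact le_mul_of_one_le_right hm.le hell1
    rw [h1]
    refine reach_of_height hLip hlam0 (hlink T₁) (R := 2 * (3 * β) * (τ * m)) ?_ ?_ ?_ ?_
    · have h4 : (1 / 2 : ℝ) ^ T₁ * (2 * (3 * β)) ≤ 1 := by
        rw [one_div, inv_pow, inv_mul_le_iff₀ (by positivity)]; linarith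
      have h5 := mul_le_mul_of_nonneg_right h4 (by positivity : 0 ≤ τ * m)
      linarith
    · have : 0 < 3 * β * (τ * m) := by positivity
      linarith
    · linarith
    · have := hheight i (hij.trans hj)
      have h6 : 3 * b * m ≤ β * m := mul_le_mul_of_nonneg_right hβb hm.le
      have h7 : m ≤ b * m := le_mul_of_one_le_left hm.le (by linarith)
      linarith
  · intro i j D hij hj h1 h2
    have hi := hij.trans hj
    have hβm : ∀ u, h u ≤ b * m → h u + κ * (2 * b * m) ≤ β * m := fun u hu => by
      have : β * m = b * m + κ * (2 * b * m) := by rw [hβ]; ring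
      linarith
    have hbm : 0 < b * m := mul_pos (by linarith) hm
    have hr := ((hloc (z i) (Z (f i)) b β (by rw [hfd]; linarith [hheight i hi]) le_rfl
      (hβm _ (hheight i hi)) le_rfl).trans (halong D _ _ (hfM i) (hfM j) h1 h2)).trans
      (hloc (Z (f j)) (z j) b β (by rw [dist_comm, hfd]; linarith [hheight j hj]) le_rfl
      (hβm _ (by rw [hZ0 _ (hfM j)]; exact hbm.le)) le_rfl)
    have hsum := hmin i j hij hj _ hr
    have hlow : ((j - i : ℕ) : ℝ) ≤ ∑ l ∈ Finset.Ico i j, Real.exp (lam * h (z l)) := by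
      have h3 : ∑ l ∈ Finset.Ico i j, (1 : ℝ) ≤ ∑ l ∈ Finset.Ico i j, Real.exp (lam * h (z l)) :=
        sum_le_sum fun l _ => Real.one_le_exp (mul_nonneg hlam0 (hpos _))
      simpa using h3
    have hWβ : W ≤ N * Real.exp (ell * β) := by
      rw [hW]
      exact mul_le_mul_of_nonneg_left (Real.exp_le_exp.2
        (mul_le_mul_of_nonneg_left hκβ (by linarith))) (by linarith)
    have hD : (0 : ℝ) ≤ D := by positivity
    have h4 : ((j - i : ℕ) : ℝ) ≤ ((E * (D + 2) : ℕ) : ℝ) := by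
      push_cast
      have h5 := mul_le_mul_of_nonneg_left hWβ hD
      have h6 := mul_le_mul_of_nonneg_right hE (by linarith : (0:ℝ) ≤ D + 2)
      linarith
    have h5 : j - i ≤ E * (D + 2) := by exact_mod_cast h4
    omega

end Step

section Tower

variable {X : Type*} [MetricSpace X]

theorem Refines.exists_monotone_label {C E M L : ℕ} {b m : ℝ} {Z z : ℕ → X} {f : ℕ → ℕ}
    (h : Refines C E b m M Z L z f) :
    ∃ g : ℕ → ℕ, Monotone g ∧ (∀ i, g i ≤ M) ∧
      ∀ i ≤ L, f i ≤ g i ∧ g i ≤ f i + C * (E * (C + 2)) := by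
  have hl : ∀ i, ∃ l ≤ min i L, partialSups f (min i L) = f l := fun i => by
    obtain ⟨l, hl, he⟩ := exists_partialSups_eq f (min i L)
    exact ⟨l, hl, he⟩
  refine ⟨fun i => partialSups f (min i L), fun i j hij => (partialSups f).monotone
    (min_le_min_right L hij), fun i => ?_, fun i hi => ⟨?_, ?_⟩⟩
  · obtain ⟨l, hl, he⟩ := hl i
    dsimp only
    rw [he]
    exact h.le l (hl.trans (min_le_right _ _))
  · dsimp only
    rw [min_eq_left hi]
    exact le_partialSups f i
  · obtain ⟨l, hl, he⟩ := hl i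
    dsimp only
    rw [he]
    rw [min_eq_left hi] at hl
    have hex : ∃ j, i ≤ j ∧ f l ≤ f j := ⟨L, hi, by rw [h.finish]; exact h.le l (hl.trans hi)⟩
    classical
    obtain ⟨j, hj, hjL, hmin⟩ : ∃ j, (i ≤ j ∧ f l ≤ f j) ∧ j ≤ L ∧
        ∀ k, i ≤ k → k < j → f k < f l :=
      ⟨Nat.find hex, Nat.find_spec hex,
        Nat.find_min' hex ⟨hi, by rw [h.finish]; exact h.le l (hl.trans hi)⟩, fun k hk hkj => by
          have := Nat.find_min hex hkj
          push Not at this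
          exact this hk⟩
    rcases hj.1.eq_or_lt with rfl | hij
    · omega
    · have h1 := hmin (j - 1) (by omega) (by omega)
      have h2 := h.jump (j - 1) (by omega)
      rw [Nat.sub_add_cancel (by omega)] at h2
      have h3 := h.index l j C (by omega) hjL (by omega) (by omega)
      have h4 := jump_le h.jump (i := i) (j - i) (by omega)
      rw [Nat.add_sub_cancel' hij.le] at h4
      have h5 : C * (j - i) ≤ C * (E * (C + 2)) := Nat.mul_le_mul_left _ (by omega)
      omega

theorem IsPath.dist_le {S : Set X} {δ : ℝ} {x y : X} {L : ℕ} {z : ℕ → X}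
    (h : IsPath S δ x y L z) {i j : ℕ} (hij : i ≤ j) (hj : j ≤ L) :
    dist (z i) (z j) ≤ (j - i : ℕ) * δ := by
  have h1 := dist_le_Ico_sum_of_dist_le (f := z) (d := fun _ => δ) hij
    (fun {k} _ hk => (h.step k (by omega)).le)
  simpa using h1

theorem Refines.exists_monotone_near {C E M L : ℕ} {b m : ℝ} {Z z : ℕ → X} {f : ℕ → ℕ} {x y : X}
    (h : Refines C E b m M Z L z f) (hZ : IsPath univ m x y M Z) (hm : 0 ≤ m) :
    ∃ g : ℕ → ℕ, Monotone g ∧ (∀ i, g i ≤ M) ∧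
      ∀ i ≤ L, dist (z i) (Z (g i)) ≤ (b + (C * (E * (C + 2)) : ℕ)) * m := by
  obtain ⟨g, hg, hgM, hgf⟩ := h.exists_monotone_label
  refine ⟨g, hg, hgM, fun i hi => ?_⟩
  have h1 := hZ.dist_le (hgf i hi).1 (hgM i)
  have h2 : ((g i - f i : ℕ) : ℝ) ≤ (C * (E * (C + 2)) : ℕ) := by
    have := (hgf i hi).2
    exact_mod_cast (by omega)
  have h3 := dist_triangle (z i) (Z (f i)) (Z (g i))
  have h4 := h.near i hi
  have h5 := mul_le_mul_of_nonneg_right h2 hm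
  linarith

/-- A sequence of successively finer chains from `x` to `y`. -/
structure IsTower (C E : ℕ) (b σ τ m : ℝ) (x y : X) (M : ℕ → ℕ) (Z : ℕ → ℕ → X)
    (f : ℕ → ℕ → ℕ) : Prop where
  top : M 0 = 1
  path : ∀ p, IsPath univ (τ ^ p * m) x y (M p) (Z p)
  sep : ∀ p, IndexSep C (σ * (τ ^ p * m)) (M p) (Z p)
  refines : ∀ p, Refines C E b (τ ^ p * m) (M p) (Z p) (M (p + 1)) (Z (p + 1)) (f p)

theorem exists_tower {C E : ℕ} {b σ τ m : ℝ} {x y : X} (hC : 1 ≤ C) (hτ : 0 < τ) (hxy : x ≠ y)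
    (hm : dist x y < m)
    (h : ∀ (m : ℝ) (M : ℕ) (Z : ℕ → X) (x y : X), 0 < m → x ≠ y → IsPath univ m x y M Z →
        IndexSep C (σ * m) M Z → ∃ L z f, IsPath univ (τ * m) x y L z ∧
          IndexSep C (σ * (τ * m)) L z ∧ Refines C E b m M Z L z f) :
    ∃ M Z f, IsTower C E b σ τ m x y M Z f := by
  have hm0 : 0 < m := dist_nonneg.trans_lt hm
  let St := {s : ℝ × ℕ × (ℕ → X) // 0 < s.1 ∧ IsPath univ s.1 x y s.2.1 s.2.2 ∧
    IndexSep C (σ * s.1) s.2.1 s.2.2}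
  have hstep : ∀ s : St, ∃ t : St, t.1.1 = τ * s.1.1 ∧ ∃ f,
      Refines C E b s.1.1 s.1.2.1 s.1.2.2 t.1.2.1 t.1.2.2 f := by
    rintro ⟨⟨m, M, Z⟩, hm, hp, hs⟩
    obtain ⟨L, z, f, h1, h2, h3⟩ := h m M Z x y hm hxy hp hs
    exact ⟨⟨⟨τ * m, L, z⟩, mul_pos hτ hm, h1, h2⟩, rfl, f, h3⟩
  choose next hnext F hF using hstep
  let s₀ : St := ⟨⟨m, 1, fun i => if i = 0 then x else y⟩, hm0,
    ⟨by simp, by simp, fun _ _ => Set.mem_univ _, fun i hi => by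
      obtain rfl : i = 0 := by simpa using hi
      simpa using hm⟩, fun k l hkl hl _ => by
        have : l ≤ 1 := hl
        omega⟩
  let s : ℕ → St := fun n => next^[n] s₀
  have hs : ∀ n, s (n + 1) = next (s n) := fun n => Function.iterate_succ_apply' _ _ _
  have hsm : ∀ n, (s n).1.1 = τ ^ n * m := by
    intro n
    induction n with
    | zero => simp [s, s₀]
    | succ n ih => rw [hs, hnext, ih]; ring
  refine ⟨fun n => (s n).1.2.1, fun n => (s n).1.2.2, fun n => F (s n), rfl, fun p => ?_,
    fun p => ?_, fun p => ?_⟩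
  · rw [← hsm]; exact (s p).2.2.1
  · rw [← hsm]; exact (s p).2.2.2
  · rw [← hsm]
    have := hF (s p)
    rw [← hs] at this
    exact this

theorem exists_index_bound {b σ τ : ℝ} (C E : ℕ) (hb : 0 ≤ b) (hσ : 5 * b ≤ σ) (hτ : 0 < τ)
    (hτ2 : τ ≤ 1 / 2) (s : ℕ) :
    ∃ c : ℕ, ∀ (m : ℝ) (x y : X) (M : ℕ → ℕ) (Z : ℕ → ℕ → X) (f : ℕ → ℕ → ℕ), 0 < m →
      IsTower C E b σ τ m x y M Z f →
      ∀ p, IndexSep c ((4 + 2 ^ s) * b * (τ ^ p * m)) (M p) (Z p) := by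
  induction s with
  | zero =>
    refine ⟨C, fun m x y M Z f hm h p k l hkl hl hd => h.sep p k l hkl hl (hd.trans ?_)⟩
    have : 0 < τ ^ p * m := by positivity
    nlinarith
  | succ s ih =>
    obtain ⟨c, hc⟩ := ih
    refine ⟨max 1 (E * (c + 2)), fun m x y M Z f hm h p k l hkl hl hd => ?_⟩
    cases p with
    | zero =>
      rw [h.top] at hl
      have := le_max_left 1 (E * (c + 2))
      omega
    | succ p =>
      have hmp : 0 < τ ^ p * m := by positivity
      have h1 := dist_triangle4 (Z p (f p k)) (Z (p + 1) k) (Z (p + 1) l) (Z p (f p l))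
      have h2 := (h.refines p).near k (by omega)
      have h3 := (h.refines p).near l hl
      rw [dist_comm] at h2
      have h4 : (4 + 2 ^ (s + 1)) * b * (τ ^ (p + 1) * m) ≤ (2 + 2 ^ s) * b * (τ ^ p * m) := by
        have : (4 + 2 ^ (s + 1)) * b * (τ ^ (p + 1) * m) =
          τ * (2 * ((2 + 2 ^ s) * b * (τ ^ p * m))) := by ring
        rw [this]
        have h5 : 0 ≤ (2 + 2 ^ s) * b * (τ ^ p * m) := by positivity
        nlinarith
      have h5 : dist (Z p (f p k)) (Z p (f p l)) ≤ (4 + 2 ^ s) * b * (τ ^ p * m) := by linarith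
      have hk := (h.refines p).le k (by omega)
      have hl' := (h.refines p).le l hl
      have h6 : l ≤ k + E * (c + 2) := by
        rcases le_total (f p k) (f p l) with h7 | h7
        · have := hc m x y M Z f hm h p _ _ h7 hl' h5
          exact (h.refines p).index k l c hkl hl (by omega) this
        · have := hc m x y M Z f hm h p _ _ h7 hk (by rwa [dist_comm])
          exact (h.refines p).index k l c hkl hl this (by omega)
      have := le_max_right 1 (E * (c + 2))
      omega

theorem IsTower.exists_projection {C E : ℕ} {b σ τ m : ℝ} {x y : X} {M : ℕ → ℕ} {Z : ℕ → ℕ → X}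
    {f : ℕ → ℕ → ℕ} (h : IsTower C E b σ τ m x y M Z f) (hm : 0 < m) (hb : 0 ≤ b) (hτ : 0 < τ)
    (hτ2 : τ ≤ 1 / 2) {p n : ℕ} (hpn : p ≤ n) :
    ∃ G : ℕ → ℕ, Monotone G ∧ (∀ i ≤ M n, G i ≤ M p) ∧ ∀ i ≤ M n, dist (Z n i) (Z p (G i)) ≤
      2 * (b + (C * (E * (C + 2)) : ℕ)) * (τ ^ p * m - τ ^ n * m) := by
  induction n, hpn using Nat.le_induction with
  | base => exact ⟨id, monotone_id, fun i hi => hi, fun i _ => by simp⟩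
  | succ n hpn ih =>
    obtain ⟨G, hG, hGM, hd⟩ := ih
    have hmn : 0 < τ ^ n * m := by positivity
    obtain ⟨g, hg, hgM, hd'⟩ := (h.refines n).exists_monotone_near (h.path n) hmn.le
    refine ⟨G ∘ g, hG.comp hg, fun i hi => hGM _ (hgM i), fun i hi => ?_⟩
    have h1 := hd' i hi
    have h2 := hd (g i) (hgM i)
    have h3 := dist_triangle (Z (n + 1) i) (Z n (g i)) (Z p (G (g i)))
    obtain ⟨B, hB⟩ : ∃ B : ℝ, B = b + (C * (E * (C + 2)) : ℕ) := ⟨_, rfl⟩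
    rw [← hB] at h1 h2 ⊢
    have hB0 : 0 ≤ B := by rw [hB]; positivity
    have h4 : τ ^ (n + 1) * m ≤ τ ^ n * m / 2 := by
      rw [pow_succ]; nlinarith
    have h5 := mul_le_mul_of_nonneg_left h4 hB0
    simp only [Function.comp_apply]
    linarith

/-- Any two points are joined by arbitrarily fine chains of bounded turning. -/
theorem exists_bounded_turning {κ N₀ : ℝ} (hκ : 1 ≤ κ) (hN₀ : 1 ≤ N₀)
    (hlink : ∀ n : ℕ, ChainLinked X κ ((1 / 2) ^ n) (N₀ ^ n)) :
    ∃ A : ℝ, 3 ≤ A ∧ ∀ (x y : X) (δ : ℝ), x ≠ y → 0 < δ → ∃ M z, IsPath univ δ x y M z ∧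
      ∀ i l j, i ≤ l → l ≤ j → j ≤ M → dist (z i) (z l) ≤ A * max (dist (z i) (z j)) δ := by
  obtain ⟨C, E, b, σ, τ, hC, hb, hσ, hτ, hτ2, href⟩ := exists_refinement hκ hN₀ hlink
  obtain ⟨B, hB⟩ : ∃ B : ℝ, B = b + (C * (E * (C + 2)) : ℕ) := ⟨_, rfl⟩
  have hB0 : 1 ≤ B := by
    rw [hB]
    have : (0:ℝ) ≤ (C * (E * (C + 2)) : ℕ) := by positivity
    linarith
  obtain ⟨s, hs⟩ := pow_unbounded_of_one_lt (4 * B + 1) (by norm_num : (1:ℝ) < 2)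
  obtain ⟨c, hc⟩ := exists_index_bound (X := X) C E (by linarith : 0 ≤ b) hσ hτ hτ2 s
  refine ⟨(4 * B + c + 1) / τ, ?_, fun x y δ hxy hδ => ?_⟩
  · rw [le_div_iff₀ hτ]
    have : (0:ℝ) ≤ c := by positivity
    linarith
  have hxy0 : 0 < dist x y := dist_pos.2 hxy
  obtain ⟨m, hm⟩ : ∃ m, m = 2 * dist x y := ⟨_, rfl⟩
  have hm0 : 0 < m := by linarith
  obtain ⟨M, Z, f, hT⟩ := exists_tower hC hτ hxy (by linarith : dist x y < m) href
  obtain ⟨n, hn⟩ : ∃ n, τ ^ n * m < δ := by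
    obtain ⟨n, hn⟩ := exists_pow_lt_of_lt_one (div_pos hδ hm0) (by linarith : τ < 1)
    exact ⟨n, by rwa [lt_div_iff₀ hm0] at hn⟩
  refine ⟨M n, Z n, (hT.path n).mono subset_rfl hn.le, fun i l j hil hlj hj => ?_⟩
  obtain ⟨d, hd⟩ : ∃ d, d = max (dist (Z n i) (Z n j)) δ := ⟨_, rfl⟩
  have hdδ : δ ≤ d := hd ▸ le_max_right _ _
  have hdd : dist (Z n i) (Z n j) ≤ d := hd ▸ le_max_left _ _
  rw [← hd, div_mul_eq_mul_div, le_div_iff₀ hτ]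
  have key : ∀ p ≤ n, ∃ G : ℕ → ℕ, Monotone G ∧ (∀ i ≤ M n, G i ≤ M p) ∧
      ∀ i ≤ M n, dist (Z n i) (Z p (G i)) ≤ 2 * B * (τ ^ p * m) := by
    intro p hp
    obtain ⟨G, h1, h2, h3⟩ := hT.exists_projection hm0 (by linarith) hτ hτ2 hp
    refine ⟨G, h1, h2, fun i hi => (h3 i hi).trans ?_⟩
    rw [← hB]
    have : 0 < τ ^ n * m := by positivity
    nlinarith
  have fin : ∀ p ≤ n, τ ^ p * m * τ ≤ d →
      (∀ G : ℕ → ℕ, Monotone G → (∀ i ≤ M n, G i ≤ M p) →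
        (∀ i ≤ M n, dist (Z n i) (Z p (G i)) ≤ 2 * B * (τ ^ p * m)) →
        G j ≤ G i + (c + 1)) → dist (Z n i) (Z n l) * τ ≤ (4 * B + c + 1) * d := by
    intro p hp hpd hG
    obtain ⟨G, h1, h2, h3⟩ := key p hp
    have h4 := hG G h1 h2 h3
    have hl := h2 l (by omega)
    have h5 := (hT.path p).dist_le (h1 hil) hl
    have h6 : ((G l - G i : ℕ) : ℝ) ≤ c + 1 := by
      have := h1 hlj
      exact_mod_cast (by omega)
    have hmp : 0 < τ ^ p * m := by positivity
    have h7 := mul_le_mul_of_nonneg_right h6 hmp.le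
    have h8 := dist_triangle4 (Z n i) (Z p (G i)) (Z p (G l)) (Z n l)
    have h9 := h3 i (by omega)
    have h10 := h3 l (by omega)
    rw [dist_comm] at h10
    have h11 : dist (Z n i) (Z n l) ≤ (4 * B + c + 1) * (τ ^ p * m) := by linarith
    calc dist (Z n i) (Z n l) * τ ≤ (4 * B + c + 1) * (τ ^ p * m) * τ := by gcongr
      _ = (4 * B + c + 1) * (τ ^ p * m * τ) := by ring
      _ ≤ _ := by gcongr
  by_cases hdm : m < d
  · refine fin 0 (Nat.zero_le _) ?_ fun G h1 h2 h3 => ?_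
    · rw [pow_zero, one_mul]; nlinarith
    · have := h2 j hj
      rw [hT.top] at this
      omega
  · push Not at hdm
    classical
    obtain ⟨p, hpn, hp, hp1⟩ : ∃ p < n, d ≤ τ ^ p * m ∧ τ ^ (p + 1) * m < d := by
      have hex : ∃ q, τ ^ q * m < d := ⟨n, hn.trans_le hdδ⟩
      have hq0 : Nat.find hex ≠ 0 := fun h0 => by
        have := Nat.find_spec hex
        rw [h0, pow_zero, one_mul] at this
        linarith
      have hqn := Nat.find_min' hex (hn.trans_le hdδ)
      refine ⟨Nat.find hex - 1, by omega, not_lt.1 (Nat.find_min hex (by omega)), ?_⟩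
      rw [Nat.sub_add_cancel (by omega)]
      exact Nat.find_spec hex
    refine fin p hpn.le (by rw [pow_succ] at hp1; linarith) fun G h1 h2 h3 => ?_
    have h4 := hc m x y M Z f hm0 hT p (G i) (G j) (h1 (hil.trans hlj)) (h2 j hj) ?_
    · omega
    have h8 := dist_triangle4 (Z p (G i)) (Z n i) (Z n j) (Z p (G j))
    have h9 := h3 i (by omega)
    have h10 := h3 j hj
    rw [dist_comm] at h9
    have hmp : 0 < τ ^ p * m := by positivity
    have h11 : 4 * B + 1 ≤ (4 + 2 ^ s) * b := by nlinarith
    have h12 := mul_le_mul_of_nonneg_right h11 hmp.le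
    linarith

end Tower

section Doubling

variable {X : Type*} [MetricSpace X]

theorem ChainCond.chainLinked {K : ℝ} {N : ℕ} (h : ChainCond X (1 / 2) K N) :
    ChainLinked X K (1 / 2) N := by
  intro x y R hR
  have hR0 : 0 < R := dist_nonneg.trans_lt hR
  obtain ⟨z, h0, hN, hball, hstep⟩ := h x R hR0 x (subset_closure (mem_ball_self hR0)) y
    (subset_closure (by rwa [mem_ball, dist_comm]))
  refine ⟨N, z, ⟨h0, hN, fun i hi => hball i hi (mem_ball_self (by positivity)), fun i hi => ?_⟩,
    by simp⟩
  simpa using hstep (i + 1) (by omega) hi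

/-- Points are joined by arbitrarily fine chains of bounded turning. -/
def BoundedTurning (X : Type*) [MetricSpace X] (A : ℝ) : Prop :=
  ∀ (x y : X) (δ : ℝ), x ≠ y → 0 < δ → ∃ M z, IsPath univ δ x y M z ∧
    ∀ i l j, i ≤ l → l ≤ j → j ≤ M → dist (z i) (z l) ≤ A * max (dist (z i) (z j)) δ

theorem IsRBC.exists_boundedTurning {K : ℝ} (hK : 1 < K) (h : IsRBC X K) :
    ∃ A, 3 ≤ A ∧ BoundedTurning X A := by
  obtain ⟨N, hN⟩ := h (1 / 2) ⟨by norm_num, by norm_num⟩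
  have h1 : ChainLinked X K (1 / 2) (N + 1) := fun x y R hR =>
    (hN.chainLinked x y R hR).mono subset_rfl le_rfl (by linarith)
  exact exists_bounded_turning (by linarith : 1 ≤ 2 * K)
    (by linarith [(Nat.cast_nonneg N : (0:ℝ) ≤ N)] : 1 ≤ (N : ℝ) + 1)
    fun n => ChainLinked.pow hK.le (by positivity) h1 n

theorem MetricDoubling.exists_cover (h : MetricDoubling X) :
    ∃ N : ℕ, ∀ (k : ℕ) (x : X) (R : ℝ), 0 < R → ∃ t : Finset X, #t ≤ N ^ k ∧
      ball x R ⊆ ⋃ z ∈ t, ball z (R / 2 ^ k) := by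
  classical
  obtain ⟨N, -, hN⟩ := h
  refine ⟨N, fun k => ?_⟩
  induction k with
  | zero => exact fun x R hR => ⟨{x}, by simp, by simp⟩
  | succ k ih =>
    intro x R hR
    obtain ⟨z, hz⟩ := hN x R hR
    choose t ht ht' using fun i => ih (z i) (R / 2) (by positivity)
    refine ⟨Finset.univ.biUnion t, ?_, fun v hv => ?_⟩
    · refine (card_biUnion_le_card_mul _ _ _ fun i _ => ht i).trans ?_
      rw [card_univ, Fintype.card_fin, pow_succ, mul_comm]
    · obtain ⟨i, hi⟩ := mem_iUnion.1 (hz hv)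
      have := ht' i hi
      simp only [mem_iUnion, exists_prop] at this ⊢
      obtain ⟨u, hu, hvu⟩ := this
      refine ⟨u, Finset.mem_biUnion.2 ⟨i, Finset.mem_univ _, hu⟩, ?_⟩
      rwa [pow_succ', ← div_div]

theorem MetricDoubling.exists_card_bound (h : MetricDoubling X) {ε : ℝ} (hε : 0 < ε) :
    ∃ N : ℕ, ∀ (x : X) (R : ℝ) (v : ℕ → X) (c : ℕ), 0 < R → (∀ i < c, v i ∈ ball x R) →
      (∀ i j, i < j → j < c → ε * R ≤ dist (v i) (v j)) → c ≤ N := by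
  obtain ⟨N, hN⟩ := h.exists_cover
  obtain ⟨k, hk⟩ := exists_pow_lt_of_lt_one (half_pos hε) (by norm_num : (1 / 2 : ℝ) < 1)
  refine ⟨N ^ k, fun x R v c hR hv hsep => ?_⟩
  obtain ⟨t, ht, hcov⟩ := hN k x R hR
  have hex : ∀ i ∈ Finset.range c, ∃ u ∈ t, dist (v i) u < R / 2 ^ k := fun i hi => by
    have := hcov (hv i (Finset.mem_range.1 hi))
    simpa using this
  have : Nonempty X := ⟨x⟩
  choose! F hFt hF using hex
  have hlt : R / 2 ^ k < ε / 2 * R := by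
    rw [one_div, inv_pow] at hk
    rw [div_eq_inv_mul]
    exact mul_lt_mul_of_pos_right hk hR
  have hinj : ∀ i j, i < j → j < c → F i ≠ F j := fun i j hij hj hF' => by
    have h1 := hF i (Finset.mem_range.2 (hij.trans hj))
    have h2 := hF j (Finset.mem_range.2 hj)
    rw [← hF'] at h2
    have h3 := dist_triangle_right (v i) (v j) (F i)
    have h4 := hsep i j hij hj
    linarith
  have := Finset.card_le_card_of_injOn (s := Finset.range c) (t := t) F hFt fun i hi j hj hij => by
    simp only [Finset.coe_range, Set.mem_Iio] at hi hj
    by_contra hne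
    rcases lt_or_gt_of_ne hne with h1 | h1
    · exact hinj i j h1 hj hij
    · exact hinj j i h1 hi hij.symm
  rw [card_range] at this
  omega

theorem MetricDoubling.isCompact_closedBall [CompleteSpace X] (h : MetricDoubling X) (x : X)
    (R : ℝ) : IsCompact (closedBall x R) := by
  refine isCompact_iff_totallyBounded_isComplete.2 ⟨?_, isClosed_closedBall.isComplete⟩
  obtain ⟨N, hN⟩ := h.exists_cover
  rw [Metric.totallyBounded_iff]
  intro ε hε
  have hR : 0 < |R| + 1 := by positivity
  obtain ⟨k, hk⟩ := exists_pow_lt_of_lt_one (div_pos hε hR) (by norm_num : (1 / 2 : ℝ) < 1)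
  obtain ⟨t, -, ht⟩ := hN k x _ hR
  refine ⟨t, t.finite_toSet, ?_⟩
  refine (closedBall_subset_ball (by linarith [le_abs_self R])).trans (ht.trans ?_)
  refine iUnion₂_mono fun z _ => ball_subset_ball ?_
  rw [one_div, inv_pow, lt_div_iff₀ hR] at hk
  rw [div_eq_inv_mul]
  exact hk.le

end Doubling

section Hierarchy

variable {X : Type*} [MetricSpace X]

/-- The indices `0, …, M` of the chain `z` are cut at `t 0 ≤ ⋯ ≤ t q` into pieces which stay within
`r` of their first point, but not within less than `ρ`. -/
structure IsPartition (z : ℕ → X) (M : ℕ) (r ρ : ℝ) (q : ℕ) (t : ℕ → ℕ) : Prop where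
  mono : Monotone t
  zero : t 0 = 0
  last : t q = M
  near : ∀ k < q, ∀ l, t k ≤ l → l ≤ t (k + 1) → dist (z (t k)) (z l) ≤ r
  far : ∀ k < q, ∃ l, t k ≤ l ∧ l ≤ t (k + 1) ∧ ρ ≤ dist (z (t k)) (z l)

theorem exists_coarsening {z : ℕ → X} {q : ℕ} {t : ℕ → ℕ} {r ρ : ℝ} (ht : Monotone t)
    (hnear : ∀ k < q, ∀ l, t k ≤ l → l ≤ t (k + 1) → dist (z (t k)) (z l) ≤ r) (hr : r ≤ ρ)
    (hρ : 0 < ρ) (n : ℕ) :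
    ∀ k₀, k₀ ≤ q → q ≤ k₀ + n → (∃ l, t k₀ ≤ l ∧ l ≤ t q ∧ ρ ≤ dist (z (t k₀)) (z l)) →
    ∃ (q' : ℕ) (s : ℕ → ℕ), Monotone s ∧ s 0 = k₀ ∧ s q' = q ∧
      ∀ k < q', (∀ l, t (s k) ≤ l → l ≤ t (s (k + 1)) → dist (z (t (s k))) (z l) ≤ 3 * ρ) ∧
        ∃ l, t (s k) ≤ l ∧ l ≤ t (s (k + 1)) ∧ ρ ≤ dist (z (t (s k))) (z l) := by
  induction n with
  | zero =>
    rintro k₀ hk hq ⟨l, h1, h2, h3⟩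
    obtain rfl : q = k₀ := by omega
    obtain rfl : l = t q := le_antisymm h2 h1
    rw [dist_self] at h3
    linarith
  | succ n ih =>
    intro k₀ hk hq hex
    classical
    have hex' : ∃ k, ∃ l, t k₀ ≤ l ∧ l ≤ t k ∧ ρ ≤ dist (z (t k₀)) (z l) := ⟨q, hex⟩
    obtain ⟨k₁, hk₁, hk₁q, hmin⟩ : ∃ k₁, (∃ l, t k₀ ≤ l ∧ l ≤ t k₁ ∧ ρ ≤ dist (z (t k₀)) (z l)) ∧
        k₁ ≤ q ∧ ∀ k < k₁, ∀ l, t k₀ ≤ l → l ≤ t k → dist (z (t k₀)) (z l) < ρ :=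
      ⟨Nat.find hex', Nat.find_spec hex', Nat.find_min' hex' hex, fun k hk l h1 h2 => by
        have := Nat.find_min hex' hk
        push Not at this
        exact this l h1 h2⟩
    have hlt : k₀ < k₁ := by
      by_contra! hle
      obtain ⟨l, h1, h2, h3⟩ := hk₁
      obtain rfl : l = t k₀ := le_antisymm (h2.trans (ht hle)) h1
      rw [dist_self] at h3
      linarith
    have hnear₁ : ∀ l, t k₀ ≤ l → l ≤ t k₁ → dist (z (t k₀)) (z l) ≤ 2 * ρ := by
      intro l h1 h2
      rcases le_total l (t (k₁ - 1)) with h3 | h3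
      · linarith [hmin (k₁ - 1) (by omega) l h1 h3]
      · have h4 := hmin (k₁ - 1) (by omega) (t (k₁ - 1)) (ht (by omega)) le_rfl
        have h5 := hnear (k₁ - 1) (by omega) l h3 (by rwa [Nat.sub_add_cancel (by omega)])
        linarith [dist_triangle (z (t k₀)) (z (t (k₁ - 1))) (z l)]
    by_cases hrem : ∃ l, t k₁ ≤ l ∧ l ≤ t q ∧ ρ ≤ dist (z (t k₁)) (z l)
    · obtain ⟨q', s, hs, hs0, hsq, hp⟩ := ih k₁ hk₁q (by omega) hrem
      refine ⟨q' + 1, fun i => Nat.casesOn i k₀ s, monotone_nat_of_le_succ ?_, rfl, hsq, ?_⟩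
      · rintro (_ | k)
        · exact hlt.le.trans hs0.ge
        · exact hs (Nat.le_succ k)
      · rintro (_ | k) hk
        · simp only [hs0]
          exact ⟨fun l h1 h2 => (hnear₁ l h1 h2).trans (by linarith), hk₁⟩
        · exact hp k (by omega)
    · push Not at hrem
      refine ⟨1, fun i => if i = 0 then k₀ else q, monotone_nat_of_le_succ ?_, rfl, rfl, ?_⟩
      · intro i
        by_cases h : i = 0
        · simp [h, hk]
        · simp [h]
      · intro k hk'
        obtain rfl : k = 0 := by omega
        refine ⟨fun l h1 h2 => ?_, hex⟩
        simp only [if_pos, Nat.zero_add, one_ne_zero, if_false] at h1 h2 ⊢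
        rcases le_total l (t k₁) with h3 | h3
        · linarith [hnear₁ l h1 h3]
        · have h4 := hnear₁ (t k₁) (ht hlt.le) le_rfl
          linarith [hrem l h3 h2, dist_triangle (z (t k₀)) (z (t k₁)) (z l)]

/-- Successively coarser partitions at scales `Λ ^ p * ρ` for `p ≤ n`. -/
structure IsPartitionTower (z : ℕ → X) (M : ℕ) (A Λ ρ : ℝ) (n : ℕ) (q : ℕ → ℕ)
    (s t : ℕ → ℕ → ℕ) : Prop where
  part : ∀ p ≤ n, IsPartition z M (A * (Λ ^ p * ρ)) (Λ ^ p * ρ) (q p) (t p)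
  mono : ∀ p < n, Monotone (s p)
  zero : ∀ p < n, s p 0 = 0
  last : ∀ p < n, s p (q (p + 1)) = q p
  comp : ∀ p < n, ∀ k, t (p + 1) k = t p (s p k)

theorem IsPartitionTower.extend {z : ℕ → X} {M n : ℕ} {A Λ ρ : ℝ} {q : ℕ → ℕ} {s t : ℕ → ℕ → ℕ}
    (h : IsPartitionTower z M A Λ ρ n q s t) {q' : ℕ} {s' : ℕ → ℕ} (hs : Monotone s') (hs0 : s' 0 = 0)
    (hsq : s' q' = q n)
    (hp : IsPartition z M (A * (Λ ^ (n + 1) * ρ)) (Λ ^ (n + 1) * ρ) q' (t n ∘ s')) :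
    ∃ Q S T, IsPartitionTower z M A Λ ρ (n + 1) Q S T ∧ Q (n + 1) = q' := by
  refine ⟨fun p => if p ≤ n then q p else q', fun p => if p < n then s p else s',
    fun p => if p ≤ n then t p else t n ∘ s', ⟨?_, ?_, ?_, ?_, ?_⟩, by simp⟩
  · intro p hpn
    rcases hpn.lt_or_eq with hpn | rfl
    · have : p ≤ n := by omega
      simpa [this] using h.part p this
    · simpa using hp
  · intro p hpn
    split_ifs with h1
    · exact h.mono p h1
    · exact hs
  · intro p hpn
    split_ifs with h1
    · exact h.zero p h1
    · exact hs0
  · intro p hpn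
    rcases (Nat.lt_succ_iff.1 hpn).lt_or_eq with h1 | rfl
    · have h2 : p + 1 ≤ n := h1
      simpa [h1, h1.le, h2] using h.last p h1
    · simpa using hsq
  · intro p hpn k
    rcases (Nat.lt_succ_iff.1 hpn).lt_or_eq with h1 | rfl
    · have h2 : p + 1 ≤ n := h1
      simpa [h1, h1.le, h2] using h.comp p h1 k
    · simp

theorem exists_partitionTower {z : ℕ → X} {M : ℕ} {A Λ ρ δ : ℝ} (hA : 3 ≤ A) (hΛ : A ≤ Λ)
    (hρ : 0 < ρ) (hδ : δ ≤ ρ) (hz : ∀ i < M, dist (z i) (z (i + 1)) < δ) (n : ℕ)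
    (hn : Λ ^ n * ρ ≤ dist (z 0) (z M)) :
    ∃ q s t, IsPartitionTower z M A Λ ρ n q s t := by
  induction n with
  | zero =>
    rw [pow_zero, one_mul] at hn
    obtain ⟨q, s, hs, hs0, hsq, hp⟩ := exists_coarsening (z := z) (q := M) (t := id) (r := ρ) (ρ := ρ)
      monotone_id (fun k hk l h1 h2 => by
        simp only [id] at h1 h2 ⊢
        rcases h1.eq_or_lt with rfl | h3
        · rw [dist_self]; exact hρ.le
        · obtain rfl : l = k + 1 := by omega
          exact (hz k hk).le.trans hδ) le_rfl hρ M 0 (Nat.zero_le _) (by omega)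
      ⟨M, Nat.zero_le _, le_rfl, hn⟩
    refine ⟨fun _ => q, fun _ => id, fun _ => s, ⟨?_, by simp, by simp, by simp, by simp⟩⟩
    intro p hp'
    obtain rfl : p = 0 := by omega
    rw [pow_zero, one_mul]
    refine ⟨hs, hs0, hsq, fun k hk l h1 h2 => ((hp k hk).1 l h1 h2).trans ?_,
      fun k hk => (hp k hk).2⟩
    exact mul_le_mul_of_nonneg_right hA hρ.le
  | succ n ih =>
    have hΛ0 : 0 < Λ := by linarith
    have hn0 : 0 < Λ ^ n * ρ := by positivity
    have hle : A * (Λ ^ n * ρ) ≤ Λ ^ (n + 1) * ρ := by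
      rw [pow_succ', mul_assoc]
      exact mul_le_mul_of_nonneg_right hΛ hn0.le
    obtain ⟨q, s, t, h⟩ := ih (by nlinarith)
    have hpart := h.part n le_rfl
    have hn1 : 0 < Λ ^ (n + 1) * ρ := by nlinarith
    obtain ⟨q', s', hs, hs0, hsq, hp⟩ := exists_coarsening (ρ := Λ ^ (n + 1) * ρ) hpart.mono
      hpart.near hle hn1 (q n) 0 (Nat.zero_le _) (by omega)
      ⟨M, by rw [hpart.zero]; exact Nat.zero_le _, hpart.last.ge, by rwa [hpart.zero]⟩
    obtain ⟨Q, S, T, h', -⟩ := h.extend hs hs0 hsq ⟨hpart.mono.comp hs, by simp [hs0, hpart.zero],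
      by simp [hsq, hpart.last], fun k hk l h1 h2 => ((hp k hk).1 l h1 h2).trans
        (mul_le_mul_of_nonneg_right hA hn1.le), fun k hk => (hp k hk).2⟩
    exact ⟨Q, S, T, h'⟩

/-- A discrete arc `v 0, …, v (q 0)` with a nested sequence of partitions into `q p` pieces, cut at
`S p k`, whose diameters are comparable to `Λ ^ p * ρ`. -/
structure IsHierarchy (A Λ ρ : ℝ) (P : ℕ) (v : ℕ → X) (q : ℕ → ℕ) (s S : ℕ → ℕ → ℕ) : Prop where
  top : q P = 1
  mono : ∀ p < P, Monotone (s p)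
  zero : ∀ p < P, s p 0 = 0
  last : ∀ p < P, s p (q (p + 1)) = q p
  base : ∀ k, S 0 k = k
  comp : ∀ p < P, ∀ k, S (p + 1) k = S p (s p k)
  near : ∀ p ≤ P, ∀ k < q p, ∀ j, S p k ≤ j → j ≤ S p (k + 1) →
    dist (v (S p k)) (v j) ≤ A * (Λ ^ p * ρ)
  far : ∀ p ≤ P, ∀ k < q p, ∀ i j, i ≤ S p k → S p (k + 1) ≤ j → j ≤ q 0 →
    Λ ^ p * ρ ≤ 2 * A * dist (v i) (v j)

theorem BoundedTurning.exists_hierarchy {A Λ : ℝ} (h : BoundedTurning X A) (hA : 3 ≤ A)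
    (hΛ : A ≤ Λ) {x y : X} (hxy : x ≠ y) (P : ℕ) :
    ∃ ρ v q s S, 0 < ρ ∧ Λ ^ (P + 1) * ρ = dist x y ∧ IsHierarchy A Λ ρ (P + 1) v q s S ∧
      v 0 = x ∧ v (q 0) = y := by
  have hR : 0 < dist x y := dist_pos.2 hxy
  have hΛ1 : 1 ≤ Λ := by linarith
  obtain ⟨ρ, hρ⟩ : ∃ ρ, ρ = dist x y / Λ ^ (P + 1) := ⟨_, rfl⟩
  have hρ0 : 0 < ρ := by rw [hρ]; positivity
  have hρR : Λ ^ (P + 1) * ρ = dist x y := by rw [hρ]; field_simp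
  have hscale : ∀ p, ρ ≤ Λ ^ p * ρ := fun p => le_mul_of_one_le_left hρ0.le (one_le_pow₀ hΛ1)
  obtain ⟨δ, hδ⟩ : ∃ δ, δ = ρ / (4 * A) := ⟨_, rfl⟩
  have hδ0 : 0 < δ := by rw [hδ]; positivity
  have hδA : 4 * (A * δ) = ρ := by rw [hδ]; field_simp
  have hδρ : δ ≤ ρ := by nlinarith
  obtain ⟨M, z, hz, hturn⟩ := h x y δ hxy hδ0
  have hPR : Λ ^ P * ρ ≤ dist (z 0) (z M) := by
    rw [hz.start, hz.finish, ← hρR, pow_succ]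
    have := hscale P
    nlinarith
  obtain ⟨q₁, s₁, t₁, hf₁⟩ := exists_partitionTower hA hΛ hρ0 hδρ hz.step P hPR
  have hpart := hf₁.part P le_rfl
  obtain ⟨q, s, t, hf, hq⟩ := hf₁.extend (q' := 1) (s' := fun k => if k = 0 then 0 else q₁ P)
    (monotone_nat_of_le_succ fun k => by
      by_cases hk : k = 0
      · simp [hk]
      · simp [hk]) rfl rfl
    ⟨hpart.mono.comp (monotone_nat_of_le_succ fun k => by
      by_cases hk : k = 0
      · simp [hk]
      · simp [hk]), by simp [hpart.zero], by simp [hpart.last], fun k hk l _ hl => by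
        obtain rfl : k = 0 := by omega
        simp only [Function.comp_apply, if_pos, hpart.zero, Nat.zero_add, one_ne_zero, if_false,
          hpart.last] at hl ⊢
        refine (hturn 0 l M (Nat.zero_le _) hl le_rfl).trans ?_
        rw [hz.start, hz.finish, max_eq_left (by linarith [hscale (P + 1)]), hρR],
      fun k hk => by
        obtain rfl : k = 0 := by omega
        refine ⟨M, by simp [hpart.zero], by simp [hpart.last], ?_⟩
        simp [hpart.zero, hz.start, hz.finish, hρR]⟩
  let S : ℕ → ℕ → ℕ := fun p => Nat.rec id (fun p F k => F (s p k)) p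
  have hS : ∀ p k, S (p + 1) k = S p (s p k) := fun _ _ => rfl
  have hSt : ∀ p ≤ P + 1, ∀ k, t p k = t 0 (S p k) := by
    intro p
    induction p with
    | zero => exact fun _ _ => rfl
    | succ p ih =>
      intro hp k
      rw [hf.comp p (by omega), ih (by omega), hS]
  have h0 := hf.part 0 (Nat.zero_le _)
  refine ⟨ρ, fun j => z (t 0 j), q, s, S, hρ0, hρR, ⟨hq, hf.mono, hf.zero, hf.last, fun _ => rfl,
    fun p _ k => hS p k, fun p hp k hk j h1 h2 => ?_, fun p hp k hk i j h1 h2 h3 => ?_⟩,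
    by simp [h0.zero, hz.start], by simp [h0.last, hz.finish]⟩
  · have := (hf.part p hp).near k hk (t 0 j) (by rw [hSt p hp]; exact h0.mono h1)
      (by rw [hSt p hp]; exact h0.mono h2)
    rwa [hSt p hp k] at this
  · obtain ⟨l, hl1, hl2, hl3⟩ := (hf.part p hp).far k hk
    have e1 : t 0 i ≤ t p k := by rw [hSt p hp]; exact h0.mono h1
    have e2 : t p (k + 1) ≤ t 0 j := by rw [hSt p hp]; exact h0.mono h2
    have e3 : t 0 j ≤ M := by rw [← h0.last]; exact h0.mono h3
    have h4 := hturn (t 0 i) (t p k) (t 0 j) e1 (by omega) e3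
    have h5 := hturn (t 0 i) l (t 0 j) (by omega) (by omega) e3
    have h6 := dist_triangle_left (z (t p k)) (z l) (z (t 0 i))
    have h7 := hscale p
    rcases max_cases (dist (z (t 0 i)) (z (t 0 j))) δ with ⟨h8, -⟩ | ⟨h8, -⟩
    · rw [h8] at h4 h5
      linarith
    · rw [h8] at h4 h5
      linarith

end Hierarchy

section Weights

/-- `w 0 < ⋯ < w q`, and consecutive increments differ by a factor of at most `M`. -/
structure IsWeight (M : ℝ) (q : ℕ) (w : ℕ → ℝ) : Prop where
  pos : ∀ k < q, w k < w (k + 1)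
  right : ∀ k, k + 1 < q → w (k + 2) - w (k + 1) ≤ M * (w (k + 1) - w k)
  left : ∀ k, k + 1 < q → w (k + 1) - w k ≤ M * (w (k + 2) - w (k + 1))

/-- `w'` refines `w` along `s`: the increment of `w` over a piece is distributed evenly enough
among the increments of `w'`. -/
structure IsWeightRefinement (M : ℝ) (q : ℕ) (s : ℕ → ℕ) (w w' : ℕ → ℝ) : Prop where
  value : ∀ k ≤ q, w' (s k) = w k
  lower : ∀ k < q, ∀ j, s k ≤ j → j < s (k + 1) → w (k + 1) - w k ≤ M * (w' (j + 1) - w' j)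
  upper : ∀ k < q, ∀ j, s k ≤ j → j < s (k + 1) →
    w' (j + 1) - w' j ≤ (1 - 2 / M) * (w (k + 1) - w k)

theorem exists_subdivision {M : ℝ} {c : ℕ} (hc : 3 ≤ c) (hM : c ≤ M) :
    ∃ Φ : ℕ → ℝ, Φ 0 = 0 ∧ Φ c = 1 ∧ Φ 1 - Φ 0 = 1 / M ∧ Φ c - Φ (c - 1) = 1 / M ∧
      ∀ r < c, 1 / M ≤ Φ (r + 1) - Φ r ∧ Φ (r + 1) - Φ r ≤ 1 - 2 / M := by
  have hc3 : (3 : ℝ) ≤ c := by exact_mod_cast hc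
  have hM0 : 0 < M := by linarith
  have hc2 : (0 : ℝ) < c - 2 := by linarith
  let Φ : ℕ → ℝ := fun r => if r = 0 then 0 else if r = c then 1 else
    1 / M + (r - 1) * ((1 - 2 / M) / (c - 2))
  have hΦ0 : Φ 0 = 0 := if_pos rfl
  have hΦc : Φ c = 1 := by
    have hc0 : c ≠ 0 := by omega
    simp [Φ, hc0]
  have hΦm : ∀ r, r ≠ 0 → r ≠ c → Φ r = 1 / M + (r - 1) * ((1 - 2 / M) / (c - 2)) := by
    intro r h1 h2
    simp only [Φ]; rw [if_neg h1, if_neg h2]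
  have hmax : 1 / M ≤ 1 - 2 / M := by
    rw [div_le_iff₀ hM0, sub_mul, div_mul_cancel₀ _ hM0.ne']; linarith
  have hΦ1 : Φ 1 - Φ 0 = 1 / M := by
    rw [hΦ0, hΦm 1 (by omega) (by omega)]; simp
  have hΦl : Φ c - Φ (c - 1) = 1 / M := by
    rw [hΦc, hΦm (c - 1) (by omega) (by omega), Nat.cast_sub (by omega)]
    push_cast
    field_simp
    ring
  refine ⟨Φ, hΦ0, hΦc, hΦ1, hΦl, fun r hr => ?_⟩
  by_cases h0 : r = 0
  · subst h0
    rw [Nat.zero_add, hΦ1]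
    exact ⟨le_rfl, hmax⟩
  by_cases h1 : r + 1 = c
  · have : r = c - 1 := by omega
    rw [h1, this, hΦl]
    exact ⟨le_rfl, hmax⟩
  have h2 : Φ (r + 1) - Φ r = (1 - 2 / M) / (c - 2) := by
    rw [hΦm _ (by omega) h1, hΦm r h0 (by omega)]
    push_cast
    ring
  rw [h2]
  constructor
  · rw [le_div_iff₀ hc2]
    have : 1 / M * (c - 2) = c / M - 2 / M := by ring
    rw [this]
    have : c / M ≤ 1 := by rw [div_le_one hM0]; exact hM
    linarith
  · refine div_le_self ?_ (by linarith)
    have : 0 < 1 / M := by positivity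
    linarith

/-- Every index below `q'` lies in a piece of the subdivision `s`. -/
theorem exists_piece {q q' : ℕ} {s : ℕ → ℕ} (h0 : s 0 = 0) (hq : s q = q')
    {j : ℕ} (hj : j < q') : ∃ k < q, s k ≤ j ∧ j < s (k + 1) := by
  classical
  have hex : ∃ k, j < s k := ⟨q, by omega⟩
  have h1 := Nat.find_spec hex
  have h2 : Nat.find hex ≠ 0 := fun h => by rw [h, h0] at h1; omega
  have h3 : Nat.find hex ≤ q := Nat.find_min' hex (by omega)
  refine ⟨Nat.find hex - 1, by omega, not_lt.1 (Nat.find_min hex (by omega)), ?_⟩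
  rwa [Nat.sub_add_cancel (by omega)]

theorem IsWeight.exists_refinement {M : ℝ} {q q' : ℕ} {s : ℕ → ℕ} {w : ℕ → ℝ}
    (h : IsWeight M q w) (hs : Monotone s) (h0 : s 0 = 0) (hq : s q = q')
    (hlow : ∀ k < q, s k + 3 ≤ s (k + 1)) (hup : ∀ k < q, (s (k + 1) : ℝ) ≤ s k + M)
    (hM : 3 ≤ M) : ∃ w', IsWeight M q' w' ∧ IsWeightRefinement M q s w w' := by
  have hM0 : 0 < M := by linarith
  have hex : ∀ k, ∃ Φ : ℕ → ℝ, k < q → Φ 0 = 0 ∧ Φ (s (k + 1) - s k) = 1 ∧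
      Φ 1 - Φ 0 = 1 / M ∧ Φ (s (k + 1) - s k) - Φ (s (k + 1) - s k - 1) = 1 / M ∧
      ∀ r < s (k + 1) - s k, 1 / M ≤ Φ (r + 1) - Φ r ∧ Φ (r + 1) - Φ r ≤ 1 - 2 / M := by
    intro k
    by_cases hk : k < q
    · have h1 := hlow k hk
      obtain ⟨Φ, hΦ⟩ := exists_subdivision (M := M) (c := s (k + 1) - s k) (by omega) (by
        rw [Nat.cast_sub (by omega)]; linarith [hup k hk])
      exact ⟨Φ, fun _ => hΦ⟩
    · exact ⟨0, fun h => absurd h hk⟩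
  choose Φ hΦ using hex
  have hpiece : ∀ j, ∃ k, j < q' → k < q ∧ s k ≤ j ∧ j < s (k + 1) := by
    intro j
    by_cases hj : j < q'
    · obtain ⟨k, hk⟩ := exists_piece h0 hq hj
      exact ⟨k, fun _ => hk⟩
    · exact ⟨0, fun h => absurd h hj⟩
  choose par hpar using hpiece
  have huniq : ∀ j k, k < q → s k ≤ j → j < s (k + 1) → par j = k := by
    intro j k hk h1 h2
    have h3 : s (k + 1) ≤ q' := by rw [← hq]; exact hs hk
    obtain ⟨h4, h5, h6⟩ := hpar j (by omega)
    by_contra hne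
    rcases lt_or_gt_of_ne hne with h7 | h7
    · have := hs (show par j + 1 ≤ k from h7); omega
    · have := hs (show k + 1 ≤ par j from h7); omega
  obtain ⟨w', hw'⟩ : ∃ w' : ℕ → ℝ, w' = fun j => if j < q' then
    w (par j) + (w (par j + 1) - w (par j)) * Φ (par j) (j - s (par j)) else w q := ⟨_, rfl⟩
  have hval : ∀ k < q, w' (s k) = w k := by
    intro k hk
    have h1 := hlow k hk
    have h3 : s (k + 1) ≤ q' := by rw [← hq]; exact hs hk
    rw [hw']
    dsimp only
    rw [if_pos (by omega), huniq (s k) k hk le_rfl (by omega), Nat.sub_self, (hΦ k hk).1]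
    ring
  have hval' : ∀ k ≤ q, w' (s k) = w k := by
    intro k hk
    rcases hk.lt_or_eq with hk | rfl
    · exact hval k hk
    · rw [hw']
      simp [hq]
  have hform : ∀ k < q, ∀ r ≤ s (k + 1) - s k, w' (s k + r) = w k + (w (k + 1) - w k) * Φ k r := by
    intro k hk r hr
    have h1 := hlow k hk
    have h3 : s (k + 1) ≤ q' := by rw [← hq]; exact hs hk
    rcases hr.lt_or_eq with hr | rfl
    · rw [hw']
      dsimp only
      rw [if_pos (by omega), huniq (s k + r) k hk (by omega) (by omega), Nat.add_sub_cancel_left]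
    · rw [Nat.add_sub_cancel' (by omega), hval' (k + 1) hk, (hΦ k hk).2.1]
      ring
  have hdiff : ∀ k < q, ∀ r < s (k + 1) - s k, w' (s k + r + 1) - w' (s k + r) =
      (w (k + 1) - w k) * (Φ k (r + 1) - Φ k r) := by
    intro k hk r hr
    rw [add_assoc, hform k hk (r + 1) hr, hform k hk r hr.le]
    ring
  have hlower : ∀ k < q, ∀ j, s k ≤ j → j < s (k + 1) →
      w (k + 1) - w k ≤ M * (w' (j + 1) - w' j) := by
    intro k hk j h1 h2
    obtain ⟨r, rfl⟩ : ∃ r, j = s k + r := ⟨j - s k, by omega⟩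
    rw [hdiff k hk r (by omega)]
    have h3 := ((hΦ k hk).2.2.2.2 r (by omega)).1
    have h4 := h.pos k hk
    rw [div_le_iff₀ hM0] at h3
    nlinarith
  have hupper : ∀ k < q, ∀ j, s k ≤ j → j < s (k + 1) →
      w' (j + 1) - w' j ≤ (1 - 2 / M) * (w (k + 1) - w k) := by
    intro k hk j h1 h2
    obtain ⟨r, rfl⟩ : ∃ r, j = s k + r := ⟨j - s k, by omega⟩
    rw [hdiff k hk r (by omega), mul_comm]
    have h3 := ((hΦ k hk).2.2.2.2 r (by omega)).2
    have h4 := h.pos k hk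
    exact mul_le_mul_of_nonneg_right h3 (by linarith)
  have hg : 1 - 2 / M ≤ 1 := by
    have : 0 < 2 / M := by positivity
    linarith
  have hpos : ∀ j < q', w' j < w' (j + 1) := by
    intro j hj
    obtain ⟨k, hk, h1, h2⟩ := exists_piece h0 hq hj
    have h3 := hlower k hk j h1 h2
    have h4 := h.pos k hk
    have h5 : 0 < M * (w' (j + 1) - w' j) := by linarith
    linarith [(mul_pos_iff_of_pos_left hM0).1 h5]
  have hadj : ∀ j, j + 1 < q' → (∃ k < q, (s k ≤ j ∧ j + 1 < s (k + 1))) ∨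
      ∃ k, k + 1 < q ∧ w' (j + 1) - w' j = (w (k + 1) - w k) * (1 / M) ∧
        w' (j + 2) - w' (j + 1) = (w (k + 2) - w (k + 1)) * (1 / M) := by
    intro j hj
    obtain ⟨k, hk, h1, h2⟩ := exists_piece h0 hq (j := j) (by omega)
    by_cases h3 : j + 1 < s (k + 1)
    · exact Or.inl ⟨k, hk, h1, h3⟩
    · right
      have h4 : s (k + 1) = j + 1 := by omega
      have h5 : k + 1 < q := by
        by_contra h6
        have : k + 1 = q := by omega
        rw [this] at h4; omega
      have h6 := hlow k hk
      have h7 := hlow (k + 1) h5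
      refine ⟨k, h5, ?_, ?_⟩
      · have h8 := hdiff k hk (s (k + 1) - s k - 1) (by omega)
        rw [show s k + (s (k + 1) - s k - 1) = j by omega,
          show s (k + 1) - s k - 1 + 1 = s (k + 1) - s k by omega, (hΦ k hk).2.2.2.1] at h8
        exact h8
      · have h8 := hdiff (k + 1) h5 0 (by omega)
        rw [add_zero, h4, Nat.zero_add, (hΦ (k + 1) h5).2.2.1] at h8
        exact h8
  refine ⟨w', ⟨hpos, fun j hj => ?_, fun j hj => ?_⟩, hval', hlower, hupper⟩
  · rcases hadj j hj with ⟨k, hk, h1, h2⟩ | ⟨k, hk, h1, h2⟩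
    · have h3 := hlower k hk j h1 (by omega)
      have h4 := hupper k hk (j + 1) (by omega) h2
      have h5 := h.pos k hk
      have h6 := mul_le_mul_of_nonneg_right hg (by linarith : 0 ≤ w (k + 1) - w k)
      linarith
    · rw [h1, h2, ← mul_assoc]
      exact mul_le_mul_of_nonneg_right (h.right k hk) (by positivity)
  · rcases hadj j hj with ⟨k, hk, h1, h2⟩ | ⟨k, hk, h1, h2⟩
    · have h3 := hupper k hk j h1 (by omega)
      have h4 := hlower k hk (j + 1) (by omega) h2
      have h5 := h.pos k hk
      have h6 := mul_le_mul_of_nonneg_right hg (by linarith : 0 ≤ w (k + 1) - w k)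
      linarith
    · rw [h1, h2, ← mul_assoc]
      exact mul_le_mul_of_nonneg_right (h.left k hk) (by positivity)

theorem exists_weights {M : ℝ} (hM : 3 ≤ M) {P : ℕ} {q : ℕ → ℕ} {s : ℕ → ℕ → ℕ}
    (hs : ∀ p < P, Monotone (s p)) (h0 : ∀ p < P, s p 0 = 0)
    (hq : ∀ p < P, s p (q (p + 1)) = q p)
    (hlow : ∀ p < P, ∀ k < q (p + 1), s p k + 3 ≤ s p (k + 1))
    (hup : ∀ p < P, ∀ k < q (p + 1), (s p (k + 1) : ℝ) ≤ s p k + M)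
    {u : ℕ → ℝ} (hu : IsWeight M (q P) u) :
    ∃ w : ℕ → ℕ → ℝ, w P = u ∧ (∀ p ≤ P, IsWeight M (q p) (w p)) ∧
      ∀ p < P, IsWeightRefinement M (q (p + 1)) (s p) (w (p + 1)) (w p) := by
  induction P generalizing u with
  | zero => exact ⟨fun _ => u, rfl, fun p hp => by rwa [Nat.le_zero.1 hp], by simp⟩
  | succ P ih =>
    obtain ⟨u', hu', hr⟩ := hu.exists_refinement (hs P (by omega)) (h0 P (by omega))
      (hq P (by omega)) (hlow P (by omega)) (hup P (by omega)) hM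
    obtain ⟨w, hwP, hw, hwr⟩ := ih (fun p hp => hs p (by omega)) (fun p hp => h0 p (by omega))
      (fun p hp => hq p (by omega)) (fun p hp => hlow p (by omega))
      (fun p hp => hup p (by omega)) hu'
    refine ⟨fun p => if p = P + 1 then u else w p, by simp, fun p hp => ?_, fun p hp => ?_⟩
    · dsimp only
      split_ifs with h1
      · rwa [h1]
      · exact hw p (by omega)
    · dsimp only
      rw [if_neg (by omega : ¬ p = P + 1)]
      split_ifs with h1
      · obtain rfl : p = P := by omega
        rwa [hwP]
      · exact hwr p (by omega)

end Weights

section Gauge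

variable {X : Type*} [MetricSpace X] {A Λ ρ M : ℝ} {P : ℕ} {v : ℕ → X} {q : ℕ → ℕ}
  {s S : ℕ → ℕ → ℕ}

theorem IsHierarchy.monotone (h : IsHierarchy A Λ ρ P v q s S) : ∀ p ≤ P, Monotone (S p) := by
  intro p
  induction p with
  | zero => intro _ i j hij; rwa [h.base, h.base]
  | succ p ih =>
    intro hp i j hij
    rw [h.comp p hp, h.comp p hp]
    exact ih (by omega) (h.mono p hp hij)

theorem IsHierarchy.map_zero (h : IsHierarchy A Λ ρ P v q s S) : ∀ p ≤ P, S p 0 = 0 := by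
  intro p
  induction p with
  | zero => intro _; exact h.base 0
  | succ p ih => intro hp; rw [h.comp p hp, h.zero p hp, ih (by omega)]

theorem IsHierarchy.map_last (h : IsHierarchy A Λ ρ P v q s S) : ∀ p ≤ P, S p (q p) = q 0 := by
  intro p
  induction p with
  | zero => intro _; exact h.base _
  | succ p ih => intro hp; rw [h.comp p hp, h.last p hp, ih (by omega)]

theorem IsHierarchy.le_last (h : IsHierarchy A Λ ρ P v q s S) {p k : ℕ} (hp : p ≤ P)
    (hk : k ≤ q p) : S p k ≤ q 0 := by
  rw [← h.map_last p hp]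
  exact h.monotone p hp hk

theorem IsHierarchy.child_le (h : IsHierarchy A Λ ρ P v q s S) {p k : ℕ} (hp : p < P)
    (hk : k ≤ q (p + 1)) : s p k ≤ q p := by
  rw [← h.last p hp]
  exact h.mono p hp hk

theorem IsHierarchy.three_le (h : IsHierarchy A Λ ρ P v q s S) (hρ : 0 < ρ) (hA : 0 < A)
    (hΛ : 4 * A ^ 2 < Λ) {p k : ℕ} (hp : p < P) (hk : k < q (p + 1)) :
    s p k + 3 ≤ s p (k + 1) := by
  have hΛ0 : 0 < Λ := by nlinarith [sq_nonneg A]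
  have hpos : 0 < Λ ^ p * ρ := by positivity
  have hle : s p k ≤ s p (k + 1) := h.mono p hp (Nat.le_succ k)
  have hq := h.child_le hp (show k + 1 ≤ q (p + 1) from hk)
  have hfar := h.far (p + 1) hp k hk _ _ le_rfl le_rfl (h.le_last hp hk)
  rw [h.comp p hp, h.comp p hp] at hfar
  have hstep : ∀ i < q p, dist (v (S p i)) (v (S p (i + 1))) ≤ A * (Λ ^ p * ρ) := fun i hi =>
    h.near p hp.le i hi _ (h.monotone p hp.le (Nat.le_succ i)) le_rfl
  have hpow : Λ ^ (p + 1) * ρ = Λ * (Λ ^ p * ρ) := by ring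
  rw [hpow] at hfar
  have hbig : 4 * A ^ 2 * (Λ ^ p * ρ) < Λ * (Λ ^ p * ρ) := mul_lt_mul_of_pos_right hΛ hpos
  by_contra hlt
  have hsmall : dist (v (S p (s p k))) (v (S p (s p (k + 1)))) ≤ 2 * (A * (Λ ^ p * ρ)) := by
    have hAr : 0 < A * (Λ ^ p * ρ) := by positivity
    obtain hc | hc | hc : s p (k + 1) = s p k ∨ s p (k + 1) = s p k + 1 ∨
        s p (k + 1) = s p k + 2 := by omega
    · rw [hc, dist_self]; positivity
    · rw [hc]; linarith [hstep (s p k) (by omega)]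
    · rw [hc]
      linarith [hstep (s p k) (by omega), hstep (s p k + 1) (by omega),
        dist_triangle (v (S p (s p k))) (v (S p (s p k + 1))) (v (S p (s p k + 2)))]
  have := mul_le_mul_of_nonneg_left hsmall (by positivity : 0 ≤ 2 * A)
  nlinarith

theorem IsHierarchy.child_count_le (h : IsHierarchy A Λ ρ P v q s S) (hρ : 0 < ρ) (hA : 0 < A)
    (hΛ : 0 < Λ) {N : ℕ}
    (hN : ∀ (x : X) (R : ℝ) (u : ℕ → X) (c : ℕ), 0 < R → (∀ i < c, u i ∈ ball x R) →
      (∀ i j, i < j → j < c → 1 / (4 * A ^ 2 * Λ) * R ≤ dist (u i) (u j)) → c ≤ N)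
    {p k : ℕ} (hp : p < P) (hk : k < q (p + 1)) : s p (k + 1) ≤ s p k + N := by
  have hle : s p k ≤ s p (k + 1) := h.mono p hp (Nat.le_succ k)
  have hq := h.child_le hp (show k + 1 ≤ q (p + 1) from hk)
  have hpos : 0 < A * (Λ ^ (p + 1) * ρ) := by positivity
  have hc := hN (v (S (p + 1) k)) (2 * (A * (Λ ^ (p + 1) * ρ))) (fun i => v (S p (s p k + i)))
    (s p (k + 1) - s p k) (by positivity) (fun i hi => ?_) (fun i j hij hj => ?_)
  · omega
  · rw [mem_ball, dist_comm]
    have := h.near (p + 1) hp k hk (S p (s p k + i))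
      (by rw [h.comp p hp]; exact h.monotone p hp.le (by omega))
      (by rw [h.comp p hp]; exact h.monotone p hp.le (by omega))
    linarith
  · have := h.far p hp.le (s p k + i) (by omega) _ _ le_rfl
      (h.monotone p hp.le (show s p k + i + 1 ≤ s p k + j by omega)) (h.le_last hp.le (by omega))
    have he : 1 / (4 * A ^ 2 * Λ) * (2 * (A * (Λ ^ (p + 1) * ρ))) = Λ ^ p * ρ / (2 * A) := by
      field_simp
      ring
    rw [he, div_le_iff₀ (by positivity)]
    linarith

theorem IsHierarchy.weight_eq (h : IsHierarchy A Λ ρ P v q s S) {w : ℕ → ℕ → ℝ}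
    (hr : ∀ p < P, IsWeightRefinement M (q (p + 1)) (s p) (w (p + 1)) (w p)) :
    ∀ p ≤ P, ∀ k ≤ q p, w 0 (S p k) = w p k := by
  intro p
  induction p with
  | zero => intro _ k _; rw [h.base]
  | succ p ih =>
    intro hp k hk
    rw [h.comp p hp, ih (by omega) _ (h.child_le hp hk), (hr p hp).value k hk]

theorem IsWeight.le_of_le {n : ℕ} {w : ℕ → ℝ} (h : IsWeight M n w) {i j : ℕ} (hij : i ≤ j)
    (hj : j ≤ n) : w i ≤ w j := by
  induction j, hij using Nat.le_induction with
  | base => exact le_rfl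
  | succ j _ ih => exact (ih (by omega)).trans (h.pos j (by omega)).le

theorem IsWeight.lt_of_lt {n : ℕ} {w : ℕ → ℝ} (h : IsWeight M n w) {i j : ℕ} (hij : i < j)
    (hj : j ≤ n) : w i < w j :=
  (h.pos i (by omega)).trans_le (h.le_of_le hij hj)

/-- The cells containing a given index, one for each level of the hierarchy. -/
theorem IsHierarchy.exists_labels (h : IsHierarchy A Λ ρ P v q s S) (h0 : 0 < q 0) {j : ℕ}
    (hj : j ≤ q 0) : ∃ l : ℕ → ℕ, (∀ p ≤ P, l p < q p ∧ S p (l p) ≤ j ∧ j ≤ S p (l p + 1)) ∧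
      ∀ p < P, s p (l (p + 1)) ≤ l p ∧ l p < s p (l (p + 1) + 1) := by
  have hex : ∀ p, ∃ k, p ≤ P → k < q p ∧ S p k ≤ min j (q 0 - 1) ∧
      min j (q 0 - 1) < S p (k + 1) := by
    intro p
    by_cases hp : p ≤ P
    · obtain ⟨k, hk⟩ := exists_piece (h.map_zero p hp) (h.map_last p hp)
        (j := min j (q 0 - 1)) (by omega)
      exact ⟨k, fun _ => hk⟩
    · exact ⟨0, fun hp' => absurd hp' hp⟩
  choose l hl using hex
  refine ⟨l, fun p hp => ?_, fun p hp => ?_⟩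
  · obtain ⟨h1, h2, h3⟩ := hl p hp
    exact ⟨h1, by omega, by omega⟩
  · obtain ⟨-, h2, h3⟩ := hl p hp.le
    obtain ⟨-, h5, h6⟩ := hl (p + 1) hp
    rw [h.comp p hp] at h5 h6
    constructor
    · by_contra! hlt
      have := h.monotone p hp.le (show l p + 1 ≤ s p (l (p + 1)) from hlt)
      omega
    · by_contra! hlt
      have := h.monotone p hp.le hlt
      omega

theorem IsHierarchy.dist_le_of_adjacent (h : IsHierarchy A Λ ρ P v q s S) {p l j a : ℕ}
    (hp : p ≤ P) (hl : l < q p) (h1 : S p l ≤ j) (h2 : j ≤ S p (l + 1)) (ha : a ≤ q 0)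
    (ha1 : S p (l - 1) ≤ a) (ha2 : a ≤ S p (l + 2)) :
    dist (v j) (v a) ≤ 3 * A * (Λ ^ p * ρ) := by
  have hstep : ∀ i < q p, dist (v (S p i)) (v (S p (i + 1))) ≤ A * (Λ ^ p * ρ) := fun i hi =>
    h.near p hp i hi _ (h.monotone p hp (Nat.le_succ i)) le_rfl
  have hj := h.near p hp l hl j h1 h2
  have hc := dist_comm (v (S p l)) (v j)
  have hn : 0 ≤ A * (Λ ^ p * ρ) := dist_nonneg.trans hj
  rcases lt_or_ge a (S p l) with h3 | h3
  · have hl0 : l ≠ 0 := by rintro rfl; rw [h.map_zero p hp] at h3; omega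
    have h4 := hstep (l - 1) (by omega)
    have h5 := h.near p hp (l - 1) (by omega) a ha1 (by
      rw [Nat.sub_add_cancel (by omega)]; exact h3.le)
    rw [Nat.sub_add_cancel (by omega)] at h4
    have h6 := dist_triangle4 (v j) (v (S p l)) (v (S p (l - 1))) (v a)
    rw [dist_comm (v (S p l)) (v (S p (l - 1)))] at h6
    linarith
  · rcases le_or_gt a (S p (l + 1)) with h4 | h4
    · have h5 := h.near p hp l hl a h3 h4
      linarith [dist_triangle (v j) (v (S p l)) (v a)]
    · have h5 : l + 1 < q p := by
        by_contra h6
        rw [show l + 1 = q p by omega, h.map_last p hp] at h4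
        omega
      have h6 := hstep l hl
      have h7 := h.near p hp (l + 1) h5 a h4.le ha2
      linarith [dist_triangle4 (v j) (v (S p l)) (v (S p (l + 1))) (v a)]

theorem IsHierarchy.weight_le_of_adjacent (h : IsHierarchy A Λ ρ P v q s S) (hM : 0 ≤ M)
    {w : ℕ → ℕ → ℝ} (hw : ∀ p ≤ P, IsWeight M (q p) (w p))
    (hr : ∀ p < P, IsWeightRefinement M (q (p + 1)) (s p) (w (p + 1)) (w p)) {p l j a : ℕ}
    (hp : p ≤ P) (hl : l < q p) (h1 : S p l ≤ j) (h2 : j ≤ S p (l + 1)) (ha : a ≤ q 0)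
    (ha1 : S p (l - 1) ≤ a) (ha2 : a ≤ S p (l + 2)) :
    |w 0 j - w 0 a| ≤ (1 + M) * (w p (l + 1) - w p l) := by
  have hU : ∀ i j, i ≤ j → j ≤ q 0 → w 0 i ≤ w 0 j := fun i j hij hj =>
    (hw 0 (by omega)).le_of_le hij hj
  have hlast : ∀ k ≤ q p, S p k ≤ q 0 := fun k hk => h.le_last hp hk
  have hval := h.weight_eq hr p hp
  have hj1 := hU _ _ h1 (h2.trans (hlast _ hl))
  have hj2 := hU _ _ h2 (hlast _ hl)
  rw [hval _ hl.le] at hj1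
  rw [hval _ hl] at hj2
  have hpos := (hw p hp).pos l hl
  have hMn : 0 ≤ M * (w p (l + 1) - w p l) := mul_nonneg hM (by linarith)
  rw [abs_le]
  rcases lt_or_ge a (S p l) with h3 | h3
  · have hl0 : l ≠ 0 := by rintro rfl; rw [h.map_zero p hp] at h3; omega
    have h4 := hU _ _ ha1 ha
    have h5 := hU _ _ h3.le (hlast _ hl.le)
    rw [hval _ (by omega)] at h4
    rw [hval _ hl.le] at h5
    have h6 := (hw p hp).left (l - 1) (by omega)
    rw [Nat.sub_add_cancel (by omega), show l - 1 + 2 = l + 1 by omega] at h6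
    constructor <;> linarith
  · have h5 := hU _ _ h3 ha
    rw [hval _ hl.le] at h5
    rcases le_or_gt a (S p (l + 1)) with h4 | h4
    · have h6 := hU _ _ h4 (hlast _ hl)
      rw [hval _ hl] at h6
      constructor <;> linarith
    · have h7 : l + 1 < q p := by
        by_contra h6
        rw [show l + 1 = q p by omega, h.map_last p hp] at h4
        omega
      have h6 := hU _ _ ha2 (hlast _ h7)
      rw [hval _ h7] at h6
      have h8 := (hw p hp).right l h7
      constructor <;> linarith

theorem IsHierarchy.le_of_not_adjacent (h : IsHierarchy A Λ ρ P v q s S) (hM : 0 ≤ M)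
    {w : ℕ → ℕ → ℝ} (hw : ∀ p ≤ P, IsWeight M (q p) (w p))
    (hr : ∀ p < P, IsWeightRefinement M (q (p + 1)) (s p) (w (p + 1)) (w p)) {p l j a : ℕ}
    (hp : p ≤ P) (hl : l < q p) (h1 : S p l ≤ j) (h2 : j ≤ S p (l + 1)) (ha : a ≤ q 0)
    (hna : ¬ (S p (l - 1) ≤ a ∧ a ≤ S p (l + 2))) :
    Λ ^ p * ρ ≤ 2 * A * dist (v j) (v a) ∧ w p (l + 1) - w p l ≤ M * |w 0 j - w 0 a| := by
  have hU : ∀ i j, i ≤ j → j ≤ q 0 → w 0 i ≤ w 0 j := fun i j hij hj =>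
    (hw 0 (by omega)).le_of_le hij hj
  have hlast : ∀ k ≤ q p, S p k ≤ q 0 := fun k hk => h.le_last hp hk
  have hval := h.weight_eq hr p hp
  have hj := h2.trans (hlast _ hl)
  rw [not_and_or, not_le, not_le] at hna
  rcases hna with h3 | h3
  · have hl0 : l - 1 ≠ 0 := by intro h4; rw [h4, h.map_zero p hp] at h3; omega
    have h4 := h.far p hp (l - 1) (by omega) a j h3.le
      (by rw [Nat.sub_add_cancel (by omega)]; exact h1) hj
    rw [dist_comm] at h4
    refine ⟨h4, ?_⟩
    have h5 := hU _ _ h3.le (hlast _ (by omega))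
    have h6 := hU _ _ h1 hj
    rw [hval _ (by omega)] at h5 h6
    have h7 := (hw p hp).right (l - 1) (by omega)
    rw [Nat.sub_add_cancel (by omega), show l - 1 + 2 = l + 1 by omega] at h7
    refine h7.trans (mul_le_mul_of_nonneg_left ?_ hM)
    exact le_trans (by linarith) (le_abs_self _)
  · have h7 : l + 1 < q p := by
      by_contra h6
      have := h.monotone p hp (show q p ≤ l + 2 by omega)
      rw [h.map_last p hp] at this
      omega
    have h4 := h.far p hp (l + 1) h7 j a h2 h3.le ha
    refine ⟨h4, ?_⟩
    have h5 := hU _ _ h3.le ha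
    have h6 := hU _ _ h2 (hlast _ hl)
    rw [hval _ (by omega)] at h5 h6
    refine ((hw p hp).left l h7).trans (mul_le_mul_of_nonneg_left ?_ hM)
    rw [abs_sub_comm]
    exact le_trans (by linarith) (le_abs_self _)

theorem IsHierarchy.le_of_ne (h : IsHierarchy A Λ ρ P v q s S) (hM : 1 ≤ M)
    {w : ℕ → ℝ} (hw : IsWeight M (q 0) w) {l j a : ℕ}
    (hl : l < q 0) (h1 : l ≤ j) (h2 : j ≤ l + 1) (ha : a ≤ q 0) (hne : a ≠ j) :
    ρ ≤ 2 * A * dist (v j) (v a) ∧ w (l + 1) - w l ≤ M * |w j - w a| := by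
  have hfar : ∀ i j, i < j → j ≤ q 0 → ρ ≤ 2 * A * dist (v i) (v j) := by
    intro i j hij hj
    have := h.far 0 (by omega) i (by omega) i j (h.base i).ge (by rw [h.base]; exact hij) hj
    simpa using this
  have hpos := hw.pos l hl
  have hab := le_abs_self (w j - w a)
  have hab' := neg_le_abs (w j - w a)
  have hMx : |w j - w a| ≤ M * |w j - w a| := le_mul_of_one_le_left (abs_nonneg _) hM
  rcases lt_or_gt_of_ne hne with h3 | h3
  · refine ⟨by rw [dist_comm]; exact hfar a j h3 (by omega), ?_⟩
    obtain rfl | rfl : j = l + 1 ∨ j = l := by omega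
    · have := hw.le_of_le (show a ≤ l by omega) hl.le
      linarith
    · have h4 := hw.le_of_le (show a ≤ j - 1 by omega) (by omega)
      have h5 := hw.right (j - 1) (by omega)
      rw [Nat.sub_add_cancel (by omega), show j - 1 + 2 = j + 1 by omega] at h5
      exact h5.trans (mul_le_mul_of_nonneg_left (by linarith) (by linarith))
  · refine ⟨hfar j a h3 ha, ?_⟩
    obtain rfl | rfl : j = l + 1 ∨ j = l := by omega
    · have h4 := hw.le_of_le (show l + 2 ≤ a by omega) ha
      have h5 := hw.left l (by omega)
      exact h5.trans (mul_le_mul_of_nonneg_left (by linarith) (by linarith))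
    · have := hw.le_of_le (show j + 1 ≤ a by omega) ha
      linarith

/-- Around each point, distances and weights are both governed by one decreasing sequence of
scales. -/
theorem IsHierarchy.exists_gauge (h : IsHierarchy A Λ ρ P v q s S) (hρ : 0 < ρ) (hA : 0 < A)
    (hΛ : 1 ≤ Λ) (hM : 1 ≤ M) {w : ℕ → ℕ → ℝ} (hw : ∀ p ≤ P, IsWeight M (q p) (w p))
    (hr : ∀ p < P, IsWeightRefinement M (q (p + 1)) (s p) (w (p + 1)) (w p)) (h0 : 0 < q 0)
    {j : ℕ} (hj : j ≤ q 0) :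
    ∃ μ : ℕ → ℝ, (∀ p ≤ P, 0 < μ p) ∧
      (∀ p < P, μ (p + 1) ≤ M * μ p ∧ μ p ≤ (1 - 2 / M) * μ (p + 1)) ∧
      ∀ a ≤ q 0, a ≠ j → ∃ p ≤ P, dist (v j) (v a) ≤ 3 * A * (Λ ^ p * ρ) ∧
        Λ ^ p * ρ ≤ 2 * A * Λ * dist (v j) (v a) ∧ |w 0 j - w 0 a| ≤ (1 + M) * μ p ∧
        μ p ≤ M ^ 2 * |w 0 j - w 0 a| := by
  obtain ⟨l, hl, hnest⟩ := h.exists_labels h0 hj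
  refine ⟨fun p => w p (l p + 1) - w p (l p), fun p hp => sub_pos.2 ((hw p hp).pos _ (hl p hp).1),
    fun p hp => ⟨(hr p hp).lower _ (hl (p + 1) hp).1 _ (hnest p hp).1 (hnest p hp).2,
      (hr p hp).upper _ (hl (p + 1) hp).1 _ (hnest p hp).1 (hnest p hp).2⟩, fun a ha hne => ?_⟩
  classical
  have hex : ∃ p, p ≤ P ∧ S p (l p - 1) ≤ a ∧ a ≤ S p (l p + 2) := by
    refine ⟨P, le_rfl, ?_, ?_⟩
    · have := (hl P le_rfl).1
      rw [h.top] at this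
      rw [show l P - 1 = 0 by omega, h.map_zero P le_rfl]
      exact Nat.zero_le a
    · rw [← h.map_last P le_rfl, h.top] at ha
      exact ha.trans (h.monotone P le_rfl (by omega))
  obtain ⟨hp, ha1, ha2⟩ := Nat.find_spec hex
  have hmin := fun {m} => Nat.find_min hex (m := m)
  generalize Nat.find hex = p at hp ha1 ha2 hmin
  obtain ⟨hlp, hj1, hj2⟩ := hl p hp
  refine ⟨p, hp, h.dist_le_of_adjacent hp hlp hj1 hj2 ha ha1 ha2, ?_⟩
  suffices hlow : Λ ^ p * ρ ≤ 2 * A * Λ * dist (v j) (v a) ∧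
      w p (l p + 1) - w p (l p) ≤ M ^ 2 * |w 0 j - w 0 a| from
    ⟨hlow.1, h.weight_le_of_adjacent (by linarith) hw hr hp hlp hj1 hj2 ha ha1 ha2, hlow.2⟩
  rcases p with _ | p
  · rw [h.base] at hj1 hj2
    obtain ⟨h3, h4⟩ := h.le_of_ne hM (hw 0 hp) hlp hj1 hj2 ha hne
    have hAd : 0 ≤ 2 * A * dist (v j) (v a) := by positivity
    have hMd : 0 ≤ M * |w 0 j - w 0 a| := by positivity
    constructor
    · simp only [pow_zero, one_mul]
      nlinarith
    · nlinarith
  · obtain ⟨hlp', hj1', hj2'⟩ := hl p (by omega)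
    obtain ⟨h3, h4⟩ := h.le_of_not_adjacent (by linarith) hw hr (by omega : p ≤ P) hlp' hj1' hj2' ha
      fun h5 => hmin (Nat.lt_succ_self p) ⟨by omega, h5⟩
    have h5 := (hr p hp).lower _ hlp _ (hnest p hp).1 (hnest p hp).2
    constructor
    · rw [pow_succ]
      nlinarith
    · nlinarith

theorem IsHierarchy.gap_le (h : IsHierarchy A Λ ρ P v q s S) (hM : 3 ≤ M) {w : ℕ → ℕ → ℝ}
    (hr : ∀ p < P, IsWeightRefinement M (q (p + 1)) (s p) (w (p + 1)) (w p))
    (hP : w P 1 - w P 0 = 1) (n : ℕ) : ∀ p, p + n = P → ∀ k < q p,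
      w p (k + 1) - w p k ≤ (1 - 2 / M) ^ n := by
  have hg : 0 ≤ 1 - 2 / M := by
    rw [sub_nonneg, div_le_one (by linarith)]; linarith
  induction n with
  | zero =>
    rintro p rfl k hk
    rw [add_zero, h.top] at *
    obtain rfl : k = 0 := by omega
    simpa using hP.le
  | succ n ih =>
    rintro p rfl j hj
    have hp : p < p + (n + 1) := by omega
    obtain ⟨k, hk, h1, h2⟩ := exists_piece (h.zero p hp) (h.last p hp) hj
    have h3 := (hr p hp).upper k hk j h1 h2
    rw [pow_succ']
    exact h3.trans (mul_le_mul_of_nonneg_left (ih (p + 1) (by omega) k hk) hg)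

end Gauge

section Distortion

theorem isDistortion_rpow_add_rpow {D c α β : ℝ} (hD : 0 < D) (hc : 0 < c) (hα : 0 < α)
    (hβ : 0 < β) : IsDistortion fun t => D * ((c * t) ^ α + (c * t) ^ β) := by
  have hcont : Continuous fun t : ℝ => D * ((c * t) ^ α + (c * t) ^ β) :=
    continuous_const.mul ((((continuous_const.mul continuous_id).rpow_const
      fun _ => Or.inr hα.le)).add ((continuous_const.mul continuous_id).rpow_const
      fun _ => Or.inr hβ.le))
  have h0 : D * ((c * (0 : ℝ)) ^ α + (c * 0) ^ β) = 0 := by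
    rw [mul_zero, Real.zero_rpow hα.ne', Real.zero_rpow hβ.ne']; simp
  refine ⟨fun a ha b _ hab => ?_, hcont.continuousOn, h0, fun y hy => ?_⟩
  · have ha : 0 ≤ c * a := mul_nonneg hc.le ha
    have hab : c * a < c * b := mul_lt_mul_of_pos_left hab hc
    exact mul_lt_mul_of_pos_left
      (add_lt_add (Real.rpow_lt_rpow ha hab hα) (Real.rpow_lt_rpow ha hab hβ)) hD
  · have hy : 0 ≤ y := hy
    have hb : 0 ≤ y / D := by positivity
    obtain ⟨T, hT⟩ : ∃ T, T = (y / D) ^ (1 / α) / c := ⟨_, rfl⟩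
    have hT0 : 0 ≤ T := by rw [hT]; positivity
    have h1 : (c * T) ^ α = y / D := by
      rw [hT, mul_div_cancel₀ _ hc.ne', ← Real.rpow_mul hb, one_div_mul_cancel hα.ne',
        Real.rpow_one]
    have h2 : y ≤ D * ((c * T) ^ α + (c * T) ^ β) := by
      rw [h1, mul_add, mul_div_cancel₀ _ hD.ne']
      have : 0 ≤ D * (c * T) ^ β := by positivity
      linarith
    obtain ⟨t, ht, rfl⟩ := intermediate_value_Icc hT0 hcont.continuousOn
      (show y ∈ Set.Icc _ _ from ⟨h0.trans_le hy, h2⟩)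
    exact ⟨t, ht.1, rfl⟩

theorem le_pow_mul_of_le_mul {μ : ℕ → ℝ} {g : ℝ} (hg : 0 ≤ g) {P : ℕ}
    (h : ∀ p < P, μ p ≤ g * μ (p + 1)) (p n : ℕ) (hp : p + n ≤ P) : μ p ≤ g ^ n * μ (p + n) := by
  induction n with
  | zero => simp
  | succ n ih =>
    rw [pow_succ, mul_assoc]
    exact (ih (by omega)).trans (mul_le_mul_of_nonneg_left (h (p + n) (by omega)) (by positivity))

theorem le_pow_mul_of_succ_le_mul {μ : ℕ → ℝ} {M : ℝ} (hM : 0 ≤ M) {P : ℕ}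
    (h : ∀ p < P, μ (p + 1) ≤ M * μ p) (p n : ℕ) (hp : p + n ≤ P) : μ (p + n) ≤ M ^ n * μ p := by
  induction n with
  | zero => simp
  | succ n ih =>
    rw [pow_succ', mul_assoc]
    exact (h (p + n) (by omega)).trans (mul_le_mul_of_nonneg_left (ih (by omega)) hM)

/-- Scales whose ratios are controlled by those of the weights, up to powers. -/
theorem pow_ratio_le {Λ M g : ℝ} (hΛ : 1 < Λ) (hM : 1 < M) (hg : 0 < g) (hg1 : g < 1)
    {P : ℕ} {μ : ℕ → ℝ} (hpos : ∀ p ≤ P, 0 < μ p) (hup : ∀ p < P, μ (p + 1) ≤ M * μ p)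
    (hlo : ∀ p < P, μ p ≤ g * μ (p + 1)) {p p' : ℕ} (hp : p ≤ P) (hp' : p' ≤ P) {τ : ℝ}
    (hτ : μ p ≤ τ * μ p') :
    Λ ^ p ≤ (τ ^ (Real.log Λ / Real.log M) + τ ^ (Real.log Λ / Real.log g⁻¹)) * Λ ^ p' := by
  have hΛ0 : 0 < Λ := by linarith
  have hτ0 : 0 < τ := by
    have := (hpos p hp).trans_le hτ
    exact (mul_pos_iff_of_pos_right (hpos p' hp')).1 this
  have hkey : ∀ b : ℝ, 1 < b → b ^ (Real.log Λ / Real.log b) = Λ := by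
    intro b hb
    rw [Real.rpow_def_of_pos (by linarith), mul_div_cancel₀ _ (Real.log_pos hb).ne',
      Real.exp_log hΛ0]
  have hgi : 1 < g⁻¹ := (one_lt_inv₀ hg).2 hg1
  have hα : 0 < Real.log Λ / Real.log M := div_pos (Real.log_pos hΛ) (Real.log_pos hM)
  have hβ : 0 < Real.log Λ / Real.log g⁻¹ := div_pos (Real.log_pos hΛ) (Real.log_pos hgi)
  have h1 : 0 ≤ τ ^ (Real.log Λ / Real.log M) := by positivity
  have h2 : 0 ≤ τ ^ (Real.log Λ / Real.log g⁻¹) := by positivity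
  rcases le_total p' p with hle | hle
  · obtain ⟨n, rfl⟩ := Nat.exists_eq_add_of_le hle
    have h3 := le_pow_mul_of_le_mul hg.le hlo p' n hp
    have h4 : g⁻¹ ^ n ≤ τ := by
      have h5 : 1 * μ p' ≤ (g ^ n * τ) * μ p' := by
        calc 1 * μ p' ≤ g ^ n * μ (p' + n) := by rwa [one_mul]
          _ ≤ g ^ n * (τ * μ p') := mul_le_mul_of_nonneg_left hτ (by positivity)
          _ = _ := by ring
      have h6 := le_of_mul_le_mul_right h5 (hpos p' hp')
      rw [inv_pow, inv_le_iff_one_le_mul₀' (by positivity)]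
      exact h6
    have h5 : Λ ^ n ≤ τ ^ (Real.log Λ / Real.log g⁻¹) := by
      calc Λ ^ n = (g⁻¹ ^ n) ^ (Real.log Λ / Real.log g⁻¹) := by
            rw [← Real.rpow_natCast g⁻¹, ← Real.rpow_mul (by positivity), mul_comm (n : ℝ),
              Real.rpow_mul (by positivity), hkey _ hgi, Real.rpow_natCast]
        _ ≤ _ := Real.rpow_le_rpow (by positivity) h4 hβ.le
    rw [pow_add, mul_comm]
    exact mul_le_mul_of_nonneg_right (by linarith) (by positivity)
  · obtain ⟨n, rfl⟩ := Nat.exists_eq_add_of_le hle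
    have h3 := le_pow_mul_of_succ_le_mul (by linarith) hup p n hp'
    have h4 : 1 ≤ M ^ n * τ := by
      have h5 : 1 * μ p ≤ (M ^ n * τ) * μ p := by
        calc 1 * μ p ≤ τ * μ (p + n) := by rwa [one_mul]
          _ ≤ τ * (M ^ n * μ p) := mul_le_mul_of_nonneg_left h3 hτ0.le
          _ = _ := by ring
      exact le_of_mul_le_mul_right h5 (hpos p hp)
    have h5 : 1 ≤ Λ ^ n * τ ^ (Real.log Λ / Real.log M) := by
      calc (1 : ℝ) ≤ (M ^ n * τ) ^ (Real.log Λ / Real.log M) := Real.one_le_rpow h4 hα.le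
        _ = _ := by
          rw [Real.mul_rpow (by positivity) hτ0.le, ← Real.rpow_natCast M,
            ← Real.rpow_mul (by positivity), mul_comm (n : ℝ), Real.rpow_mul (by positivity),
            hkey _ hM, Real.rpow_natCast]
    rw [pow_add]
    calc Λ ^ p = 1 * Λ ^ p := (one_mul _).symm
      _ ≤ (Λ ^ n * τ ^ (Real.log Λ / Real.log M)) * Λ ^ p :=
          mul_le_mul_of_nonneg_right h5 (by positivity)
      _ = τ ^ (Real.log Λ / Real.log M) * (Λ ^ p * Λ ^ n) := by ring
      _ ≤ _ := mul_le_mul_of_nonneg_right (by linarith) (by positivity)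

end Distortion

section DiscreteArc

variable {X : Type*} [MetricSpace X]

/-- `v 0, …, v n`, parametrized by `U 0, …, U n` in `[0,1]`, is an `η`-quasisymmetric chain
with parameter gaps at most `g`. -/
structure IsDiscreteArc (η : ℝ → ℝ) (g : ℝ) (n : ℕ) (U : ℕ → ℝ) (v : ℕ → X) : Prop where
  zero : U 0 = 0
  one : U n = 1
  gap : ∀ j < n, U (j + 1) ≤ U j + g
  dist_le : ∀ i ≤ n, ∀ a ≤ n, ∀ b ≤ n, i ≠ b →
    U i ≠ U b ∧ dist (v i) (v a) ≤ η (|U i - U a| / |U i - U b|) * dist (v i) (v b)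

theorem BoundedTurning.exists_isDiscreteArc {A : ℝ} (h : BoundedTurning X A) (hA : 3 ≤ A)
    (hX : MetricDoubling X) : ∃ (η : ℝ → ℝ) (g : ℝ), IsDistortion η ∧ 0 ≤ g ∧ g < 1 ∧
      ∀ x y : X, x ≠ y → ∀ P : ℕ, ∃ (n : ℕ) (U : ℕ → ℝ) (v : ℕ → X), v 0 = x ∧ v n = y ∧
        IsDiscreteArc η (g ^ P) n U v ∧ ∀ j ≤ n, v j ∈ closedBall x (A * dist x y) := by
  have hA0 : 0 < A := by linarith
  obtain ⟨Λ, hΛ⟩ : ∃ Λ, Λ = 5 * A ^ 2 := ⟨_, rfl⟩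
  have hΛ4 : 4 * A ^ 2 < Λ := by rw [hΛ]; nlinarith
  have hAΛ : A ≤ Λ := by nlinarith
  have hΛ1 : 1 < Λ := by linarith
  have hΛ0 : 0 < Λ := by linarith
  obtain ⟨N, hN⟩ := hX.exists_card_bound (ε := 1 / (4 * A ^ 2 * Λ)) (by positivity)
  obtain ⟨M, hM⟩ : ∃ M : ℝ, M = max 3 (N : ℝ) := ⟨_, rfl⟩
  have hM3 : 3 ≤ M := by rw [hM]; exact le_max_left _ _
  have hNM : N ≤ M := by rw [hM]; exact le_max_right _ _
  have hM0 : 0 < M := by linarith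
  obtain ⟨g, hg⟩ : ∃ g, g = 1 - 2 / M := ⟨_, rfl⟩
  have hg0 : 0 < g := by
    rw [hg, sub_pos, div_lt_one hM0]; linarith
  have hg1 : g < 1 := by
    have : 0 < 2 / M := by positivity
    linarith
  have hgi : 1 < g⁻¹ := (one_lt_inv₀ hg0).2 hg1
  refine ⟨fun t => 6 * A ^ 2 * Λ * ((M ^ 2 * (1 + M) * t) ^ (Real.log Λ / Real.log M) +
    (M ^ 2 * (1 + M) * t) ^ (Real.log Λ / Real.log g⁻¹)), g,
    isDistortion_rpow_add_rpow (by positivity) (by positivity)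
      (div_pos (Real.log_pos hΛ1) (Real.log_pos (by linarith)))
      (div_pos (Real.log_pos hΛ1) (Real.log_pos hgi)), hg0.le, hg1, fun x y hxy P => ?_⟩
  obtain ⟨ρ, v, q, s, S, hρ, hρR, hh, hvx, hvy⟩ := h.exists_hierarchy hA hAΛ hxy P
  obtain ⟨w, hwP, hw, hr⟩ := exists_weights hM3 hh.mono hh.zero hh.last
    (fun p hp k hk => hh.three_le hρ hA0 hΛ4 hp hk)
    (fun p hp k hk => by
      have := hh.child_count_le hρ hA0 hΛ0 hN hp hk
      have : (s p (k + 1) : ℝ) ≤ s p k + N := by exact_mod_cast this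
      linarith) (u := fun k => (k : ℝ))
    ⟨fun k _ => by push_cast; linarith, fun k hk => by rw [hh.top] at hk; omega,
      fun k hk => by rw [hh.top] at hk; omega⟩
  have hval := hh.weight_eq hr (P + 1) le_rfl
  have hU0 : w 0 0 = 0 := by
    have := hval 0 (Nat.zero_le _)
    rw [hh.map_zero _ le_rfl, hwP] at this
    simpa using this
  have hU1 : w 0 (q 0) = 1 := by
    have := hval (q (P + 1)) le_rfl
    rw [hh.map_last _ le_rfl, hwP, hh.top] at this
    simpa using this
  have hq0 : 0 < q 0 := by
    rw [Nat.pos_iff_ne_zero]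
    intro h0
    rw [h0, hU0] at hU1
    norm_num at hU1
  have hgn : g ^ (P + 1) ≤ g ^ P := pow_le_pow_of_le_one hg0.le hg1.le (Nat.le_succ P)
  refine ⟨q 0, w 0, v, hvx, hvy, ⟨hU0, hU1, fun j hj => ?_, fun i hi a ha b hb hib => ⟨?_, ?_⟩⟩, ?_⟩
  · have := hh.gap_le hM3 hr (by rw [hwP]; simp) (P + 1) 0 (by omega) j hj
    rw [← hg] at this
    linarith
  · rcases lt_or_gt_of_ne hib with h1 | h1
    · exact ((hw 0 (by omega)).lt_of_lt h1 hb).ne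
    · exact ((hw 0 (by omega)).lt_of_lt h1 hi).ne'
  · rcases eq_or_ne a i with rfl | hai
    · rw [dist_self]; positivity
    obtain ⟨μ, hμ, hμr, hex⟩ := hh.exists_gauge hρ hA0 hΛ1.le (by linarith) hw hr hq0 hi
    obtain ⟨p, hp, h1, -, -, h2⟩ := hex a ha hai
    obtain ⟨p', hp', -, h3, h4, -⟩ := hex b hb hib.symm
    have hx' : 0 < |w 0 i - w 0 b| := by
      obtain ⟨r, hr', -, -, -, h5⟩ := hex b hb hib.symm
      exact (mul_pos_iff_of_pos_left (by positivity)).1 ((hμ r hr').trans_le h5)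
    have hτ : μ p ≤ (M ^ 2 * (1 + M) * (|w 0 i - w 0 a| / |w 0 i - w 0 b|)) * μ p' := by
      calc μ p ≤ M ^ 2 * |w 0 i - w 0 a| := h2
        _ = M ^ 2 * (|w 0 i - w 0 a| / |w 0 i - w 0 b|) * |w 0 i - w 0 b| := by field_simp
        _ ≤ M ^ 2 * (|w 0 i - w 0 a| / |w 0 i - w 0 b|) * ((1 + M) * μ p') :=
            mul_le_mul_of_nonneg_left h4 (by positivity)
        _ = _ := by ring
    have h5 := pow_ratio_le hΛ1 (by linarith : 1 < M) hg0 hg1 hμ (fun p hp => (hμr p hp).1)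
      (fun p hp => by rw [hg]; exact (hμr p hp).2) hp hp' hτ
    generalize (M ^ 2 * (1 + M) * (|w 0 i - w 0 a| / |w 0 i - w 0 b|)) ^
      (Real.log Λ / Real.log M) + (M ^ 2 * (1 + M) * (|w 0 i - w 0 a| / |w 0 i - w 0 b|)) ^
      (Real.log Λ / Real.log g⁻¹) = E at h5
    have hE : 0 ≤ E := by
      by_contra! hE
      have h6 : 0 < Λ ^ p := by positivity
      have h7 : 0 < Λ ^ p' := by positivity
      nlinarith
    calc dist (v i) (v a) ≤ 3 * A * (Λ ^ p * ρ) := h1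
      _ ≤ 3 * A * (E * Λ ^ p' * ρ) := by gcongr
      _ = 3 * A * E * (Λ ^ p' * ρ) := by ring
      _ ≤ 3 * A * E * (2 * A * Λ * dist (v i) (v b)) := by gcongr
      _ = _ := by ring
  · intro j hj
    have := hh.near (P + 1) le_rfl 0 (by rw [hh.top]; omega) j
      (by rw [hh.map_zero _ le_rfl]; omega)
      (by have := hh.map_last _ le_rfl; rw [hh.top] at this; rwa [Nat.zero_add, this])
    rw [hh.map_zero _ le_rfl, hvx, hρR] at this
    rw [mem_closedBall, dist_comm]
    exact this

end DiscreteArc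

section Limit

variable {X : Type*} [MetricSpace X]

theorem IsDiscreteArc.exists_index {η : ℝ → ℝ} {g : ℝ} {n : ℕ} {U : ℕ → ℝ} {v : ℕ → X}
    (h : IsDiscreteArc η g n U v) (hg : 0 ≤ g) (t : ℝ) : ∃ j ≤ n, (t = 0 → j = 0) ∧
      (t = 1 → j = n) ∧ (t ∈ Set.Icc (0 : ℝ) 1 → |U j - t| ≤ g) := by
  classical
  by_cases ht : t ∈ Set.Ioo (0 : ℝ) 1
  · have hex : ∃ k, t < U k := ⟨n, by rw [h.one]; exact ht.2⟩
    have h1 := Nat.find_spec hex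
    have h2 : Nat.find hex ≠ 0 := fun h0 => by
      rw [h0, h.zero] at h1
      exact lt_asymm h1 ht.1
    have h3 : Nat.find hex ≤ n := Nat.find_min' hex (by rw [h.one]; exact ht.2)
    have h4 := not_lt.1 (Nat.find_min hex (show Nat.find hex - 1 < Nat.find hex by omega))
    have h5 := h.gap (Nat.find hex - 1) (by omega)
    rw [Nat.sub_add_cancel (by omega)] at h5
    refine ⟨Nat.find hex - 1, by omega, fun h0 => absurd h0 ht.1.ne', fun h0 => absurd h0 ht.2.ne,
      fun _ => ?_⟩
    rw [abs_le]
    constructor <;> linarith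
  · rcases eq_or_ne t 0 with rfl | h0
    · exact ⟨0, Nat.zero_le n, fun _ => rfl, fun h0 => by norm_num at h0, fun _ => by
        rw [h.zero]; simpa using hg⟩
    · refine ⟨n, le_rfl, fun h1 => absurd h1 h0, fun _ => rfl, fun h1 => ?_⟩
      obtain rfl : t = 1 := by
        by_contra h2
        exact ht ⟨lt_of_le_of_ne h1.1 h0.symm, lt_of_le_of_ne h1.2 h2⟩
      rw [h.one]
      simpa using hg

theorem IsDistortion.tendsto {η : ℝ → ℝ} (hη : IsDistortion η) {ι : Type*} {l : Filter ι}
    {f : ι → ℝ} {t : ℝ} (hf : Filter.Tendsto f l (nhds t)) (ht : 0 ≤ t) (h0 : ∀ i, 0 ≤ f i) :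
    Filter.Tendsto (fun i => η (f i)) l (nhds (η t)) :=
  (hη.continuousOn t ht).tendsto.comp
    (tendsto_nhdsWithin_iff.2 ⟨hf, Filter.Eventually.of_forall h0⟩)

theorem IsDistortion.isQuasiArc {η : ℝ → ℝ} (hη : IsDistortion η) {γ : ℝ → X} (h01 : γ 0 ≠ γ 1)
    (h : ∀ s ∈ Set.Icc (0 : ℝ) 1, ∀ a ∈ Set.Icc (0 : ℝ) 1, ∀ b ∈ Set.Icc (0 : ℝ) 1,
      s ≠ b → dist (γ s) (γ a) ≤ η (|s - a| / |s - b|) * dist (γ s) (γ b)) :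
    ContinuousOn γ (Set.Icc 0 1) ∧ Set.InjOn γ (Set.Icc 0 1) := by
  have m0 : (0 : ℝ) ∈ Set.Icc (0 : ℝ) 1 := ⟨le_rfl, zero_le_one⟩
  have m1 : (1 : ℝ) ∈ Set.Icc (0 : ℝ) 1 := ⟨zero_le_one, le_rfl⟩
  constructor
  · intro s hs
    obtain ⟨b, hb, hsb⟩ : ∃ b ∈ Set.Icc (0 : ℝ) 1, s ≠ b := by
      rcases eq_or_ne s 0 with rfl | h0
      · exact ⟨1, m1, zero_ne_one⟩
      · exact ⟨0, m0, h0⟩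
    refine tendsto_iff_dist_tendsto_zero.2 (squeeze_zero'
      (g := fun a => η (|s - a| / |s - b|) * dist (γ s) (γ b))
      (Filter.Eventually.of_forall fun _ => dist_nonneg) ?_ ?_)
    · filter_upwards [self_mem_nhdsWithin] with a ha
      rw [dist_comm]
      exact h s hs a ha b hb hsb
    · have hc : Filter.Tendsto (fun a => |s - a| / |s - b|) (nhdsWithin s (Set.Icc 0 1))
          (nhds 0) := by
        have : Continuous fun a => |s - a| / |s - b| := by fun_prop
        simpa using (this.tendsto s).mono_left nhdsWithin_le_nhds
      simpa [hη.map_zero] using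
        (hη.tendsto hc le_rfl fun a => by positivity).mul_const (dist (γ s) (γ b))
  · intro s hs b hb hsb
    by_contra hne
    have hall : ∀ a ∈ Set.Icc (0 : ℝ) 1, γ s = γ a := fun a ha => by
      have := h s hs a ha b hb hne
      rw [hsb, dist_self, mul_zero, ← hsb] at this
      exact dist_le_zero.1 this
    exact h01 ((hall 0 m0).symm.trans (hall 1 m1))

theorem exists_quasiArc_of_discreteArcs {η : ℝ → ℝ} (hη : IsDistortion η) {g : ℝ} (hg : 0 ≤ g)
    (hg1 : g < 1) {x y : X} (hxy : x ≠ y) {R : ℝ} (hR : IsCompact (closedBall x R))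
    (h : ∀ P : ℕ, ∃ (n : ℕ) (U : ℕ → ℝ) (v : ℕ → X), v 0 = x ∧ v n = y ∧
      IsDiscreteArc η (g ^ P) n U v ∧ ∀ j ≤ n, v j ∈ closedBall x R) :
    ∃ γ : ℝ → X, γ 0 = x ∧ γ 1 = y ∧
      ContinuousOn γ (Set.Icc 0 1) ∧ Set.InjOn γ (Set.Icc 0 1) ∧
      ∀ s ∈ Set.Icc (0 : ℝ) 1, ∀ a ∈ Set.Icc (0 : ℝ) 1, ∀ b ∈ Set.Icc (0 : ℝ) 1,
        s ≠ b → dist (γ s) (γ a) ≤ η (|s - a| / |s - b|) * dist (γ s) (γ b) := by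
  choose n U v hv0 hvn harc hmem using h
  choose J hJn hJ0 hJ1 hJ using fun (P : ℕ) (t : ℝ) =>
    (harc P).exists_index (pow_nonneg hg P) t
  let F : Ultrafilter ℕ := Filter.hyperfilter ℕ
  have hlim : ∀ t, ∃ z, Filter.Tendsto (fun P => v P (J P t)) F (nhds z) := by
    intro t
    obtain ⟨z, -, hz⟩ := hR.ultrafilter_le_nhds (F.map fun P => v P (J P t))
      (Filter.le_principal_iff.2 (Filter.mem_map.2
        (Filter.univ_mem' fun P => hmem P _ (hJn P t))))
    exact ⟨z, hz⟩
  choose γ hγ using hlim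
  have hU : ∀ t ∈ Set.Icc (0 : ℝ) 1, Filter.Tendsto (fun P => U P (J P t)) F (nhds t) := by
    intro t ht
    have h1 : Filter.Tendsto (fun P : ℕ => g ^ P) F (nhds 0) :=
      (tendsto_pow_atTop_nhds_zero_of_lt_one hg hg1).mono_left Nat.hyperfilter_le_atTop
    exact tendsto_iff_dist_tendsto_zero.2
      (squeeze_zero (fun _ => dist_nonneg) (fun P => hJ P t ht) h1)
  have hγ0 : γ 0 = x := by
    refine tendsto_nhds_unique (hγ 0) ?_
    simp only [hJ0 _ 0 rfl, hv0]
    exact tendsto_const_nhds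
  have hγ1 : γ 1 = y := by
    refine tendsto_nhds_unique (hγ 1) ?_
    simp only [hJ1 _ 1 rfl, hvn]
    exact tendsto_const_nhds
  have hqs : ∀ s ∈ Set.Icc (0 : ℝ) 1, ∀ a ∈ Set.Icc (0 : ℝ) 1, ∀ b ∈ Set.Icc (0 : ℝ) 1,
      s ≠ b → dist (γ s) (γ a) ≤ η (|s - a| / |s - b|) * dist (γ s) (γ b) := by
    intro s hs a ha b hb hsb
    have h1 : Filter.Tendsto (fun P => |U P (J P s) - U P (J P a)| / |U P (J P s) - U P (J P b)|) F
        (nhds (|s - a| / |s - b|)) :=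
      ((hU s hs).sub (hU a ha)).abs.div ((hU s hs).sub (hU b hb)).abs
        (abs_ne_zero.2 (sub_ne_zero.2 hsb))
    have h2 := (hη.tendsto h1 (by positivity) fun P => by positivity).mul ((hγ s).dist (hγ b))
    refine le_of_tendsto_of_tendsto ((hγ s).dist (hγ a)) h2 ?_
    filter_upwards [((hU s hs).sub (hU b hb)).eventually_ne (sub_ne_zero.2 hsb)] with P hP
    exact ((harc P).dist_le _ (hJn P s) _ (hJn P a) _ (hJn P b) fun h0 => hP (by rw [h0, sub_self])).2
  have h01 : γ 0 ≠ γ 1 := by rw [hγ0, hγ1]; exact hxy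
  obtain ⟨hc, hi⟩ := hη.isQuasiArc h01 hqs
  exact ⟨γ, hγ0, hγ1, hc, hi, hqs⟩

end Limit

end QuasiArcs

/-- A complete metric space which is relatively ball connected and
metric doubling is quasi-arc connected. -/
theorem rbc_doubling_implies_quasiArcConnected
    {X : Type*} [MetricSpace X] [CompleteSpace X]
    (hRBC : ∃ K : ℝ, 1 < K ∧ IsRBC X K) (hMD : MetricDoubling X) :
    QuasiArcConnected X := by
  obtain ⟨K, hK, h⟩ := hRBC
  obtain ⟨A, hA, hturn⟩ := h.exists_boundedTurning hK
  obtain ⟨η, g, hη, hg, hg1, harc⟩ := hturn.exists_isDiscreteArc hA hMD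
  exact ⟨η, hη, fun x y hxy => exists_quasiArc_of_discreteArcs hη hg hg1 hxy
    (hMD.isCompact_closedBall x (A * dist x y)) (harc x y hxy)⟩
end

section
/- Let (X,d) be a quasi-arc connected metric space with distortion function η. Then (X,d) is relatively K ball connected for a constant K > 1 depending only on η(1) (one may take K = 2 + 2·η(1)); moreover, for each ε ∈ (0,1) the integer N_X(ε) in the chain condition may be taken to be any integer N such that 2·η(2/N)·η(1) < ε. -/
namespace IsDistortion

variable {η : ℝ → ℝ}

theorem mono (hη : IsDistortion η) {s t : ℝ} (hs : 0 ≤ s) (hst : s ≤ t) : η s ≤ η t :=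
  hη.strictMonoOn.monotoneOn hs (hs.trans hst) hst

theorem map_nonneg (hη : IsDistortion η) {t : ℝ} (ht : 0 ≤ t) : 0 ≤ η t :=
  hη.map_zero ▸ hη.mono le_rfl ht

theorem map_one_pos (hη : IsDistortion η) : 0 < η 1 :=
  hη.map_zero ▸ hη.strictMonoOn (Set.mem_Ici.2 le_rfl) (Set.mem_Ici.2 zero_le_one) zero_lt_one

theorem exists_nat_map_two_div_lt (hη : IsDistortion η) {δ : ℝ} (hδ : 0 < δ) :
    ∃ N : ℕ, 0 < N ∧ η (2 / N) < δ := by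
  obtain ⟨t, ht, rfl⟩ := hη.surjOn (Set.mem_Ici.2 hδ.le)
  have ht0 : 0 < t := by
    refine lt_of_le_of_ne ht fun h => ?_
    rw [← h, hη.map_zero] at hδ
    exact hδ.false
  obtain ⟨N, hN⟩ := exists_nat_gt (2 / t)
  have hN0 : (0 : ℝ) < N := (by positivity : 0 < 2 / t).trans hN
  refine ⟨N, by exact_mod_cast hN0, hη.strictMonoOn (Set.mem_Ici.2 (by positivity)) ht ?_⟩
  exact (div_lt_comm₀ ht0 hN0).1 hN

end IsDistortion

section QuasiArc

variable {X : Type*} [MetricSpace X] {η : ℝ → ℝ} {γ : ℝ → X}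

theorem dist_quasiArc_endpoints_le (hη : IsDistortion η)
    (hγ : ∀ s ∈ Set.Icc (0:ℝ) 1, ∀ a ∈ Set.Icc (0:ℝ) 1, ∀ b ∈ Set.Icc (0:ℝ) 1,
      s ≠ b → dist (γ s) (γ a) ≤ η (|s - a| / |s - b|) * dist (γ s) (γ b))
    {s : ℝ} (hs : s ∈ Set.Icc (0:ℝ) 1) :
    dist (γ 0) (γ s) ≤ η 1 * dist (γ 0) (γ 1) ∧ dist (γ 1) (γ s) ≤ η 1 * dist (γ 0) (γ 1) := by
  have h0 : (0:ℝ) ∈ Set.Icc (0:ℝ) 1 := by simp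
  have h1 : (1:ℝ) ∈ Set.Icc (0:ℝ) 1 := by simp
  constructor
  · refine (hγ 0 h0 s hs 1 h1 zero_ne_one).trans ?_
    gcongr
    refine hη.mono (by positivity) ?_
    simpa [abs_of_nonneg hs.1] using hs.2
  · refine (hγ 1 h1 s hs 0 h0 one_ne_zero).trans ?_
    rw [dist_comm (γ 1) (γ 0)]
    gcongr
    refine hη.mono (by positivity) ?_
    simpa [abs_of_nonneg (sub_nonneg.2 hs.2)] using hs.1

theorem dist_quasiArc_le (hη : IsDistortion η)
    (hγ : ∀ s ∈ Set.Icc (0:ℝ) 1, ∀ a ∈ Set.Icc (0:ℝ) 1, ∀ b ∈ Set.Icc (0:ℝ) 1,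
      s ≠ b → dist (γ s) (γ a) ≤ η (|s - a| / |s - b|) * dist (γ s) (γ b))
    {s a : ℝ} (hs : s ∈ Set.Icc (0:ℝ) 1) (ha : a ∈ Set.Icc (0:ℝ) 1) :
    dist (γ s) (γ a) ≤ η (2 * |s - a|) * (η 1 * dist (γ 0) (γ 1)) := by
  obtain ⟨b, hb, hsb, hd⟩ : ∃ b ∈ Set.Icc (0:ℝ) 1, 1 / 2 ≤ |s - b| ∧
      dist (γ s) (γ b) ≤ η 1 * dist (γ 0) (γ 1) := by
    have hends := dist_quasiArc_endpoints_le hη hγ hs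
    rcases le_total (1 / 2) s with h | h
    · exact ⟨0, by simp, by simpa using h.trans (le_abs_self s), dist_comm (γ s) _ ▸ hends.1⟩
    · refine ⟨1, by simp, ?_, dist_comm (γ s) _ ▸ hends.2⟩
      rw [abs_sub_comm]
      exact le_trans (by linarith) (le_abs_self _)
  have hpos : 0 < |s - b| := by linarith
  have hle : |s - a| / |s - b| ≤ 2 * |s - a| := by
    rw [div_le_iff₀ hpos]
    nlinarith [abs_nonneg (s - a)]
  exact (hγ s hs a ha b hb (sub_ne_zero.1 (abs_pos.1 hpos))).trans
    (mul_le_mul (hη.mono (by positivity) hle) hd dist_nonneg (hη.map_nonneg (by positivity)))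

end QuasiArc

theorem chainCond_of_quasiArcs
    {X : Type*} [MetricSpace X] {η : ℝ → ℝ} (hη : IsDistortion η)
    (harc : ∀ x y : X, x ≠ y → ∃ γ : ℝ → X, γ 0 = x ∧ γ 1 = y ∧
      ∀ s ∈ Set.Icc (0:ℝ) 1, ∀ a ∈ Set.Icc (0:ℝ) 1, ∀ b ∈ Set.Icc (0:ℝ) 1,
        s ≠ b → dist (γ s) (γ a) ≤ η (|s - a| / |s - b|) * dist (γ s) (γ b))
    {ε : ℝ} (hε : ε ∈ Set.Ioo (0:ℝ) 1) {N : ℕ} (hN : 0 < N) (hNε : 2 * η (2 / N) * η 1 < ε) :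
    ChainCond X ε (2 + 2 * η 1) N := by
  intro x₀ R hR x hx y hy
  have hη1 := hη.map_one_pos
  replace hx : dist x x₀ ≤ R := Metric.closure_ball_subset_closedBall hx
  replace hy : dist y x₀ ≤ R := Metric.closure_ball_subset_closedBall hy
  have hεR : ε * R ≤ R := mul_le_of_le_one_left hR.le hε.2.le
  have hball : ∀ w : X, dist x w ≤ η 1 * (2 * R) →
      Metric.ball w (ε * R) ⊆ Metric.ball x₀ ((2 + 2 * η 1) * R) := by
    intro w hw
    refine Metric.ball_subset_ball' ?_
    have := dist_triangle_left w x₀ x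
    linarith
  rcases eq_or_ne x y with rfl | hxy
  · refine ⟨fun _ => x, rfl, rfl, fun i _ => hball x ?_, fun i _ _ => ?_⟩
    · rw [dist_self]
      positivity
    · rw [dist_self]
      exact mul_pos hε.1 hR
  obtain ⟨γ, rfl, rfl, hγ⟩ := harc x y hxy
  have hd : dist (γ 0) (γ 1) ≤ 2 * R := by
    have := dist_triangle_right (γ 0) (γ 1) x₀
    linarith
  have hN0 : (0 : ℝ) < N := by exact_mod_cast hN
  have hmem : ∀ i ≤ N, (i / N : ℝ) ∈ Set.Icc (0:ℝ) 1 := fun i hi =>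
    ⟨by positivity, (div_le_one hN0).2 (by exact_mod_cast hi)⟩
  refine ⟨fun i => γ (i / N), by simp, by simp [hN0.ne'], fun i hi => hball _ ?_,
    fun i hi1 hi => ?_⟩
  · exact (dist_quasiArc_endpoints_le hη hγ (hmem i hi)).1.trans (by gcongr)
  · have hstep : 2 * |((i - 1 : ℕ) / N : ℝ) - i / N| = 2 / N := by
      rw [← sub_div, Nat.cast_sub hi1, Nat.cast_one, sub_sub_cancel_left, abs_div, abs_neg,
        abs_one, abs_of_pos hN0, mul_one_div]
    have hη2 : 0 ≤ η (2 / N) := hη.map_nonneg (by positivity)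
    calc dist (γ ((i - 1 : ℕ) / N)) (γ (i / N))
        ≤ η (2 / N) * (η 1 * dist (γ 0) (γ 1)) :=
          hstep ▸ dist_quasiArc_le hη hγ (hmem _ ((Nat.sub_le i 1).trans hi)) (hmem i hi)
      _ ≤ η (2 / N) * (η 1 * (2 * R)) := by gcongr
      _ = 2 * η (2 / N) * η 1 * R := by ring
      _ < ε * R := by gcongr

/-- Let `(X,d)` be quasi-arc connected with distortion function `η`.
Then `(X,d)` is relatively `K` ball connected with `K = 2 + 2·η(1)`; moreover, for each
`ε ∈ (0,1)`, the chain condition at scale `ε` (inside `B(x₀, K R)`) holds with any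
positive integer `N` satisfying `2·η(2/N)·η(1) < ε`. -/
theorem quasiArcConnected_implies_rbc
    {X : Type*} [MetricSpace X] (η : ℝ → ℝ) (hη : IsDistortion η)
    (harc : ∀ x y : X, x ≠ y → ∃ γ : ℝ → X,
      γ 0 = x ∧ γ 1 = y ∧
      ContinuousOn γ (Set.Icc 0 1) ∧ Set.InjOn γ (Set.Icc 0 1) ∧
      ∀ s ∈ Set.Icc (0:ℝ) 1, ∀ a ∈ Set.Icc (0:ℝ) 1, ∀ b ∈ Set.Icc (0:ℝ) 1,
        s ≠ b → dist (γ s) (γ a) ≤ η (|s - a| / |s - b|) * dist (γ s) (γ b)) :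
    IsRBC X (2 + 2 * η 1) ∧
    ∀ ε ∈ Set.Ioo (0:ℝ) 1, ∀ N : ℕ, 0 < N → 2 * η (2 / N) * η 1 < ε →
      ChainCond X ε (2 + 2 * η 1) N := by
  have hchain : ∀ ε ∈ Set.Ioo (0:ℝ) 1, ∀ N : ℕ, 0 < N → 2 * η (2 / N) * η 1 < ε →
      ChainCond X ε (2 + 2 * η 1) N := by
    refine fun ε hε N hN hNε => chainCond_of_quasiArcs hη (fun x y hxy => ?_) hε hN hNε
    obtain ⟨γ, h0, h1, -, -, hγ⟩ := harc x y hxy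
    exact ⟨γ, h0, h1, hγ⟩
  refine ⟨fun ε hε => ?_, hchain⟩
  have hη1 := hη.map_one_pos
  obtain ⟨N, hN, hlt⟩ := hη.exists_nat_map_two_div_lt (div_pos hε.1 (mul_pos two_pos hη1))
  refine ⟨N, hchain ε hε N hN ?_⟩
  rw [lt_div_iff₀ (by positivity)] at hlt
  linarith
end

section
/- Let (X,d) be a metric space, let ε ∈ (0,1) and K > 1, and suppose (X,d) is relatively (ε,K) ball connected, i.e. there exists an integer N such that for all x₀ ∈ X, R > 0 and x, y in the closure of B(x₀,R) there exist points z₀ = x, z₁, …, z_N = y with d(z_{i−1}, z_i) < εR for 1 ≤ i ≤ N and B(z_i, εR) ⊆ B(x₀, KR) for all 0 ≤ i ≤ N. Then (X,d) is relatively K′ ball connected with K′ = 1 + K/(1−ε); that is, for every ε′ ∈ (0,1) there exists an integer N(ε′) so that the analogous chain condition holds at scale ε′ inside B(x₀, K′R). -/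
open Metric

/-- There is a chain of `n` steps of size less than `r` from `x` to `y` whose points lie in `s`. -/
def HasChain {X : Type*} [MetricSpace X] (s : Set X) (r : ℝ) (n : ℕ) (x y : X) : Prop :=
  ∃ z : ℕ → X, z 0 = x ∧ z n = y ∧ (∀ i ≤ n, z i ∈ s) ∧ ∀ i < n, dist (z i) (z (i + 1)) < r

namespace HasChain

variable {X : Type*} [MetricSpace X] {s t : Set X} {r : ℝ} {m n : ℕ} {x y w : X}

theorem mono (h : HasChain s r n x y) (hst : s ⊆ t) : HasChain t r n x y := by
  obtain ⟨z, h0, hn, hs, hd⟩ := h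
  exact ⟨z, h0, hn, fun i hi => hst (hs i hi), hd⟩

theorem trans (h₁ : HasChain s r m x y) (h₂ : HasChain s r n y w) :
    HasChain s r (m + n) x w := by
  obtain ⟨z, rfl, rfl, hs, hd⟩ := h₁
  obtain ⟨z', h0, rfl, hs', hd'⟩ := h₂
  have hge : ∀ j, (if m + j ≤ m then z (m + j) else z' (m + j - m)) = z' j := by
    intro j
    rcases Nat.eq_zero_or_pos j with rfl | hj
    · simp [h0]
    · rw [if_neg (by omega), Nat.add_sub_cancel_left]
  refine ⟨fun k => if k ≤ m then z k else z' (k - m), by simp, hge n, fun i hi => ?_,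
    fun i hi => ?_⟩
  · rcases le_total i m with him | him
    · simpa [him] using hs i him
    · obtain ⟨j, rfl⟩ := Nat.exists_eq_add_of_le him
      simpa only [hge] using hs' j (by omega)
  · rcases lt_or_ge i m with him | him
    · simpa [him.le, Nat.succ_le_of_lt him] using hd i him
    · obtain ⟨j, rfl⟩ := Nat.exists_eq_add_of_le him
      simpa only [add_assoc, hge] using hd' j (by omega)

/-- Replacing every link of a sequence by a chain of `n` steps. -/
theorem concat {z : ℕ → X} (h0 : z 0 ∈ s) :
    (∀ i < m, HasChain s r n (z i) (z (i + 1))) → HasChain s r (m * n) (z 0) (z m) := by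
  induction m with
  | zero => exact fun _ => ⟨fun _ => z 0, rfl, rfl, fun _ _ => h0, by simp⟩
  | succ m ih =>
    intro h
    rw [Nat.succ_mul]
    exact (ih fun i hi => h i (by omega)).trans (h m (by omega))

end HasChain

theorem ChainCond.hasChain {X : Type*} [MetricSpace X] {ε K R : ℝ} {N : ℕ}
    (h : ChainCond X ε K N) (hε : 0 < ε) (hR : 0 < R) {x₀ x y : X}
    (hx : x ∈ closure (ball x₀ R)) (hy : y ∈ closure (ball x₀ R)) :
    HasChain (ball x₀ (K * R)) (ε * R) N x y := by
  obtain ⟨z, h0, hN, hs, hd⟩ := h x₀ R hR x hx y hy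
  exact ⟨z, h0, hN, fun i hi => hs i hi (mem_ball_self (mul_pos hε hR)),
    fun i hi => hd (i + 1) (by omega) hi⟩

theorem ChainCond.exists_hasChain_pow {X : Type*} [MetricSpace X] {ε K : ℝ} {N : ℕ}
    (h : ChainCond X ε K N) (hε : ε ∈ Set.Ioo (0 : ℝ) 1) (hK : 0 ≤ K) (n : ℕ) :
    ∃ M : ℕ, ∀ (x₀ : X) (R : ℝ), 0 < R →
      ∀ x ∈ closure (ball x₀ R), ∀ y ∈ closure (ball x₀ R),
        HasChain (ball x₀ (K / (1 - ε) * R)) (ε ^ (n + 1) * R) M x y := by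
  have hε1 : 0 < 1 - ε := sub_pos.2 hε.2
  have hKle : K ≤ K / (1 - ε) := le_div_self hK hε1 (by linarith [hε.1])
  have hsum : K + K / (1 - ε) * ε = K / (1 - ε) := by field_simp; ring
  induction n with
  | zero =>
    refine ⟨N, fun x₀ R hR x hx y hy => ?_⟩
    simpa using (h.hasChain hε.1 hR hx hy).mono (ball_subset_ball (by gcongr))
  | succ n ih =>
    obtain ⟨M, hM⟩ := ih
    refine ⟨N * M, fun x₀ R hR x hx y hy => ?_⟩
    obtain ⟨z, rfl, rfl, hs, hd⟩ := h.hasChain hε.1 hR hx hy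
    have hεR : 0 < ε * R := mul_pos hε.1 hR
    refine HasChain.concat (ball_subset_ball (by gcongr) (hs 0 (Nat.zero_le _))) fun i hi => ?_
    have hlink := hM (z i) (ε * R) hεR (z i) (subset_closure (mem_ball_self hεR)) (z (i + 1))
      (subset_closure (mem_ball'.2 (hd i hi)))
    rw [← mul_assoc (ε ^ (n + 1)), ← pow_succ] at hlink
    refine hlink.mono (ball_subset_ball' ?_)
    have hzi := (mem_ball.1 (hs i hi.le)).le
    calc K / (1 - ε) * (ε * R) + dist (z i) x₀ ≤ K / (1 - ε) * (ε * R) + K * R := by gcongr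
      _ = (K + K / (1 - ε) * ε) * R := by ring
      _ = K / (1 - ε) * R := by rw [hsum]

/-- If `(X,d)` is relatively `(ε,K)` ball connected for a single
`ε ∈ (0,1)` and `K > 1` (i.e. the chain condition holds at the single scale `ε` for some
integer `N`), then `(X,d)` is relatively `K'` ball connected with `K' = 1 + K/(1-ε)`. -/
theorem rbc_single_scale_implies_rbc
    {X : Type*} [MetricSpace X] (ε K : ℝ) (hε : ε ∈ Set.Ioo (0:ℝ) 1) (hK : 1 < K)
    (h : ∃ N : ℕ, ChainCond X ε K N) :
    IsRBC X (1 + K / (1 - ε)) := by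
  obtain ⟨N, hN⟩ := h
  intro ε' hε'
  obtain ⟨n, hn⟩ := exists_pow_lt_of_lt_one hε'.1 hε.2
  obtain ⟨M, hM⟩ := hN.exists_hasChain_pow hε (by linarith) n
  refine ⟨M, fun x₀ R hR x hx y hy => ?_⟩
  obtain ⟨z, h0, hz, hs, hd⟩ := hM x₀ R hR x hx y hy
  have hle : ε ^ (n + 1) ≤ ε' := (pow_le_pow_of_le_one hε.1.le hε.2.le n.le_succ).trans hn.le
  refine ⟨z, h0, hz, fun i hi => ball_subset_ball' ?_, fun i hi hiM => ?_⟩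
  · have hzi := mem_ball.1 (hs i hi)
    have hR' : ε' * R ≤ 1 * R := by gcongr; exact hε'.2.le
    linarith
  · obtain ⟨j, rfl⟩ := Nat.exists_eq_add_of_le' hi
    exact (hd j hiM).trans_le (by gcongr)
end

section
/- Let (X,d) be a metric space that is relatively K ball connected for some K > 1. Let x, y ∈ X with d(x,y) < R, let ε ∈ (0,1) and let r satisfy εR < r < R. Then there exist points z₀, …, z_n ∈ X such that: (i) z₀ = x, z_n = y and d(z_{i−1}, z_i) < εR for 1 ≤ i ≤ n; (ii) B(z_i, εR) ⊆ B(x, KR) for 0 ≤ i ≤ n; (iii) if j = max{ i : z_i ∈ B(x,r) }, then B(z_i, εR) ⊆ B(x, Kr) for 0 ≤ i ≤ j; (iv) n ≤ N_X(ε) + N_X(εR/r), where N_X(·) is the function from the relative ball connectedness condition. -/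
/-- regularization of chains.  Let `(X,d)` be relatively `K` ball
connected with chain function `Nf = N_X(·)`.  Let `d(x,y) < R`, `ε ∈ (0,1)` and
`ε R < r < R`.  Then there is a chain `z 0 = x, …, z n = y` such that:
(i) consecutive distances are `< ε R`;
(ii) `B(z i, ε R) ⊆ B(x, K R)` for `i ≤ n`;
(iii) if `j` is the last index with `z j ∈ B(x,r)`, then `B(z i, ε R) ⊆ B(x, K r)`
for all `i ≤ j`;
(iv) `n ≤ N_X(ε) + N_X(ε R / r)`. -/
theorem rbc_regularized_chain
    {X : Type*} [MetricSpace X] (K : ℝ) (hK : 1 < K)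
    (Nf : ℝ → ℕ) (hRBC : RBCWith X K Nf)
    (x y : X) (R : ℝ) (hd : dist x y < R)
    (ε : ℝ) (hε : ε ∈ Set.Ioo (0:ℝ) 1)
    (r : ℝ) (hr1 : ε * R < r) (hr2 : r < R) :
    ∃ n : ℕ, ∃ z : ℕ → X,
      (z 0 = x ∧ z n = y ∧ ∀ i, 1 ≤ i → i ≤ n → dist (z (i - 1)) (z i) < ε * R) ∧
      (∀ i ≤ n, Metric.ball (z i) (ε * R) ⊆ Metric.ball x (K * R)) ∧
      (∀ j ≤ n, (z j ∈ Metric.ball x r ∧ ∀ i, j < i → i ≤ n → z i ∉ Metric.ball x r) →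
        ∀ i ≤ j, Metric.ball (z i) (ε * R) ⊆ Metric.ball x (K * r)) ∧
      n ≤ Nf ε + Nf (ε * R / r) := by
  classical
  obtain ⟨hε0, hε1⟩ := hε
  have hR : 0 < R := dist_nonneg.trans_lt hd
  have hr : 0 < r := (mul_pos hε0 hR).trans hr1
  have hrad : ε * R / r * r = ε * R := div_mul_cancel₀ _ hr.ne'
  obtain ⟨z, hz0, hzN, hzb, hzd⟩ := hRBC ε ⟨hε0, hε1⟩ x R hR x
    (subset_closure (Metric.mem_ball_self hR)) y
    (subset_closure (Metric.mem_ball'.2 hd))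
  -- The last index at which the chain `z` visits the small ball.
  obtain ⟨m, hmN, hmr, hmax⟩ : ∃ m ≤ Nf ε, z m ∈ Metric.ball x r ∧
      ∀ i, m < i → i ≤ Nf ε → z i ∉ Metric.ball x r :=
    ⟨Nat.findGreatest (fun i => z i ∈ Metric.ball x r) (Nf ε), Nat.findGreatest_le _,
      Nat.findGreatest_spec (P := fun i => z i ∈ Metric.ball x r) (Nat.zero_le _)
        (by simpa [hz0] using hr),
      fun i hi hiN => Nat.findGreatest_is_greatest hi hiN⟩
  obtain ⟨u, hu0, huM, hub, hud⟩ := hRBC (ε * R / r)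
    ⟨div_pos (mul_pos hε0 hR) hr, (div_lt_one hr).2 hr1⟩ x r hr x
    (subset_closure (Metric.mem_ball_self hr)) (z m) (subset_closure hmr)
  simp only [hrad] at hub hud
  generalize Nf (ε * R / r) = M at *
  generalize Nf ε = N at *
  have hKr : Metric.ball x (K * r) ⊆ Metric.ball x (K * R) :=
    Metric.ball_subset_ball (by gcongr)
  let w : ℕ → X := fun i => if i ≤ M then u i else z (m + (i - M))
  have hwu : ∀ i ≤ M, w i = u i := fun i hi => if_pos hi
  have hwz : ∀ i, M ≤ i → w i = z (m + (i - M)) := by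
    intro i hi
    rcases hi.eq_or_lt with rfl | hi
    · simpa [w] using huM
    · exact if_neg hi.not_ge
  refine ⟨M + (N - m), w, ⟨?_, ?_, ?_⟩, ?_, ?_, by omega⟩
  · rw [hwu 0 (Nat.zero_le _), hu0]
  · rw [hwz _ (by omega), ← hzN]
    congr 1
    omega
  · intro i hi hin
    rcases le_or_gt i M with h | h
    · rw [hwu i h, hwu (i - 1) (by omega)]
      exact hud i hi h
    · rw [hwz i h.le, hwz (i - 1) (by omega),
        show m + (i - 1 - M) = m + (i - M) - 1 by omega]
      exact hzd _ (by omega) (by omega)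
  · intro i hin
    rcases le_or_gt i M with h | h
    · rw [hwu i h]
      exact (hub i h).trans hKr
    · rw [hwz i h.le]
      exact hzb _ (by omega)
  · rintro j hjn ⟨hj, -⟩ i hij
    have hjM : j ≤ M := by
      by_contra! h
      rw [hwz j h.le] at hj
      exact hmax _ (by omega) (by omega) hj
    rw [hwu i (hij.trans hjM)]
    exact hub i (hij.trans hjM)
end
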